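/- Let F : Σ → Σ be a measurable pseudo-Anosov map whose turbulations have the property that for any compatible positive measure tartans R and S there is a finite chain R = T_0, T_1, …, T_k = S of compatible positive measure tartans such that, for each i, the union of the stable streamlines containing fibers of T_i intersects the union of the unstable streamlines containing fibers of T_{i+1} in a set of positive μ-measure. Then F is ergodic with respect to μ. -/

import Mathlib

open MeasureTheory Set Function Topology Filter
open scoped ENNReal

noncomputable section

variable {S : Type} [TopologicalSpace S] [MeasurableSpace S]

/-- `d` is (the distance function of) a metric on `S` compatible with its topology. -/
def IsCompatibleMetric (S : Type) [TopologicalSpace S] (d : S → S → ℝ) : Prop :=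
  (∀ x y, d x y = d y x) ∧ (∀ x y, d x y = 0 ↔ x = y) ∧
  (∀ x y z, d x z ≤ d x y + d y z) ∧
  (∀ s : Set S, IsOpen s ↔ ∀ x ∈ s, ∃ ε > (0 : ℝ), ∀ y, d x y < ε → y ∈ s)

/-- An immersed line: a continuous injective image of `ℝ`. -/
def IsImmersedLine (ℓ : Set S) : Prop :=
  ∃ f : ℝ → S, Continuous f ∧ Function.Injective f ∧ Set.range f = ℓ

/-- `A` is a closed stream arc of the immersed line `ℓ` with endpoints `x` and `y`. -/
def IsArcIn (ℓ A : Set S) (x y : S) : Prop :=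
  ∃ f : ℝ → S, Continuous f ∧ Function.Injective f ∧ Set.range f = ℓ ∧
    ∃ a b : ℝ, a ≤ b ∧ f a = x ∧ f b = y ∧ A = f '' Set.Icc a b

/-- `A` is a closed stream arc of the immersed line `ℓ`. -/
def IsArc (ℓ A : Set S) : Prop := ∃ x y, IsArcIn ℓ A x y

/-- Topological transversality of two immersed lines at a point `x`: local pieces (arcs) of the
two lines through `x` are, in some chart around `x`, the two coordinate axes. -/
def TransverseAt (ℓ ℓ' : Set S) (x : S) : Prop :=
  ∃ α β : Set S, x ∈ α ∧ x ∈ β ∧ IsArc ℓ α ∧ IsArc ℓ' β ∧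
    ∃ U : Set S, IsOpen U ∧ x ∈ U ∧ ∃ e : U ≃ₜ ℝ × ℝ,
      Subtype.val '' (⇑e ⁻¹' {p : ℝ × ℝ | p.2 = 0}) = α ∩ U ∧
      Subtype.val '' (⇑e ⁻¹' {p : ℝ × ℝ | p.1 = 0}) = β ∩ U

/-- The (manifold) boundary of the surface `S`: points having no neighbourhood
homeomorphic to the plane. -/
def ManifoldBdry (S : Type) [TopologicalSpace S] : Set S :=
  {x : S | ¬ ∃ U : Set S, IsOpen U ∧ x ∈ U ∧ Nonempty (U ≃ₜ ℝ × ℝ)}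

/-- An Oxtoby–Ulam (OU) measure on the compact surface `S`: Borel (via the ambient
`BorelSpace` assumption), non-atomic, positive on non-empty open sets, and vanishing on
the boundary of `S`. -/
structure IsOUMeasure (μ : Measure S) : Prop where
  noAtoms : ∀ x : S, μ {x} = 0
  openPos : ∀ U : Set S, IsOpen U → U.Nonempty → 0 < μ U
  boundaryNull : μ (ManifoldBdry S) = 0

/-- A measured turbulation on `S` (with ambient measure `μ`): a partition of a full
`μ`-measure Borel subset of `S` into streamlines (immersed lines), together with an
OU measure on each streamline which is finite on closed stream arcs. -/
structure MeasuredTurbulation (μ : Measure S) where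
  lines : Set (Set S)
  lines_immersed : ∀ ℓ ∈ lines, IsImmersedLine ℓ
  lines_disjoint : lines.PairwiseDisjoint id
  domain_borel : MeasurableSet (⋃₀ lines)
  domain_full : μ (⋃₀ lines) = 1
  ν : Set S → Measure S
  ν_supported : ∀ ℓ ∈ lines, ν ℓ ℓᶜ = 0
  ν_nonatomic : ∀ ℓ ∈ lines, ∀ x : S, ν ℓ {x} = 0
  ν_arc_pos : ∀ ℓ ∈ lines, ∀ A : Set S, ∀ x y : S, IsArcIn ℓ A x y → x ≠ y → 0 < ν ℓ A
  ν_arc_finite : ∀ ℓ ∈ lines, ∀ A : Set S, ∀ x y : S, IsArcIn ℓ A x y → ν ℓ A < ⊤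

namespace MeasuredTurbulation

variable {μ : Measure S}

/-- Tameness with respect to a given metric `d`: stream arcs of small stream measure are small. -/
def TameWith (T : MeasuredTurbulation μ) (d : S → S → ℝ) : Prop :=
  ∀ ε : ℝ, 0 < ε → ∃ δ : ℝ, 0 < δ ∧
    ∀ ℓ ∈ T.lines, ∀ A : Set S, ∀ x y : S,
      IsArcIn ℓ A x y → T.ν ℓ A < ENNReal.ofReal δ → d x y < ε

/-- A measured turbulation is tame if it is tame with respect to (every, equivalently some)
metric on `S` compatible with its topology. -/
def Tame (T : MeasuredTurbulation μ) : Prop :=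
  ∀ d : S → S → ℝ, IsCompatibleMetric S d → T.TameWith d

/-- Every streamline is dense in `S`. -/
def DenseStreamlines (T : MeasuredTurbulation μ) : Prop := ∀ ℓ ∈ T.lines, Dense ℓ

/-- Two measured turbulations are transverse if almost every point lies on streamlines of both
which intersect transversely there. -/
def TransversePair (Ts Tu : MeasuredTurbulation μ) : Prop :=
  ∃ W : Set S, MeasurableSet W ∧ μ W = 1 ∧
    ∀ x ∈ W, ∃ ℓ ∈ Ts.lines, ∃ ℓ' ∈ Tu.lines, x ∈ ℓ ∧ x ∈ ℓ' ∧ TransverseAt ℓ ℓ' x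

end MeasuredTurbulation

/-- A tartan for the (stable, unstable) pair of measured turbulations `(Ts, Tu)`. -/
structure Tartan {μ : Measure S} (Ts Tu : MeasuredTurbulation μ) where
  Rs : Set S
  Ru : Set S
  borel_s : MeasurableSet Rs
  borel_u : MeasurableSet Ru
  fibs : Set (Set S)
  fibu : Set (Set S)
  fibs_disjoint : fibs.PairwiseDisjoint id
  fibu_disjoint : fibu.PairwiseDisjoint id
  fibs_cover : ⋃₀ fibs = Rs
  fibu_cover : ⋃₀ fibu = Ru
  /-- (a) every stable fiber meets every unstable fiber in exactly one point. -/
  inter_unique : ∀ A ∈ fibs, ∀ B ∈ fibu, ∃! z : S, z ∈ A ∩ B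
  /-- The fibers are stream arcs of the corresponding turbulations, and (b) they can be
  oriented consistently: every stable fiber crosses the unstable fibers in the same order,
  and vice versa. -/
  oriented : ∃ ords ordu : Set S → S → S → Prop,
    (∀ A ∈ fibs, ∃ ℓ ∈ Ts.lines, ∃ f : ℝ → S, Continuous f ∧ Function.Injective f ∧
        Set.range f = ℓ ∧ ∃ a b : ℝ, a ≤ b ∧ A = f '' Set.Icc a b ∧
        ∀ s ∈ Set.Icc a b, ∀ t ∈ Set.Icc a b, (ords A (f s) (f t) ↔ s ≤ t)) ∧
    (∀ B ∈ fibu, ∃ ℓ ∈ Tu.lines, ∃ f : ℝ → S, Continuous f ∧ Function.Injective f ∧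
        Set.range f = ℓ ∧ ∃ a b : ℝ, a ≤ b ∧ B = f '' Set.Icc a b ∧
        ∀ s ∈ Set.Icc a b, ∀ t ∈ Set.Icc a b, (ordu B (f s) (f t) ↔ s ≤ t)) ∧
    (∀ A ∈ fibs, ∀ A' ∈ fibs, ∀ B ∈ fibu, ∀ B' ∈ fibu,
      ∀ p ∈ A ∩ B, ∀ q ∈ A ∩ B', ∀ p' ∈ A' ∩ B, ∀ q' ∈ A' ∩ B',
        (ords A p q ↔ ords A' p' q')) ∧
    (∀ B ∈ fibu, ∀ B' ∈ fibu, ∀ A ∈ fibs, ∀ A' ∈ fibs,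
      ∀ p ∈ B ∩ A, ∀ q ∈ B ∩ A', ∀ p' ∈ B' ∩ A, ∀ q' ∈ B' ∩ A',
        (ordu B p q ↔ ordu B' p' q'))
  /-- (c) the stream measures of the fibers are bounded above. -/
  bounded : ∃ L : ℝ≥0∞, L < ⊤ ∧
    (∀ A ∈ fibs, ∀ ℓ ∈ Ts.lines, A ⊆ ℓ → Ts.ν ℓ A ≤ L) ∧
    (∀ B ∈ fibu, ∀ ℓ ∈ Tu.lines, B ⊆ ℓ → Tu.ν ℓ B ≤ L)
  /-- (d) `Rs ∪ Ru` is contained in an open topological disk. -/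
  in_disk : ∃ U : Set S, IsOpen U ∧ Rs ∪ Ru ⊆ U ∧ Nonempty (U ≃ₜ ℝ × ℝ)

namespace Tartan

variable {μ : Measure S} {Ts Tu : MeasuredTurbulation μ}

/-- The set `R^⋔` of tartan intersection points. -/
def core (R : Tartan Ts Tu) : Set S := R.Rs ∩ R.Ru

/-- The tartan `R` is compatible with the ambient measure `μ`: for all stable and unstable
fibers `𝔰`, `𝔲`, the bijection `ψ : E^𝔰 × E^𝔲 → R^⋔`, `(x, y) ↦ 𝔲(x) ⋔ 𝔰(y)`, is
bi-measurable and pushes `ν_𝔰 × ν_𝔲` forward to `μ` restricted to `R^⋔`. -/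
def Compatible (R : Tartan Ts Tu) : Prop :=
  ∀ 𝔰 ∈ R.fibs, ∀ 𝔲 ∈ R.fibu,
  ∀ ℓs ∈ Ts.lines, 𝔰 ⊆ ℓs → ∀ ℓu ∈ Tu.lines, 𝔲 ⊆ ℓu →
  ∃ ψ : S × S → S,
    (∀ x ∈ 𝔰 ∩ R.core, ∀ y ∈ 𝔲 ∩ R.core,
      ∀ B ∈ R.fibu, x ∈ B → ∀ A ∈ R.fibs, y ∈ A → ψ (x, y) ∈ B ∩ A) ∧
    Set.InjOn ψ ((𝔰 ∩ R.core) ×ˢ (𝔲 ∩ R.core)) ∧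
    ψ '' ((𝔰 ∩ R.core) ×ˢ (𝔲 ∩ R.core)) = R.core ∧
    Measurable ψ ∧
    (∀ E : Set (S × S), E ⊆ (𝔰 ∩ R.core) ×ˢ (𝔲 ∩ R.core) → MeasurableSet E →
      MeasurableSet (ψ '' E)) ∧
    Measure.map ψ (((Ts.ν ℓs).restrict (𝔰 ∩ R.core)).prod
      ((Tu.ν ℓu).restrict (𝔲 ∩ R.core))) = μ.restrict R.core

/-- Image of `B ⊆ E^𝔰` under the holonomy map `h_{𝔰,𝔰'} : E^𝔰 → E^{𝔰'}`, `x ↦ 𝔲(x) ⋔ 𝔰'`. -/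
def holSS (R : Tartan Ts Tu) (𝔰' B : Set S) : Set S :=
  {x' : S | ∃ x ∈ B, ∃ Bu ∈ R.fibu, x ∈ Bu ∧ x' ∈ Bu ∩ 𝔰'}

/-- Image of `B ⊆ E^𝔲` under the holonomy map `h_{𝔲,𝔲'} : E^𝔲 → E^{𝔲'}`, `y ↦ 𝔰(y) ⋔ 𝔲'`. -/
def holUU (R : Tartan Ts Tu) (𝔲' B : Set S) : Set S :=
  {y' : S | ∃ y ∈ B, ∃ A ∈ R.fibs, y ∈ A ∧ y' ∈ A ∩ 𝔲'}

/-- "`𝔲(x) ⋔ 𝔰(y) ∈ A`": the intersection point of the unstable fiber through `x` and the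
stable fiber through `y` belongs to `A`. -/
def sectMem (R : Tartan Ts Tu) (A : Set S) (x y : S) : Prop :=
  ∃ B ∈ R.fibu, x ∈ B ∧ ∃ C ∈ R.fibs, y ∈ C ∧ ∃ z ∈ B ∩ C, z ∈ A

/-- `ν_{𝔲(x)}(A ∩ 𝔲(x))`: the stream measure of `A` along the unstable fiber through `x`. -/
def fiberMeasU (R : Tartan Ts Tu) (A : Set S) (x : S) : ℝ≥0∞ :=
  ⨆ (B : Set S) (_ : B ∈ R.fibu) (_ : x ∈ B) (ℓ : Set S) (_ : ℓ ∈ Tu.lines) (_ : B ⊆ ℓ),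
    Tu.ν ℓ (A ∩ B)

/-- `ν_{𝔰(y)}(A ∩ 𝔰(y))`: the stream measure of `A` along the stable fiber through `y`. -/
def fiberMeasS (R : Tartan Ts Tu) (A : Set S) (y : S) : ℝ≥0∞ :=
  ⨆ (C : Set S) (_ : C ∈ R.fibs) (_ : y ∈ C) (ℓ : Set S) (_ : ℓ ∈ Ts.lines) (_ : C ⊆ ℓ),
    Ts.ν ℓ (A ∩ C)

end Tartan

/-- The union of the stable streamlines containing fibers of `R`. -/
def stableSaturation {μ : Measure S} {Ts Tu : MeasuredTurbulation μ} (R : Tartan Ts Tu) :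
    Set S :=
  ⋃₀ {ℓ : Set S | ℓ ∈ Ts.lines ∧ ∃ A ∈ R.fibs, A ⊆ ℓ}

/-- The union of the unstable streamlines containing fibers of `R`. -/
def unstableSaturation {μ : Measure S} {Ts Tu : MeasuredTurbulation μ} (R : Tartan Ts Tu) :
    Set S :=
  ⋃₀ {ℓ : Set S | ℓ ∈ Tu.lines ∧ ∃ B ∈ R.fibu, B ⊆ ℓ}

/-- The pair `(Ts, Tu)` is full: countably many compatible tartans cover a full measure
subset of `S`, and every non-empty open set contains a positive measure compatible tartan. -/
def FullPair {μ : Measure S} (Ts Tu : MeasuredTurbulation μ) : Prop :=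
  (∃ R : ℕ → Tartan Ts Tu, (∀ i, (R i).Compatible) ∧ μ (⋃ i, (R i).core) = 1) ∧
  (∀ U : Set S, IsOpen U → U.Nonempty →
    ∃ R : Tartan Ts Tu, R.Compatible ∧ 0 < μ R.core ∧ R.Rs ∪ R.Ru ⊆ U)

/-- `(Ts, Tu)` are measurable pseudo-Anosov turbulations: transverse, tame, full, with
dense streamlines. -/
def MPATurbulations {μ : Measure S} (Ts Tu : MeasuredTurbulation μ) : Prop :=
  Ts.TransversePair Tu ∧ Ts.Tame ∧ Tu.Tame ∧ FullPair Ts Tu ∧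
    Ts.DenseStreamlines ∧ Tu.DenseStreamlines

/-- `F` is a measurable pseudo-Anosov homeomorphism with invariant turbulations `(Ts, Tu)`
and dilatation `lam > 1`. -/
structure IsMPA (μ : Measure S) (F : S ≃ₜ S) (Ts Tu : MeasuredTurbulation μ)
    (lam : ℝ) : Prop where
  measurePreserving : MeasurePreserving (⇑F) μ μ
  one_lt_lam : 1 < lam
  turbulations : MPATurbulations Ts Tu
  stable_image : ∀ ℓ ∈ Ts.lines, ⇑F '' ℓ ∈ Ts.lines
  unstable_image : ∀ ℓ ∈ Tu.lines, ⇑F '' ℓ ∈ Tu.lines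
  stable_contract : ∀ ℓ ∈ Ts.lines, ∀ A : Set S, ∀ x y : S, IsArcIn ℓ A x y →
    Ts.ν (⇑F '' ℓ) (⇑F '' A) = (ENNReal.ofReal lam)⁻¹ * Ts.ν ℓ A
  unstable_expand : ∀ ℓ ∈ Tu.lines, ∀ A : Set S, ∀ x y : S, IsArcIn ℓ A x y →
    Tu.ν (⇑F '' ℓ) (⇑F '' A) = ENNReal.ofReal lam * Tu.ν ℓ A

/-- `x` is a (two-sided) density point of `D` along the streamline `ℓ` of `T`. -/
def DensityPtAlong {μ : Measure S} (T : MeasuredTurbulation μ) (ℓ D : Set S) (x : S) :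
    Prop :=
  ∀ ε : ℝ, 0 < ε → ∃ δ : ℝ, 0 < δ ∧ ∀ A : Set S, ∀ y : S,
    IsArcIn ℓ A x y → T.ν ℓ A < ENNReal.ofReal δ →
      (1 - ε) * (T.ν ℓ A).toReal ≤ (T.ν ℓ (A ∩ D)).toReal

/-- The set `den_k(R)` of level `k` density points of the tartan `R`. -/
def denSet {μ : Measure S} {Ts Tu : MeasuredTurbulation μ} (R : Tartan Ts Tu) :
    ℕ → Set S
  | 0 => R.core
  | k + 1 =>
    {x : S | x ∈ denSet R k ∧
      (∀ ℓ ∈ Ts.lines, x ∈ ℓ → DensityPtAlong Ts ℓ (denSet R k) x) ∧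
      (∀ ℓ ∈ Tu.lines, x ∈ ℓ → DensityPtAlong Tu ℓ (denSet R k) x)}

/-- The set `X_{δ,η}(R)`: points of `R^⋔` all of whose stable and unstable stream arcs of
measure less than `η` contain points of `R^⋔` in density at least `1 - δ`. -/
def Xset {μ : Measure S} {Ts Tu : MeasuredTurbulation μ} (R : Tartan Ts Tu)
    (δ η : ℝ) : Set S :=
  {x : S | x ∈ R.core ∧
    (∀ ℓ ∈ Ts.lines, x ∈ ℓ → ∀ A : Set S, ∀ y : S, IsArcIn ℓ A x y →
      Ts.ν ℓ A < ENNReal.ofReal η →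
        ENNReal.ofReal (1 - δ) * Ts.ν ℓ A ≤ Ts.ν ℓ (A ∩ R.core)) ∧
    (∀ ℓ ∈ Tu.lines, x ∈ ℓ → ∀ A : Set S, ∀ y : S, IsArcIn ℓ A x y →
      Tu.ν ℓ A < ENNReal.ofReal η →
        ENNReal.ofReal (1 - δ) * Tu.ν ℓ A ≤ Tu.ν ℓ (A ∩ R.core))}

/-- A regular tartan: for `y ∈ 𝔰(x) ∩ R^⋔` and `z ∈ 𝔲(x) ∩ R^⋔` at small stream distance
from `x`, all the fibers of the subtartan `R(y,z)` (the subarcs of stable fibers running from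
`𝔲(y)` to `𝔲(z) = 𝔲(x)`, and of unstable fibers running from `𝔰(y) = 𝔰(x)` to `𝔰(z)`)
are contained in `U`. -/
def Tartan.Regular {μ : Measure S} {Ts Tu : MeasuredTurbulation μ}
    (R : Tartan Ts Tu) : Prop :=
  ∀ x ∈ R.core, ∀ U ∈ 𝓝 x, ∃ δ : ℝ, 0 < δ ∧
    ∀ 𝔰x ∈ R.fibs, x ∈ 𝔰x → ∀ 𝔲x ∈ R.fibu, x ∈ 𝔲x →
    ∀ y ∈ 𝔰x ∩ R.core, ∀ z ∈ 𝔲x ∩ R.core,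
    (∀ ℓ ∈ Ts.lines, 𝔰x ⊆ ℓ → ∀ α : Set S, IsArcIn ℓ α x y →
      Ts.ν ℓ α < ENNReal.ofReal δ) →
    (∀ ℓ ∈ Tu.lines, 𝔲x ⊆ ℓ → ∀ α : Set S, IsArcIn ℓ α x z →
      Tu.ν ℓ α < ENNReal.ofReal δ) →
    ∀ 𝔲y ∈ R.fibu, y ∈ 𝔲y → ∀ 𝔰z ∈ R.fibs, z ∈ 𝔰z →
      ((∀ A ∈ R.fibs, ∀ p q : S, p ∈ A ∩ 𝔲y → q ∈ A ∩ 𝔲x →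
          ∀ ℓ ∈ Ts.lines, A ⊆ ℓ → ∀ α : Set S, IsArcIn ℓ α p q → α ⊆ U) ∧
       (∀ B ∈ R.fibu, ∀ p q : S, p ∈ B ∩ 𝔰x → q ∈ B ∩ 𝔰z →
          ∀ ℓ ∈ Tu.lines, B ⊆ ℓ → ∀ β : Set S, IsArcIn ℓ β p q → β ⊆ U))

/-- A (stable) bi-Lipschitz regular tartan: for some metric compatible with the topology of
`S` and some `K ≥ 1`, stream measure and distance are `K`-bi-Lipschitz comparable along
stable fibers. -/
def Tartan.StableBiLipschitzRegular {μ : Measure S} {Ts Tu : MeasuredTurbulation μ}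
    (R : Tartan Ts Tu) : Prop :=
  ∃ d : S → S → ℝ, IsCompatibleMetric S d ∧ ∃ K : ℝ, 1 ≤ K ∧
    ∀ 𝔰 ∈ R.fibs, ∀ x ∈ 𝔰, ∀ y ∈ 𝔰, ∀ ℓ ∈ Ts.lines, 𝔰 ⊆ ℓ →
      ∀ α : Set S, IsArcIn ℓ α x y →
        d x y / K ≤ (Ts.ν ℓ α).toReal ∧ (Ts.ν ℓ α).toReal ≤ K * d x y

/-- The turbulation `T` has partial flowboxes: if `x` and `y` lie on the same streamline
`ℓ`, and arcs transverse to `ℓ` at `x` and `y` contain transverse intersections with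
streamlines of `T` arbitrarily close to `x` and `y` on the same side of `ℓ`, then every
neighbourhood `U` of the stream arc `[x,y]` contains other stream arcs with endpoints on the
two transversals.  (The transversals and the side are encoded via a chart straightening the
streamline.) -/
def HasPartialFlowboxes {μ : Measure S} (T : MeasuredTurbulation μ) : Prop :=
  ∀ ℓ ∈ T.lines, ∀ x y : S, ∀ A : Set S, IsArcIn ℓ A x y →
  ∀ V : Set S, IsOpen V → ∀ e : V ≃ₜ ℝ × ℝ, A ⊆ V →
  (Subtype.val '' (⇑e ⁻¹' {p : ℝ × ℝ | p.2 = 0}) ⊆ ℓ) →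
  (∃ hx : x ∈ V, e ⟨x, hx⟩ = (0, 0)) →
  (∃ hy : y ∈ V, e ⟨y, hy⟩ = (1, 0)) →
  (∀ ε : ℝ, 0 < ε → ∃ p : S, ∃ hp : p ∈ V,
      (e ⟨p, hp⟩).1 = 0 ∧ 0 < (e ⟨p, hp⟩).2 ∧ (e ⟨p, hp⟩).2 < ε ∧
      ∃ ℓ' ∈ T.lines, p ∈ ℓ' ∧
        TransverseAt ℓ' (Subtype.val '' (⇑e ⁻¹' {q : ℝ × ℝ | q.1 = 0})) p) →
  (∀ ε : ℝ, 0 < ε → ∃ p : S, ∃ hp : p ∈ V,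
      (e ⟨p, hp⟩).1 = 1 ∧ 0 < (e ⟨p, hp⟩).2 ∧ (e ⟨p, hp⟩).2 < ε ∧
      ∃ ℓ' ∈ T.lines, p ∈ ℓ' ∧
        TransverseAt ℓ' (Subtype.val '' (⇑e ⁻¹' {q : ℝ × ℝ | q.1 = 1})) p) →
  ∀ U : Set S, IsOpen U → A ⊆ U →
    ∃ ℓ'' ∈ T.lines, ∃ A'' : Set S, ∃ x'' y'' : S, IsArcIn ℓ'' A'' x'' y'' ∧
      A'' ⊆ U ∧ A'' ≠ A ∧
      x'' ∈ Subtype.val '' (⇑e ⁻¹' {q : ℝ × ℝ | q.1 = 0}) ∧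
      y'' ∈ Subtype.val '' (⇑e ⁻¹' {q : ℝ × ℝ | q.1 = 1})

/-- Forward Birkhoff averages of `φ` under the homeomorphism `F`. -/
def birkhoffFwd (F : S ≃ₜ S) (φ : S → ℝ) (x : S) (n : ℕ) : ℝ :=
  (n : ℝ)⁻¹ * ∑ i ∈ Finset.range n, φ ((⇑F)^[i] x)

/-- Backward Birkhoff averages of `φ` under the homeomorphism `F`. -/
def birkhoffBwd (F : S ≃ₜ S) (φ : S → ℝ) (x : S) (n : ℕ) : ℝ :=
  (n : ℝ)⁻¹ * ∑ i ∈ Finset.range n, φ ((⇑F.symm)^[i] x)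

/-- The set `Z` of points where the forward and backward Birkhoff averages of `φ` exist
and are equal. -/
def ZSet (F : S ≃ₜ S) (φ : S → ℝ) : Set S :=
  {x : S | ∃ c : ℝ, Tendsto (birkhoffFwd F φ x) atTop (𝓝 c) ∧
      Tendsto (birkhoffBwd F φ x) atTop (𝓝 c)}

/-- The relation `~` on `Z`: `x ~ y` if they are joined by a finite chain of stream arcs
whose consecutive intersections contain points of `Z`. -/
def StreamRel {μ : Measure S} (Ts Tu : MeasuredTurbulation μ) (F : S ≃ₜ S)
    (φ : S → ℝ) (x y : S) : Prop :=
  x ∈ ZSet F φ ∧ y ∈ ZSet F φ ∧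
  (x = y ∨ ∃ k : ℕ, ∃ α : Fin (k + 1) → Set S,
    (∀ i, (∃ ℓ ∈ Ts.lines, IsArc ℓ (α i)) ∨ (∃ ℓ ∈ Tu.lines, IsArc ℓ (α i))) ∧
    x ∈ α 0 ∧ y ∈ α (Fin.last k) ∧
    ∀ i : Fin k, ∃ z ∈ α i.castSucc ∩ α i.succ, z ∈ ZSet F φ)


/-! ### A planarity lemma: three paths systems joining `a i` to `b j` cannot be disjoint -/

lemma exists_continuous_log {X : Type*} [TopologicalSpace X] [SimplyConnectedSpace X]
    [LocallyPathConnectedSpace X] (g : C(X, ℂ)) (hg : ∀ x, g x ≠ 0) :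
    ∃ L : C(X, ℂ), ∀ x, Complex.exp (L x) = g x := by
  obtain ⟨x₀⟩ : Nonempty X := inferInstance
  obtain ⟨L, ⟨-, hL⟩, -⟩ := Complex.isCoveringMapOn_exp.existsUnique_continuousMap_lifts g
    (Complex.exp_log (hg x₀)) (fun x => hg x)
  exact ⟨L, fun x => congrFun hL x⟩

lemma increment_eq_of_exp_eq {g h : ℝ → ℂ} (hg : Continuous g) (hh : Continuous h) (c : ℂ)
    (e : ∀ x, Complex.exp (g x) = c * Complex.exp (h x)) (x y : ℝ) :
    g x - g y = h x - h y := by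
  have hk : Continuous fun t => g t - h t := hg.sub hh
  have hc : ∀ t, Complex.exp (g t - h t) = c := fun t => by
    rw [Complex.exp_sub, e t, mul_div_cancel_right₀ _ (Complex.exp_ne_zero _)]
  obtain ⟨n, hn⟩ : ∃ n : ℝ → ℤ, ∀ t, g t - h t = g y - h y + n t * (2 * Real.pi * Complex.I) := by
    choose n hn using fun t => Complex.exp_eq_exp_iff_exists_int.1 ((hc t).trans (hc y).symm)
    exact ⟨n, hn⟩
  have hpi : (2 * Real.pi * Complex.I : ℂ) ≠ 0 := Complex.two_pi_I_ne_zero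
  have hn' : ∀ t, ((n t : ℝ)) = ((g t - h t - (g y - h y)) / (2 * Real.pi * Complex.I)).re := by
    intro t
    rw [hn t, add_sub_cancel_left, mul_div_cancel_right₀ _ hpi]
    simp
  have hcont : Continuous n := by
    have : Continuous fun t => (n t : ℝ) := by
      simp_rw [hn']
      fun_prop
    exact Int.isClosedEmbedding_coe_real.isInducing.continuous_iff.2 this
  have hconst : n x = n y := PreconnectedSpace.constant inferInstance hcont
  have h1 := hn x
  have h2 := hn y
  rw [hconst] at h1
  linear_combination h1 - h2

lemma exp_add_pi_I (z : ℂ) : Complex.exp (z + Real.pi * Complex.I) = - Complex.exp z := by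
  rw [Complex.exp_add, Complex.exp_pi_mul_I]; ring

/-- Logarithms of differences of distinct points, odd up to the prescribed branch. -/
lemma exists_logs_sub (a : Fin 3 → ℂ) (ha : ∀ i k, i ≠ k → a i ≠ a k) :
    ∃ l : Fin 3 → Fin 3 → ℂ, (∀ i k, i ≠ k → Complex.exp (l i k) = a i - a k) ∧
      ∀ i k, i < k → l k i = l i k + Real.pi * Complex.I := by
  refine ⟨fun i k => if i < k then Complex.log (a i - a k)
    else Complex.log (a k - a i) + Real.pi * Complex.I, ?_, ?_⟩
  · intro i k hik
    by_cases h : i < k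
    · simp only [h, if_true]
      exact Complex.exp_log (sub_ne_zero.2 (ha i k hik))
    · simp only [h, if_false]
      rw [exp_add_pi_I, Complex.exp_log (sub_ne_zero.2 (ha k i hik.symm))]
      ring
  · intro i k hik
    simp [hik, not_lt.2 hik.le]

theorem not_disjoint_paths_complex (a b : Fin 3 → ℂ) (γ : Fin 3 → Fin 3 → ℝ → ℂ)
    (hγ : ∀ i j, Continuous (γ i j)) (h0 : ∀ i j, γ i j 0 = a i) (h1 : ∀ i j, γ i j 1 = b j)
    (hd : ∀ i j k l, i ≠ k → j ≠ l → ∀ s t, γ i j s ≠ γ k l t) : False := by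
  have other : ∀ i : Fin 3, ∃ j, j ≠ i := by decide
  have haa : ∀ i k, i ≠ k → a i ≠ a k := fun i k hik => by
    have := hd i 0 k 1 hik (by decide) 0 0
    rwa [h0, h0] at this
  have hbb : ∀ j l, j ≠ l → b j ≠ b l := fun j l hjl => by
    have := hd 0 j 1 l (by decide) hjl 1 1
    rwa [h1, h1] at this
  have hγa : ∀ k i j, k ≠ i → ∀ s, γ i j s - a k ≠ 0 := fun k i j hk s => by
    obtain ⟨l, hl⟩ := other j
    have := hd i j k l hk.symm hl.symm s 0
    rw [h0] at this
    exact sub_ne_zero.2 this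
  have hγb : ∀ l i j, l ≠ j → ∀ s, γ i j s - b l ≠ 0 := fun l i j hl s => by
    obtain ⟨k, hk⟩ := other i
    have := hd i j k l hk.symm hl.symm s 1
    rw [h1] at this
    exact sub_ne_zero.2 this
  have hba : ∀ k j, b j - a k ≠ 0 := fun k j => by
    obtain ⟨i, hi⟩ := other k
    have := hγa k i j hi.symm 1
    rwa [h1] at this
  obtain ⟨la, hla, hla'⟩ := exists_logs_sub a haa
  obtain ⟨lb, hlb, hlb'⟩ := exists_logs_sub b hbb
  have hA : ∀ k i j, ∃ L : ℝ → ℂ, k ≠ i → Continuous L ∧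
      ∀ s, Complex.exp (L s) = γ i j s - a k := fun k i j => by
    by_cases hk : k ≠ i
    · obtain ⟨L, hL⟩ := exists_continuous_log ⟨fun s => γ i j s - a k, by have := hγ i j; fun_prop⟩
        (hγa k i j hk)
      exact ⟨L, fun _ => ⟨L.continuous, hL⟩⟩
    · exact ⟨0, fun h => absurd h hk⟩
  choose LA hLA using hA
  have hB : ∀ l i j, ∃ L : ℝ → ℂ, l ≠ j → Continuous L ∧
      ∀ s, Complex.exp (L s) = γ i j s - b l := fun k i j => by
    by_cases hk : k ≠ j
    · obtain ⟨L, hL⟩ := exists_continuous_log ⟨fun s => γ i j s - b k, by have := hγ i j; fun_prop⟩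
        (hγb k i j hk)
      exact ⟨L, fun _ => ⟨L.continuous, hL⟩⟩
    · exact ⟨0, fun h => absurd h hk⟩
  choose LB hLB using hB
  have hsq : ∀ i j k l, i ≠ k → j ≠ l →
      (LA k i j 1 - LA k i j 0) + (LB j k l 1 - LB j k l 0) =
      (LA i k l 1 - LA i k l 0) + (LB l i j 1 - LB l i j 0) := by
    intro i j k l hik hjl
    obtain ⟨L, hL⟩ := exists_continuous_log (X := ℝ × ℝ)
      ⟨fun p => γ i j p.1 - γ k l p.2, by have := hγ i j; have := hγ k l; fun_prop⟩
      (fun p => sub_ne_zero.2 (hd i j k l hik hjl p.1 p.2))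
    simp only [ContinuousMap.coe_mk] at hL
    have e1 := increment_eq_of_exp_eq (g := fun s => L (s, 0)) (h := LA k i j) (by fun_prop)
      (hLA k i j hik.symm).1 1 (fun s => by rw [hL, (hLA k i j hik.symm).2, h0]; ring) 1 0
    have e2 := increment_eq_of_exp_eq (g := fun s => L (1, s)) (h := LB j k l) (by fun_prop)
      (hLB j k l hjl).1 (-1) (fun s => by rw [hL, (hLB j k l hjl).2, h1]; ring) 1 0
    have e3 := increment_eq_of_exp_eq (g := fun s => L (0, s)) (h := LA i k l) (by fun_prop)
      (hLA i k l hik).1 (-1) (fun s => by rw [hL, (hLA i k l hik).2, h0]; ring) 1 0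
    have e4 := increment_eq_of_exp_eq (g := fun s => L (s, 1)) (h := LB l i j) (by fun_prop)
      (hLB l i j hjl.symm).1 1 (fun s => by rw [hL, (hLB l i j hjl.symm).2, h1]; ring) 1 0
    rw [← e1, ← e2, ← e3, ← e4]
    ring
  have hn : ∀ k i j, ∃ n : ℤ, k ≠ i → LA k i j 1 - LA k i j 0 =
      Complex.log (b j - a k) - la i k + n * (2 * Real.pi * Complex.I) := fun k i j => by
    by_cases hk : k ≠ i
    · obtain ⟨n, hn⟩ := Complex.exp_eq_exp_iff_exists_int.1
        (show Complex.exp (LA k i j 1 - LA k i j 0) = Complex.exp (Complex.log (b j - a k) - la i k)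
        by rw [Complex.exp_sub, Complex.exp_sub, (hLA k i j hk).2, (hLA k i j hk).2, h0, h1,
            Complex.exp_log (hba k j), hla i k hk.symm])
      exact ⟨n, fun _ => hn⟩
    · exact ⟨0, fun h => absurd h hk⟩
  choose n hn using hn
  have hm : ∀ l i j, ∃ m : ℤ, l ≠ j → LB l i j 1 - LB l i j 0 =
      lb j l - (Complex.log (b l - a i) + Real.pi * Complex.I) + m * (2 * Real.pi * Complex.I) :=
    fun l i j => by
    by_cases hl : l ≠ j
    · obtain ⟨n, hn⟩ := Complex.exp_eq_exp_iff_exists_int.1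
        (show Complex.exp (LB l i j 1 - LB l i j 0) =
          Complex.exp (lb j l - (Complex.log (b l - a i) + Real.pi * Complex.I))
        by rw [Complex.exp_sub, Complex.exp_sub, (hLB l i j hl).2, (hLB l i j hl).2, h0, h1,
            exp_add_pi_I, Complex.exp_log (hba i l), hlb j l hl.symm]; ring)
      exact ⟨n, fun _ => hn⟩
    · exact ⟨0, fun h => absurd h hl⟩
  choose m hm using hm
  have key : ∀ i j k l, i < k → j ≠ l →
      n k i j - n i k l - m l i j + m j k l = if j < l then (-1 : ℤ) else 0 := by
    intro i j k l hik hjl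
    have e := hsq i j k l hik.ne hjl
    rw [hn k i j hik.ne', hm j k l hjl, hn i k l hik.ne, hm l i j hjl.symm, hla' i k hik] at e
    have hpi := Complex.two_pi_I_ne_zero
    rcases lt_or_gt_of_ne hjl with h | h
    · rw [hlb' j l h] at e
      rw [if_pos h]
      have : ((n k i j - n i k l - m l i j + m j k l : ℤ) : ℂ) = ((-1 : ℤ) : ℂ) := by
        apply mul_right_cancel₀ hpi
        push_cast
        linear_combination e
      exact_mod_cast this
    · rw [hlb' l j h] at e
      rw [if_neg h.not_gt]
      have : ((n k i j - n i k l - m l i j + m j k l : ℤ) : ℂ) = ((0 : ℤ) : ℂ) := by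
        apply mul_right_cancel₀ hpi
        push_cast
        linear_combination e
      exact_mod_cast this
  have k1 := fun j l h => key 0 j 1 l (by decide) h
  have k2 := fun j l h => key 0 j 2 l (by decide) h
  have k3 := fun j l h => key 1 j 2 l (by decide) h
  have a1 := k1 0 1 (by decide); have a2 := k1 0 2 (by decide); have a3 := k1 1 2 (by decide)
  have a4 := k1 1 0 (by decide); have a5 := k1 2 0 (by decide); have a6 := k1 2 1 (by decide)
  have b1 := k2 0 1 (by decide); have b2 := k2 0 2 (by decide); have b3 := k2 1 2 (by decide)
  have b4 := k2 1 0 (by decide); have b5 := k2 2 0 (by decide); have b6 := k2 2 1 (by decide)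
  have c1 := k3 0 1 (by decide); have c2 := k3 0 2 (by decide); have c3 := k3 1 2 (by decide)
  have c4 := k3 1 0 (by decide); have c5 := k3 2 0 (by decide); have c6 := k3 2 1 (by decide)
  simp only [show (0 : Fin 3) < 1 from by decide, show (0 : Fin 3) < 2 from by decide,
    show (1 : Fin 3) < 2 from by decide, show ¬ (1 : Fin 3) < 0 from by decide,
    show ¬ (2 : Fin 3) < 0 from by decide, show ¬ (2 : Fin 3) < 1 from by decide,
    if_true, if_false] at a1 a2 a3 a4 a5 a6 b1 b2 b3 b4 b5 b6 c1 c2 c3 c4 c5 c6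
  omega

/-- In a disk, there are no connecting sets `E i j` joining `a i` to `b j` such that sets with
no common index are disjoint. -/
theorem not_disjoint_joinedIn {S : Type*} [TopologicalSpace S] {U : Set S}
    (e : U ≃ₜ ℝ × ℝ) (a b : Fin 3 → S) (E : Fin 3 → Fin 3 → Set S)
    (hU : ∀ i j, E i j ⊆ U) (hJ : ∀ i j, JoinedIn (E i j) (a i) (b j))
    (hd : ∀ i j k l, i ≠ k → j ≠ l → Disjoint (E i j) (E k l)) : False := by
  have hmem : ∀ i j t, (hJ i j).somePath t ∈ U := fun i j t => hU i j ((hJ i j).somePath_mem t)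
  let f : U → ℂ := fun x => Complex.equivRealProdCLM.symm (e x)
  have hf : Continuous f := Complex.equivRealProdCLM.symm.continuous.comp e.continuous
  have hfi : Injective f := Complex.equivRealProdCLM.symm.injective.comp e.injective
  let g : Fin 3 → Fin 3 → ℝ → U := fun i j t =>
    ⟨(hJ i j).somePath.extend t, hmem i j _⟩
  have hg : ∀ i j, Continuous (g i j) := fun i j =>
    (hJ i j).somePath.continuous_extend.subtype_mk _
  have haU : ∀ i, a i ∈ U := fun i => hU i 0 (hJ i 0).source_mem
  have hbU : ∀ j, b j ∈ U := fun j => hU 0 j (hJ 0 j).target_mem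
  refine not_disjoint_paths_complex (fun i => f ⟨a i, haU i⟩) (fun j => f ⟨b j, hbU j⟩)
    (fun i j t => f (g i j t)) (fun i j => hf.comp (hg i j)) ?_ ?_ ?_
  · intro i j
    congr 1
    exact Subtype.ext (by simp [g])
  · intro i j
    congr 1
    exact Subtype.ext (by simp [g])
  · intro i j k l hik hjl s t h
    have h2 := congrArg Subtype.val (hfi h)
    have h3 : (hJ i j).somePath (projIcc 0 1 zero_le_one s)
      = (hJ k l).somePath (projIcc 0 1 zero_le_one t) := h2
    refine Set.disjoint_left.1 (hd i j k l hik hjl)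
      ((hJ i j).somePath_mem (projIcc 0 1 zero_le_one s)) ?_
    rw [h3]
    exact (hJ k l).somePath_mem _

section Arcs

variable {S : Type} [TopologicalSpace S]

/-- `f` is an injective continuous parametrization of `ℓ`. -/
def IsParam (ℓ : Set S) (f : ℝ → S) : Prop := Continuous f ∧ Injective f ∧ range f = ℓ

namespace IsParam

variable {ℓ : Set S} {f : ℝ → S}

lemma neg (h : IsParam ℓ f) : IsParam ℓ fun t => f (-t) :=
  ⟨h.1.comp continuous_neg, h.2.1.comp neg_injective, by
    rw [← h.2.2]; exact neg_surjective.range_comp f⟩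

lemma mem (h : IsParam ℓ f) (t : ℝ) : f t ∈ ℓ := h.2.2 ▸ mem_range_self t

lemma exists_eq (h : IsParam ℓ f) {x : S} (hx : x ∈ ℓ) : ∃ t, f t = x := by
  rwa [← h.2.2] at hx

lemma isArcIn (h : IsParam ℓ f) {a b : ℝ} (hab : a ≤ b) :
    IsArcIn ℓ (f '' Icc a b) (f a) (f b) :=
  ⟨f, h.1, h.2.1, h.2.2, a, b, hab, rfl, rfl, rfl⟩

lemma isArcIn_uIcc (h : IsParam ℓ f) (a b : ℝ) :
    IsArcIn ℓ (f '' uIcc a b) (f a) (f b) := by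
  rcases le_total a b with hab | hab
  · rw [uIcc_of_le hab]; exact h.isArcIn hab
  · rw [uIcc_of_ge hab]
    have := h.neg.isArcIn (neg_le_neg hab)
    rw [neg_neg, neg_neg] at this
    convert this using 1
    rw [← image_image f (fun t : ℝ => -t)]
    simp

lemma joinedIn (h : IsParam ℓ f) (a b : ℝ) : JoinedIn (f '' uIcc a b) (f a) (f b) := by
  have : JoinedIn (uIcc a b) a b :=
    ((convex_uIcc a b).isPathConnected ⟨a, left_mem_uIcc⟩).joinedIn a left_mem_uIcc b
      right_mem_uIcc
  exact this.map_continuousOn h.1.continuousOn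

end IsParam

namespace IsArcIn

variable {ℓ A : Set S} {x y : S}

lemma exists_isParam (h : IsArcIn ℓ A x y) : ∃ f, IsParam ℓ f ∧
    ∃ a b : ℝ, a ≤ b ∧ f a = x ∧ f b = y ∧ A = f '' Icc a b := by
  obtain ⟨f, h1, h2, h3, h4⟩ := h
  exact ⟨f, ⟨h1, h2, h3⟩, h4⟩

lemma subset (h : IsArcIn ℓ A x y) : A ⊆ ℓ := by
  obtain ⟨f, hf, a, b, -, -, -, rfl⟩ := h.exists_isParam
  rw [← hf.2.2]
  exact image_subset_range _ _

lemma left_mem (h : IsArcIn ℓ A x y) : x ∈ A := by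
  obtain ⟨f, hf, a, b, hab, rfl, -, rfl⟩ := h.exists_isParam
  exact mem_image_of_mem _ (left_mem_Icc.2 hab)

lemma right_mem (h : IsArcIn ℓ A x y) : y ∈ A := by
  obtain ⟨f, hf, a, b, hab, -, rfl, rfl⟩ := h.exists_isParam
  exact mem_image_of_mem _ (right_mem_Icc.2 hab)

lemma isCompact (h : IsArcIn ℓ A x y) : IsCompact A := by
  obtain ⟨f, hf, a, b, hab, -, -, rfl⟩ := h.exists_isParam
  exact isCompact_Icc.image hf.1

lemma symm (h : IsArcIn ℓ A x y) : IsArcIn ℓ A y x := by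
  obtain ⟨f, hf, a, b, hab, rfl, rfl, rfl⟩ := h.exists_isParam
  rw [← uIcc_of_ge hab]
  exact hf.isArcIn_uIcc b a

lemma exists_subarc (h : IsArcIn ℓ A x y) {x' y' : S} (hx : x' ∈ A) (hy : y' ∈ A) :
    ∃ A' ⊆ A, IsArcIn ℓ A' x' y' := by
  obtain ⟨f, hf, a, b, hab, rfl, rfl, rfl⟩ := h.exists_isParam
  obtain ⟨s, hs, rfl⟩ := hx
  obtain ⟨t, ht, rfl⟩ := hy
  exact ⟨_, image_mono (ordConnected_Icc.uIcc_subset hs ht), hf.isArcIn_uIcc s t⟩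

lemma joinedIn (h : IsArcIn ℓ A x y) : JoinedIn A x y := by
  obtain ⟨f, hf, a, b, hab, rfl, rfl, rfl⟩ := h.exists_isParam
  rw [← uIcc_of_le hab]
  exact hf.joinedIn a b

lemma joinedIn_of_mem (h : IsArcIn ℓ A x y) {x' y' : S} (hx : x' ∈ A) (hy : y' ∈ A) :
    JoinedIn A x' y' := by
  obtain ⟨A', hA', h'⟩ := h.exists_subarc hx hy
  exact h'.joinedIn.mono hA'

lemma image (h : IsArcIn ℓ A x y) (G : S ≃ₜ S) : IsArcIn (G '' ℓ) (G '' A) (G x) (G y) := by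
  obtain ⟨f, hf, a, b, hab, rfl, rfl, rfl⟩ := h.exists_isParam
  exact ⟨G ∘ f, G.continuous.comp hf.1, G.injective.comp hf.2.1, by rw [range_comp, hf.2.2],
    a, b, hab, rfl, rfl, by rw [image_comp]⟩

end IsArcIn

lemma IsImmersedLine.exists_isParam {ℓ : Set S} (h : IsImmersedLine ℓ) : ∃ f, IsParam ℓ f := h

end Arcs

instance (priority := 50) polishSpace_of_compact_secondCountable {S : Type*} [TopologicalSpace S]
    [T2Space S] [CompactSpace S] [SecondCountableTopology S] : PolishSpace S := by
  let := TopologicalSpace.metrizableSpaceMetric S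
  infer_instance

section Turb

variable {S : Type} [TopologicalSpace S] [MeasurableSpace S]

namespace MeasuredTurbulation

variable {μ : Measure S} (T : MeasuredTurbulation μ)

lemma line_unique {ℓ ℓ' : Set S} (h : ℓ ∈ T.lines) (h' : ℓ' ∈ T.lines) {x : S} (hx : x ∈ ℓ)
    (hx' : x ∈ ℓ') : ℓ = ℓ' := by
  by_contra hne
  exact disjoint_left.1 (T.lines_disjoint h h' hne) hx hx'

lemma exists_isParam {ℓ : Set S} (h : ℓ ∈ T.lines) : ∃ f, IsParam ℓ f := T.lines_immersed ℓ h

lemma exists_arc {ℓ : Set S} (h : ℓ ∈ T.lines) {x y : S} (hx : x ∈ ℓ) (hy : y ∈ ℓ) :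
    ∃ A, IsArcIn ℓ A x y := by
  obtain ⟨f, hf⟩ := T.exists_isParam h
  obtain ⟨s, rfl⟩ := hf.exists_eq hx
  obtain ⟨t, rfl⟩ := hf.exists_eq hy
  exact ⟨_, hf.isArcIn_uIcc s t⟩

lemma noAtoms {ℓ : Set S} (h : ℓ ∈ T.lines) : NullSingletonClass (T.ν ℓ) := ⟨T.ν_nonatomic ℓ h⟩

variable {T}

section Tame

variable [T2Space S] [CompactSpace S] [SecondCountableTopology S]

lemma Tame.exists_metric (hT : T.Tame) : ∃ m : MetricSpace S,
    m.toUniformSpace.toTopologicalSpace = ‹TopologicalSpace S› ∧ T.TameWith m.dist := by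
  let m := TopologicalSpace.metrizableSpaceMetric S
  refine ⟨m, rfl, hT _ ⟨dist_comm, fun x y => dist_eq_zero, dist_triangle, fun s => ?_⟩⟩
  rw [Metric.isOpen_iff]
  refine forall₂_congr fun x _ => exists_congr fun ε => and_congr_right fun _ => ?_
  exact ⟨fun h y hy => h (by rwa [Metric.mem_ball, dist_comm]),
    fun h y hy => h y (by rwa [Metric.mem_ball, dist_comm] at hy)⟩

lemma Tame.exists_subset (hT : T.Tame) {K U : Set S} (hK : IsCompact K) (hU : IsOpen U)
    (hKU : K ⊆ U) : ∃ δ : ℝ, 0 < δ ∧ ∀ ℓ ∈ T.lines, ∀ A x y, IsArcIn ℓ A x y →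
      T.ν ℓ A < ENNReal.ofReal δ → (A ∩ K).Nonempty → A ⊆ U := by
  obtain ⟨m, rfl, hm⟩ := hT.exists_metric
  obtain ⟨ε, hε, hεU⟩ := hK.exists_thickening_subset_open hU hKU
  obtain ⟨δ, hδ, H⟩ := hm ε hε
  refine ⟨δ, hδ, fun ℓ hℓ A x y hA hν hne z hz => ?_⟩
  obtain ⟨w, hwA, hwK⟩ := hne
  obtain ⟨A', hA', h'⟩ := hA.exists_subarc hz hwA
  exact hεU (Metric.mem_thickening_iff.2
    ⟨w, hwK, H ℓ hℓ A' z w h' ((measure_mono hA').trans_lt hν)⟩)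

lemma Tame.exists_abs_sub_lt (hT : T.Tame) {φ : S → ℝ} (hφ : Continuous φ) {ε : ℝ} (hε : 0 < ε) :
    ∃ δ : ℝ, 0 < δ ∧ ∀ ℓ ∈ T.lines, ∀ A x y, IsArcIn ℓ A x y →
      T.ν ℓ A < ENNReal.ofReal δ → |φ x - φ y| < ε := by
  obtain ⟨m, rfl, hm⟩ := hT.exists_metric
  obtain ⟨η, hη, H⟩ := Metric.uniformContinuous_iff.1
    (CompactSpace.uniformContinuous_of_continuous hφ) ε hε
  obtain ⟨δ, hδ, H'⟩ := hm η hη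
  exact ⟨δ, hδ, fun ℓ hℓ A x y hA hν => H (H' ℓ hℓ A x y hA hν)⟩

end Tame

end MeasuredTurbulation

section Comap

variable [T2Space S] [CompactSpace S] [SecondCountableTopology S] [BorelSpace S]

lemma IsParam.measurableEmbedding {ℓ : Set S} {f : ℝ → S} (hf : IsParam ℓ f) :
    MeasurableEmbedding f := hf.1.measurableEmbedding hf.2.1

lemma IsArcIn.measurableSet {ℓ A : Set S} {x y : S} (h : IsArcIn ℓ A x y) : MeasurableSet A :=
  h.isCompact.isClosed.measurableSet

variable {μ : Measure S} (T : MeasuredTurbulation μ)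

lemma MeasuredTurbulation.measure_Icc_lt_top {ℓ : Set S} (h : ℓ ∈ T.lines) {f : ℝ → S}
    (hf : IsParam ℓ f) (a b : ℝ) : T.ν ℓ (f '' Icc a b) < ⊤ := by
  rcases le_total a b with hab | hab
  · exact T.ν_arc_finite ℓ h _ _ _ (hf.isArcIn hab)
  · refine lt_of_le_of_lt (measure_mono (image_mono ?_))
      (T.ν_arc_finite ℓ h _ _ _ (hf.isArcIn (le_refl a)))
    intro t ht
    exact ⟨ht.1, ht.2.trans hab⟩

lemma MeasuredTurbulation.sigmaFinite {ℓ : Set S} (h : ℓ ∈ T.lines) : SigmaFinite (T.ν ℓ) := by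
  obtain ⟨f, hf⟩ := T.exists_isParam h
  refine ⟨⟨⟨fun n => f '' Icc (-(n : ℝ)) n ∪ ℓᶜ, fun _ => trivial, fun n => ?_, ?_⟩⟩⟩
  · refine (measure_union_le _ _).trans_lt ?_
    rw [T.ν_supported ℓ h, add_zero]
    exact T.measure_Icc_lt_top h hf _ _
  · refine eq_univ_of_forall fun x => ?_
    by_cases hx : x ∈ ℓ
    · obtain ⟨t, rfl⟩ := hf.exists_eq hx
      obtain ⟨n, hn⟩ := exists_nat_ge |t|
      exact mem_iUnion.2 ⟨n, Or.inl ⟨t, abs_le.1 hn, rfl⟩⟩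
    · exact mem_iUnion.2 ⟨0, Or.inr hx⟩

end Comap
end Turb

namespace Tartan

variable {μ : Measure S} {T₁ T₂ : MeasuredTurbulation μ}

/-- Exchange the roles of the two turbulations. -/
def swap (R : Tartan T₁ T₂) : Tartan T₂ T₁ where
  Rs := R.Ru
  Ru := R.Rs
  borel_s := R.borel_u
  borel_u := R.borel_s
  fibs := R.fibu
  fibu := R.fibs
  fibs_disjoint := R.fibu_disjoint
  fibu_disjoint := R.fibs_disjoint
  fibs_cover := R.fibu_cover
  fibu_cover := R.fibs_cover
  inter_unique A hA B hB := by
    rw [inter_comm]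
    exact R.inter_unique B hB A hA
  oriented := by
    obtain ⟨o, o', h1, h2, h3, h4⟩ := R.oriented
    exact ⟨o', o, h2, h1, h4, h3⟩
  bounded := by
    obtain ⟨L, h0, h1, h2⟩ := R.bounded
    exact ⟨L, h0, h2, h1⟩
  in_disk := by
    obtain ⟨U, h⟩ := R.in_disk
    exact ⟨U, by rwa [union_comm]⟩

variable (R : Tartan T₁ T₂)

lemma core_swap : R.swap.core = R.core := inter_comm _ _

lemma stableSaturation_swap : stableSaturation R.swap = unstableSaturation R := rfl

lemma measurableSet_core : MeasurableSet R.core := R.borel_s.inter R.borel_u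

variable {R}


/-- The unstable fiber through `v`. -/
def col (R : Tartan T₁ T₂) (v : S) : Set S := ⋃₀ {B ∈ R.fibu | v ∈ B}

lemma fibu_unique {B B' : Set S} (hB : B ∈ R.fibu) (hB' : B' ∈ R.fibu) {v : S} (hv : v ∈ B)
    (hv' : v ∈ B') : B = B' := by
  by_contra hne
  exact disjoint_left.1 (R.fibu_disjoint hB hB' hne) hv hv'

lemma col_eq {B : Set S} (hB : B ∈ R.fibu) {v : S} (hv : v ∈ B) : R.col v = B := by
  have : {B ∈ R.fibu | v ∈ B} = {B} := by
    ext B'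
    exact ⟨fun h => fibu_unique h.1 hB h.2 hv, fun h => by rw [mem_singleton_iff.1 h]; exact ⟨hB, hv⟩⟩
  rw [col, this, sUnion_singleton]

lemma exists_fibu {v : S} (hv : v ∈ R.core) : ∃ B ∈ R.fibu, v ∈ B := by
  have := hv.2
  rwa [← R.fibu_cover] at this

lemma exists_fibs {v : S} (hv : v ∈ R.core) : ∃ A ∈ R.fibs, v ∈ A := by
  have := hv.1
  rwa [← R.fibs_cover] at this

lemma col_mem {v : S} (hv : v ∈ R.core) : R.col v ∈ R.fibu ∧ v ∈ R.col v := by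
  obtain ⟨B, hB, hvB⟩ := exists_fibu hv
  rw [col_eq hB hvB]
  exact ⟨hB, hvB⟩

lemma mem_core {A B : Set S} (hA : A ∈ R.fibs) (hB : B ∈ R.fibu) {v : S} (hv : v ∈ A)
    (hv' : v ∈ B) : v ∈ R.core := by
  refine ⟨?_, ?_⟩
  · rw [← R.fibs_cover]; exact ⟨A, hA, hv⟩
  · rw [← R.fibu_cover]; exact ⟨B, hB, hv'⟩

lemma inter_eq {A B : Set S} (hA : A ∈ R.fibs) (hB : B ∈ R.fibu) {v w : S} (hv : v ∈ A)
    (hv' : v ∈ B) (hw : w ∈ A) (hw' : w ∈ B) : v = w :=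
  (R.inter_unique A hA B hB).unique ⟨hv, hv'⟩ ⟨hw, hw'⟩

lemma exists_inter {A B : Set S} (hA : A ∈ R.fibs) (hB : B ∈ R.fibu) : ∃ v, v ∈ A ∧ v ∈ B :=
  (R.inter_unique A hA B hB).exists

lemma fibs_isArc {A : Set S} (hA : A ∈ R.fibs) : ∃ ℓ ∈ T₁.lines, ∃ x y, IsArcIn ℓ A x y := by
  obtain ⟨o, o', h, -⟩ := R.oriented
  obtain ⟨ℓ, hℓ, f, h1, h2, h3, a, b, hab, rfl, -⟩ := h A hA
  exact ⟨ℓ, hℓ, f a, f b, IsParam.isArcIn ⟨h1, h2, h3⟩ hab⟩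

/-- The core points whose unstable fiber meets `X` and whose stable fiber meets `Y`. -/
def box (R : Tartan T₁ T₂) (X Y : Set S) : Set S :=
  {v ∈ R.core | (∃ B ∈ R.fibu, v ∈ B ∧ (B ∩ X).Nonempty) ∧ ∃ A ∈ R.fibs, v ∈ A ∧ (A ∩ Y).Nonempty}

section Box

variable [T2Space S] [CompactSpace S] [SecondCountableTopology S] [BorelSpace S]

lemma Compatible.measure_box (hR : R.Compatible) {A B ℓ ℓ' X Y : Set S} (hA : A ∈ R.fibs)
    (hB : B ∈ R.fibu) (hℓ : ℓ ∈ T₁.lines) (hAℓ : A ⊆ ℓ) (hℓ' : ℓ' ∈ T₂.lines) (hBℓ' : B ⊆ ℓ')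
    (hX : MeasurableSet X) (hXA : X ⊆ A ∩ R.core) (hY : MeasurableSet Y) (hYB : Y ⊆ B ∩ R.core) :
    MeasurableSet (R.box X Y) ∧ μ (R.box X Y) = T₁.ν ℓ X * T₂.ν ℓ' Y := by
  obtain ⟨ψ, h1, h2, h3, h4, h5, h6⟩ := hR A hA B hB ℓ hℓ hAℓ ℓ' hℓ' hBℓ'
  have := T₁.sigmaFinite hℓ
  have := T₂.sigmaFinite hℓ'
  have hXY : X ×ˢ Y ⊆ (A ∩ R.core) ×ˢ (B ∩ R.core) := prod_mono hXA hYB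
  have hbox : R.box X Y = ψ '' (X ×ˢ Y) := by
    ext v
    constructor
    · rintro ⟨hv, ⟨B', hB', hvB', x, hxB', hx⟩, A', hA', hvA', y, hyA', hy⟩
      refine ⟨(x, y), ⟨hx, hy⟩, ?_⟩
      have := h1 x (hXA hx) y (hYB hy) B' hB' hxB' A' hA' hyA'
      exact inter_eq hA' hB' this.2 this.1 hvA' hvB'
    · rintro ⟨⟨x, y⟩, ⟨hx, hy⟩, rfl⟩
      obtain ⟨B', hB', hxB'⟩ := exists_fibu (hXA hx).2
      obtain ⟨A', hA', hyA'⟩ := exists_fibs (hYB hy).2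
      have := h1 x (hXA hx) y (hYB hy) B' hB' hxB' A' hA' hyA'
      exact ⟨mem_core hA' hB' this.2 this.1, ⟨B', hB', this.1, x, hxB', hx⟩,
        A', hA', this.2, y, hyA', hy⟩
  have hm : MeasurableSet (R.box X Y) := hbox ▸ h5 _ hXY (hX.prod hY)
  refine ⟨hm, ?_⟩
  have hsub : R.box X Y ⊆ R.core := fun v hv => hv.1
  have hAm : MeasurableSet (A ∩ R.core) := by
    obtain ⟨_, _, _, _, h⟩ := fibs_isArc hA
    exact h.measurableSet.inter R.measurableSet_core
  have hBm : MeasurableSet (B ∩ R.core) := by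
    obtain ⟨_, _, _, _, h⟩ := R.swap.fibs_isArc hB
    exact h.measurableSet.inter R.measurableSet_core
  calc μ (R.box X Y) = μ.restrict R.core (R.box X Y) := by
        rw [Measure.restrict_apply hm, inter_eq_left.2 hsub]
    _ = ((T₁.ν ℓ).prod (T₂.ν ℓ')) (X ×ˢ Y) := by
        rw [← h6, Measure.map_apply h4 hm, Measure.prod_restrict, Measure.restrict_apply (h4 hm)]
        congr 1
        rw [hbox]
        ext p
        constructor
        · rintro ⟨⟨q, hq, hqp⟩, hp⟩
          rwa [← h2 (hXY hq) hp hqp]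
        · exact fun hp => ⟨mem_image_of_mem _ hp, hXY hp⟩
    _ = _ := Measure.prod_prod _ _

lemma measurableSet_fibs {A : Set S} (hA : A ∈ R.fibs) : MeasurableSet A := by
  obtain ⟨_, _, _, _, h⟩ := fibs_isArc hA
  exact h.measurableSet

lemma isClosed_fibs {A : Set S} (hA : A ∈ R.fibs) : IsClosed A := by
  obtain ⟨_, _, _, _, h⟩ := fibs_isArc hA
  exact h.isCompact.isClosed

lemma Compatible.swap (hR : R.Compatible) : R.swap.Compatible := by
  intro B hB A hA ℓ' hℓ' hBℓ' ℓ hℓ hAℓ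
  obtain ⟨ψ, h1, h2, h3, h4, h5, h6⟩ := hR A hA B hB ℓ hℓ hAℓ ℓ' hℓ' hBℓ'
  have := T₁.sigmaFinite hℓ
  have := T₂.sigmaFinite hℓ'
  rw [core_swap]
  refine ⟨ψ ∘ Prod.swap, ?_, ?_, ?_, h4.comp measurable_swap, ?_, ?_⟩
  · intro x hx y hy A' hA' hxA' B' hB' hyB'
    exact (h1 y hy x hx B' hB' hyB' A' hA' hxA').symm
  · intro p hp q hq h
    exact Prod.swap_injective (h2 hp.symm hq.symm h)
  · rw [image_comp, image_swap_prod, h3]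
  · intro E hE hEm
    rw [image_comp]
    refine h5 _ ?_ ?_
    · rintro _ ⟨p, hp, rfl⟩
      exact (hE hp).symm
    · rw [image_swap_eq_preimage_swap]
      exact measurable_swap hEm
  · rw [← h6, ← Measure.map_map h4 measurable_swap, Measure.prod_swap]

/-- The measure of the core points whose unstable fiber meets `X` is proportional to the
stream measure of `X`. -/
lemma Compatible.exists_measure_col (hR : R.Compatible) : ∃ M : ℝ≥0∞, M < ⊤ ∧
    ∀ A ∈ R.fibs, ∀ ℓ ∈ T₁.lines, A ⊆ ℓ → ∀ X, MeasurableSet X → X ⊆ A ∩ R.core →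
      MeasurableSet {v ∈ R.core | (R.col v ∩ X).Nonempty} ∧
      μ {v ∈ R.core | (R.col v ∩ X).Nonempty} = M * T₁.ν ℓ X := by
  by_cases hne : R.fibu.Nonempty
  · obtain ⟨B, hB⟩ := hne
    obtain ⟨ℓ', hℓ', x, y, hB'⟩ := R.swap.fibs_isArc hB
    refine ⟨T₂.ν ℓ' (B ∩ R.core), (measure_mono inter_subset_left).trans_lt
      (T₂.ν_arc_finite ℓ' hℓ' B x y hB'), fun A hA ℓ hℓ hAℓ X hX hXA => ?_⟩
    have := hR.measure_box hA hB hℓ hAℓ hℓ' hB'.subset hX hXA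
      (hB'.measurableSet.inter R.measurableSet_core) le_rfl
    rw [mul_comm]
    convert this using 3 <;>
    · ext v
      refine and_congr_right fun hv => ⟨fun h => ⟨⟨_, (col_mem hv).1, (col_mem hv).2, h⟩, ?_⟩, ?_⟩
      · obtain ⟨A', hA', hvA'⟩ := exists_fibs hv
        obtain ⟨z, hz, hz'⟩ := exists_inter hA' hB
        exact ⟨A', hA', hvA', z, hz, hz', mem_core hA' hB hz hz'⟩
      · rintro ⟨⟨B', hB', hvB', h⟩, -⟩
        rwa [col_eq hB' hvB']
  · have hc : R.core = ∅ := by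
      refine eq_empty_of_forall_notMem fun v hv => hne ?_
      obtain ⟨B, hB, -⟩ := exists_fibu hv
      exact ⟨B, hB⟩
    refine ⟨0, by simp, fun A hA ℓ hℓ hAℓ X hX hXA => ?_⟩
    simp [hc]

lemma Compatible.measure_core_inter_fibu (hR : R.Compatible) {B : Set S} (hB : B ∈ R.fibu) :
    μ (R.core ∩ B) = 0 := by
  rcases eq_empty_or_nonempty (R.core ∩ B) with h | ⟨v, hv, hvB⟩
  · simp [h]
  obtain ⟨M, hM, H⟩ := hR.exists_measure_col
  obtain ⟨A, hA, hvA⟩ := exists_fibs hv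
  obtain ⟨ℓ, hℓ, x, y, hA'⟩ := fibs_isArc hA
  have h := (H A hA ℓ hℓ hA'.subset {v} (measurableSet_singleton v)
    (singleton_subset_iff.2 ⟨hvA, hv⟩)).2
  rw [T₁.ν_nonatomic ℓ hℓ, mul_zero] at h
  refine measure_mono_null ?_ h
  intro w hw
  exact ⟨hw.1, v, by rwa [col_eq hB hw.2], rfl⟩

end Box

end Tartan

section RealMeasure

lemma exists_measure_Iic_lt (m : Measure ℝ) [IsFiniteMeasure m] (h0 : ∀ x, m {x} = 0) {P : Set ℝ}
    (hne : P.Nonempty) (hb : BddBelow P) (hP : m (Iio (sInf P)) = 0) {ε : ℝ≥0∞} (hε : 0 < ε) :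
    ∃ u ∈ P, m (Iic u) < ε := by
  obtain ⟨u, hu, hxu, hlim, huP⟩ := (isGLB_csInf hne hb).exists_seq_antitone_tendsto hne
  have hI : ⋂ n, Iic (u n) = Iic (sInf P) := by
    ext x
    simp only [mem_iInter, mem_Iic]
    exact ⟨fun h => ge_of_tendsto' hlim h, fun h n => h.trans (hxu n)⟩
  have ht := tendsto_measure_iInter_atTop (μ := m) (s := fun n => Iic (u n))
    (fun n => measurableSet_Iic.nullMeasurableSet) (fun i j hij => Iic_subset_Iic.2 (hu hij))
    ⟨0, measure_ne_top _ _⟩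
  have hz : m (Iic (sInf P)) = 0 := by
    rw [← Iio_union_right]
    exact measure_union_null hP (h0 _)
  rw [hI, hz] at ht
  obtain ⟨n, hn⟩ := (ht.eventually (gt_mem_nhds hε)).exists
  exact ⟨u n, huP n, hn⟩

lemma exists_measure_Ici_lt (m : Measure ℝ) [IsFiniteMeasure m] (h0 : ∀ x, m {x} = 0) {P : Set ℝ}
    (hne : P.Nonempty) (hb : BddAbove P) (hP : m (Ioi (sSup P)) = 0) {ε : ℝ≥0∞} (hε : 0 < ε) :
    ∃ u ∈ P, m (Ici u) < ε := by
  have e (s : Set ℝ) : m.map Neg.neg s = m (Neg.neg ⁻¹' s) :=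
    (MeasurableEquiv.neg ℝ).map_apply s
  obtain ⟨u, hu, h⟩ := exists_measure_Iic_lt (m.map Neg.neg) (P := -P)
    (fun x => by rw [e]; convert h0 (-x) using 2; ext y; simp)
    hne.neg hb.neg (by rw [e]; convert hP using 2; ext y; simp [Real.sInf_neg]) hε
  rw [e] at h
  exact ⟨-u, hu, by convert h using 2; ext y; simp⟩

lemma measure_le_of_forall_Ioo_le (m : Measure ℝ) (h0 : ∀ x, m {x} = 0) {P : Set ℝ}
    (hb : BddBelow P) (ha : BddAbove P) {k : ℝ≥0∞}
    (h : ∀ p ∈ P, ∀ q ∈ P, p < q → m (Ioo p q) ≤ k) : m (Icc (sInf P) (sSup P) ∩ {_x | P.Nonempty}) ≤ k := by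
  rcases P.eq_empty_or_nonempty with rfl | hne
  · simp
  obtain ⟨u, hu, hxu, hlim, huP⟩ := (isGLB_csInf hne hb).exists_seq_antitone_tendsto hne
  obtain ⟨v, hv, hxv, hlim', hvP⟩ := (isLUB_csSup hne ha).exists_seq_monotone_tendsto hne
  have hI : Icc (sInf P) (sSup P) ⊆ (⋃ n, Ioo (u n) (v n)) ∪ {sInf P} ∪ {sSup P} := by
    intro x hx
    rcases eq_or_lt_of_le hx.1 with h1 | h1
    · exact Or.inl (Or.inr h1.symm)
    rcases eq_or_lt_of_le hx.2 with h2 | h2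
    · exact Or.inr h2
    obtain ⟨n, hn, hn'⟩ := ((hlim.eventually (gt_mem_nhds h1)).and
      (hlim'.eventually (lt_mem_nhds h2))).exists
    exact Or.inl (Or.inl (mem_iUnion.2 ⟨n, hn, hn'⟩))
  calc m (Icc (sInf P) (sSup P) ∩ {_x | P.Nonempty})
      ≤ m ((⋃ n, Ioo (u n) (v n)) ∪ {sInf P} ∪ {sSup P}) :=
        measure_mono (inter_subset_left.trans hI)
    _ ≤ m (⋃ n, Ioo (u n) (v n)) := by
        refine (measure_union_le _ _).trans ?_
        rw [h0, add_zero]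
        refine (measure_union_le _ _).trans ?_
        rw [h0, add_zero]
    _ ≤ k := by
        have hmono : Monotone fun n => Ioo (u n) (v n) :=
          fun i j hij => Ioo_subset_Ioo (hu hij) (hv hij)
        rw [hmono.measure_iUnion]
        refine iSup_le fun n => ?_
        rcases lt_or_ge (u n) (v n) with h1 | h1
        · exact h _ (huP n) _ (hvP n) h1
        · simp [Ioo_eq_empty (not_lt.2 h1)]

end RealMeasure

variable {S : Type} [TopologicalSpace S] [MeasurableSpace S]

namespace Tartan

variable {μ : Measure S} {T₁ T₂ : MeasuredTurbulation μ}

/-- Coherent parametrizations of the stable fibers of a tartan, where `p A B` is the parameter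
of the intersection of `A` and `B`. -/
structure Rowing (R : Tartan T₁ T₂) where
  base : Set S
  base_mem : base ∈ R.fibs
  line : Set S → Set S
  f : Set S → ℝ → S
  lo : Set S → ℝ
  hi : Set S → ℝ
  p : Set S → Set S → ℝ
  line_mem : ∀ A ∈ R.fibs, line A ∈ T₁.lines
  param : ∀ A ∈ R.fibs, IsParam (line A) (f A)
  lo_le : ∀ A ∈ R.fibs, lo A ≤ hi A
  eq : ∀ A ∈ R.fibs, A = f A '' Icc (lo A) (hi A)
  p_mem : ∀ A ∈ R.fibs, ∀ B ∈ R.fibu, p A B ∈ Icc (lo A) (hi A)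
  pt_mem_u : ∀ A ∈ R.fibs, ∀ B ∈ R.fibu, f A (p A B) ∈ B
  p_le : ∀ A ∈ R.fibs, ∀ B ∈ R.fibu, ∀ B' ∈ R.fibu, p A B ≤ p A B' ↔ p base B ≤ p base B'

lemma exists_rowing (R : Tartan T₁ T₂) (hne : R.fibs.Nonempty) : Nonempty R.Rowing := by
  obtain ⟨base, hbase⟩ := hne
  obtain ⟨-, -, x, -⟩ := fibs_isArc hbase
  have : Nonempty S := ⟨x⟩
  obtain ⟨o, o', h, -, hc, -⟩ := R.oriented
  choose! ℓ hℓ f hf hf' hf'' lo hi hle heq ho using h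
  have hp : ∀ A ∈ R.fibs, ∀ B ∈ R.fibu, ∃ p, p ∈ Icc (lo A) (hi A) ∧ f A p ∈ B := by
    intro A hA B hB
    obtain ⟨v, hvA, hvB⟩ := exists_inter hA hB
    rw [heq A hA] at hvA
    obtain ⟨p, hp, rfl⟩ := hvA
    exact ⟨p, hp, hvB⟩
  choose! p hp hp' using hp
  have hpA : ∀ A ∈ R.fibs, ∀ B ∈ R.fibu, f A (p A B) ∈ A := fun A hA B hB => by
    have := mem_image_of_mem (f A) (hp A hA B hB)
    rwa [← heq A hA] at this
  refine ⟨⟨base, hbase, ℓ, f, lo, hi, p, hℓ, fun A hA => ⟨hf A hA, hf' A hA, hf'' A hA⟩, hle, heq,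
    hp, hp', fun A hA B hB B' hB' => ?_⟩⟩
  rw [← ho A hA _ (hp A hA B hB) _ (hp A hA B' hB'),
    ← ho base hbase _ (hp base hbase B hB) _ (hp base hbase B' hB')]
  exact hc A hA base hbase B hB B' hB' _ ⟨hpA A hA B hB, hp' A hA B hB⟩ _
    ⟨hpA A hA B' hB', hp' A hA B' hB'⟩ _ ⟨hpA base hbase B hB, hp' base hbase B hB⟩ _
    ⟨hpA base hbase B' hB', hp' base hbase B' hB'⟩

namespace Rowing

variable {R : Tartan T₁ T₂} (G : R.Rowing)

/-- The coordinate of an unstable fiber along the base fiber. -/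
def κ (B : Set S) : ℝ := G.p G.base B

/-- The part of the stable fiber `A` between the unstable fibers `B` and `B'`. -/
def seg (A B B' : Set S) : Set S := G.f A '' uIcc (G.p A B) (G.p A B')

lemma subset_line {A : Set S} (hA : A ∈ R.fibs) : A ⊆ G.line A := by
  have := image_subset_range (G.f A) (Icc (G.lo A) (G.hi A))
  rwa [← G.eq A hA, (G.param A hA).2.2] at this

variable {A B B' B'' : Set S} (hA : A ∈ R.fibs) (hB : B ∈ R.fibu) (hB' : B' ∈ R.fibu)
include hA hB

lemma pt_mem_s : G.f A (G.p A B) ∈ A := by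
  have := mem_image_of_mem (G.f A) (G.p_mem A hA B hB)
  rwa [← G.eq A hA] at this

lemma eq_p {t : ℝ} (ht : t ∈ Icc (G.lo A) (G.hi A)) (h : G.f A t ∈ B) : t = G.p A B := by
  refine (G.param A hA).2.1 (inter_eq hA hB ?_ h (G.pt_mem_s hA hB) (G.pt_mem_u A hA B hB))
  have := mem_image_of_mem (G.f A) ht
  rwa [← G.eq A hA] at this

lemma eq_pt {z : S} (hz : z ∈ A) (h : z ∈ B) : z = G.f A (G.p A B) :=
  inter_eq hA hB hz h (G.pt_mem_s hA hB) (G.pt_mem_u A hA B hB)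

include hB'

lemma p_lt : G.p A B < G.p A B' ↔ G.κ B < G.κ B' := by
  rw [← not_le, ← not_le, κ, κ, G.p_le A hA B' hB' B hB]

lemma p_mem_uIcc (hB'' : B'' ∈ R.fibu) (h : G.p A B'' ∈ uIcc (G.p A B) (G.p A B')) :
    G.κ B'' ∈ uIcc (G.κ B) (G.κ B') := by
  rw [mem_uIcc] at h ⊢
  rwa [G.p_le A hA B hB B'' hB'', G.p_le A hA B'' hB'' B' hB', G.p_le A hA B'' hB'' B hB,
    G.p_le A hA B' hB' B'' hB''] at h

lemma uIcc_subset : uIcc (G.p A B) (G.p A B') ⊆ Icc (G.lo A) (G.hi A) :=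
  ordConnected_Icc.uIcc_subset (G.p_mem A hA B hB) (G.p_mem A hA B' hB')

lemma seg_subset : G.seg A B B' ⊆ A := by
  have := image_mono (f := G.f A) (G.uIcc_subset hA hB hB')
  rwa [← G.eq A hA] at this

omit hA hB hB' in
lemma seg_joinedIn (hA : A ∈ R.fibs) :
    JoinedIn (G.seg A B B') (G.f A (G.p A B)) (G.f A (G.p A B')) :=
  (G.param A hA).joinedIn _ _

lemma disjoint_seg (hB'' : B'' ∈ R.fibu) (h : G.κ B'' ∉ uIcc (G.κ B) (G.κ B')) :
    Disjoint (G.seg A B B') B'' := by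
  rw [disjoint_left]
  rintro _ ⟨t, ht, rfl⟩ hz
  have := G.eq_p hA hB'' (G.uIcc_subset hA hB hB' ht) hz
  subst this
  exact h (G.p_mem_uIcc hA hB hB' hB'' ht)

omit hA
lemma κ_inj (h : G.κ B = G.κ B') : B = B' := by
  refine fibu_unique hB hB' (G.pt_mem_u _ G.base_mem B hB) ?_
  change G.p _ _ = G.p _ _ at h
  rw [h]
  exact G.pt_mem_u _ G.base_mem B' hB'

omit hB hB'
lemma κ_mem (hB : B ∈ R.fibu) : G.κ B ∈ Icc (G.lo G.base) (G.hi G.base) :=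
  G.p_mem _ G.base_mem B hB

section Measure

variable [T2Space S] [CompactSpace S] [SecondCountableTopology S] [BorelSpace S]

lemma measurableSet_κ (hR : R.Compatible) {C : Set ℝ} (hC : MeasurableSet C) :
    MeasurableSet {v ∈ R.core | G.κ (R.col v) ∈ C} := by
  obtain ⟨M, hM, H⟩ := hR.exists_measure_col
  have hp := G.param _ G.base_mem
  have := (H G.base G.base_mem _ (G.line_mem _ G.base_mem)
    (G.subset_line G.base_mem)
    (G.f G.base '' C ∩ (G.base ∩ R.core))
    ((hp.measurableEmbedding.measurableSet_image.2 hC).inter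
      ((measurableSet_fibs G.base_mem).inter R.measurableSet_core)) inter_subset_right).1
  convert this using 3 with v
  refine and_congr_right fun hv => ?_
  have hcv := col_mem hv
  constructor
  · intro h
    have h1 := G.pt_mem_s G.base_mem hcv.1
    have h2 := G.pt_mem_u _ G.base_mem _ hcv.1
    exact ⟨_, h2, mem_image_of_mem _ h, h1, mem_core G.base_mem hcv.1 h1 h2⟩
  · rintro ⟨z, hz, ⟨t, ht, rfl⟩, hz', -⟩
    have := (G.param _ G.base_mem).2.1 (G.eq_pt G.base_mem hcv.1 hz' hz)
    rwa [this] at ht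

/-- The distribution of the coordinates of the core points. -/
lemma exists_law [IsFiniteMeasure μ] (hR : R.Compatible) : ∃ m : Measure ℝ, IsFiniteMeasure m ∧
    (∀ x, m {x} = 0) ∧
    ∀ C, MeasurableSet C → m C = μ {v ∈ R.core | G.κ (R.col v) ∈ C} := by
  let g := R.core.indicator fun v => G.κ (R.col v)
  have hpre : ∀ C, g ⁻¹' C ∩ R.core = {v ∈ R.core | G.κ (R.col v) ∈ C} := fun C => by
    ext v
    by_cases hv : v ∈ R.core <;> simp [g, hv]
  have hg : Measurable g := by
    intro C hC
    rw [← inter_union_compl (g ⁻¹' C) R.core, hpre]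
    refine (G.measurableSet_κ hR hC).union ?_
    have : g ⁻¹' C ∩ R.coreᶜ = R.coreᶜ ∩ {_v | (0 : ℝ) ∈ C} := by
      ext v
      by_cases hv : v ∈ R.core <;> simp [g, hv]
    rw [this]
    exact R.measurableSet_core.compl.inter (MeasurableSet.const _)
  have hm : ∀ C, MeasurableSet C →
      (μ.restrict R.core).map g C = μ {v ∈ R.core | G.κ (R.col v) ∈ C} := fun C hC => by
    rw [Measure.map_apply hg hC, Measure.restrict_apply (hg hC), hpre]
  refine ⟨(μ.restrict R.core).map g, inferInstance, fun x => ?_, hm⟩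
  rw [hm _ (measurableSet_singleton x)]
  by_cases hx : ∃ v ∈ R.core, G.κ (R.col v) = x
  · obtain ⟨v, hv, rfl⟩ := hx
    refine measure_mono_null ?_ (hR.measure_core_inter_fibu (col_mem hv).1)
    rintro w ⟨hw, hwx⟩
    refine ⟨hw, ?_⟩
    have := G.κ_inj (col_mem hw).1 (col_mem hv).1 hwx
    rw [← this]
    exact (col_mem hw).2
  · convert measure_empty (μ := μ)
    exact eq_empty_of_forall_notMem fun v hv => hx ⟨v, hv.1, hv.2⟩

/-- Two unstable fibers between which most of the core lies. -/
lemma exists_frame [IsFiniteMeasure μ] (hR : R.Compatible) (hne : R.core.Nonempty) {ε : ℝ≥0∞}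
    (hε : 0 < ε) : ∃ B ∈ R.fibu, ∃ B' ∈ R.fibu,
      MeasurableSet {v ∈ R.core | G.κ (R.col v) ∈ Ioo (G.κ B) (G.κ B')} ∧
      μ {v ∈ R.core | G.κ (R.col v) ∉ Ioo (G.κ B) (G.κ B')} ≤ ε := by
  obtain ⟨m, _, h0, hm⟩ := G.exists_law hR
  let P' := (fun v => G.κ (R.col v)) '' R.core
  have hP' : P' ⊆ Icc (G.lo G.base) (G.hi G.base) := by
    rintro _ ⟨v, hv, rfl⟩
    exact G.κ_mem (col_mem hv).1
  have hz : ∀ C, MeasurableSet C → Disjoint C P' → m C = 0 := fun C hC hd => by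
    rw [hm C hC]
    convert measure_empty (μ := μ)
    exact eq_empty_of_forall_notMem fun v hv =>
      disjoint_left.1 hd hv.2 (mem_image_of_mem (fun v => G.κ (R.col v)) hv.1)
  have hbb : BddBelow P' := bddBelow_Icc.mono hP'
  have hba : BddAbove P' := bddAbove_Icc.mono hP'
  have hε2 : 0 < ε / 2 := ENNReal.half_pos hε.ne'
  obtain ⟨_, ⟨v, hv, rfl⟩, h1⟩ := exists_measure_Iic_lt m h0 (hne.image _)
    hbb (hz _ measurableSet_Iio (disjoint_left.2 fun x hx hx' => not_le.2 hx (csInf_le hbb hx'))) hε2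
  obtain ⟨_, ⟨v', hv', rfl⟩, h2⟩ := exists_measure_Ici_lt m h0 (hne.image _)
    hba (hz _ measurableSet_Ioi (disjoint_left.2 fun x hx hx' => not_le.2 hx (le_csSup hba hx'))) hε2
  refine ⟨_, (col_mem hv).1, _, (col_mem hv').1, G.measurableSet_κ hR measurableSet_Ioo, ?_⟩
  rw [hm _ measurableSet_Iic] at h1
  rw [hm _ measurableSet_Ici] at h2
  rw [← ENNReal.add_halves ε]
  refine le_trans (measure_mono ?_) ((measure_union_le _ _).trans (add_le_add h1.le h2.le))
  rintro w ⟨hw, hw'⟩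
  rw [mem_Ioo, not_and_or, not_lt, not_lt] at hw'
  exact hw'.imp (fun h => ⟨hw, h⟩) (fun h => ⟨hw, h⟩)

end Measure

end Rowing

end Tartan

lemma exists_countable_joined_basis {S : Type*} [TopologicalSpace S] {U : Set S} (hU : IsOpen U)
    (e : U ≃ₜ ℝ × ℝ) : ∃ O : ℕ × ℕ → Set S, (∀ i, ∀ x ∈ O i, ∀ y ∈ O i, JoinedIn (O i) x y) ∧
      ∀ W, IsOpen W → ∀ x ∈ W ∩ U, ∃ i, x ∈ O i ∧ O i ⊆ W ∩ U := by
  let E : ℝ × ℝ → S := fun p => (e.symm p : S)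
  have hE : Continuous E := continuous_subtype_val.comp e.symm.continuous
  refine ⟨fun i => E '' Metric.ball (TopologicalSpace.denseSeq (ℝ × ℝ) i.1) (1 / (i.2 + 1)),
    ?_, ?_⟩
  · rintro i _ ⟨p, hp, rfl⟩ _ ⟨q, hq, rfl⟩
    have : JoinedIn (Metric.ball (TopologicalSpace.denseSeq (ℝ × ℝ) i.1) (1 / (i.2 + 1))) p q :=
      ((convex_ball _ _).isPathConnected ⟨p, hp⟩).joinedIn p hp q hq
    exact this.map_continuousOn hE.continuousOn
  · rintro W hW x ⟨hxW, hxU⟩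
    have hx : E (e ⟨x, hxU⟩) = x := by simp [E]
    have hO : IsOpen (E ⁻¹' W) := hW.preimage hE
    obtain ⟨ε, hε, hεW⟩ := Metric.isOpen_iff.1 hO (e ⟨x, hxU⟩) (by rwa [mem_preimage, hx])
    obtain ⟨n, hn⟩ := exists_nat_one_div_lt (half_pos hε)
    obtain ⟨k, hk⟩ := (TopologicalSpace.denseRange_denseSeq (ℝ × ℝ)).exists_dist_lt
      (e ⟨x, hxU⟩) (ε := 1 / ((n : ℝ) + 1)) (by positivity)
    refine ⟨(k, n), ⟨e ⟨x, hxU⟩, hk, hx⟩, ?_⟩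
    rintro _ ⟨p, hp, rfl⟩
    refine ⟨hεW ?_, (e.symm p).2⟩
    rw [Metric.mem_ball] at hp ⊢
    have := dist_triangle p (TopologicalSpace.denseSeq (ℝ × ℝ) k) (e ⟨x, hxU⟩)
    rw [dist_comm] at hk
    simp only at hp
    linarith

variable {S : Type} [TopologicalSpace S] [MeasurableSpace S]

namespace Tartan

variable {μ : Measure S} {T₁ T₂ : MeasuredTurbulation μ}

section
variable [T2Space S] [CompactSpace S] [SecondCountableTopology S] [BorelSpace S]

lemma countable_fibs_subset (R : Tartan T₁ T₂) {ℓ : Set S} (hℓ : ℓ ∈ T₁.lines)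
    {B B' : Set S} (hB : B ∈ R.fibu) (hB' : B' ∈ R.fibu) (hne : B ≠ B') :
    {A ∈ R.fibs | A ⊆ ℓ}.Countable := by
  have := T₁.sigmaFinite hℓ
  have h := Measure.countable_meas_pos_of_disjoint_iUnion (μ := T₁.ν ℓ)
    (As := fun A : {A ∈ R.fibs | A ⊆ ℓ} => (A : Set S)) (fun A => measurableSet_fibs A.2.1)
    (fun A A' hAA' => R.fibs_disjoint A.2.1 A'.2.1 (fun h => hAA' (Subtype.ext h)))
  have hall : {A : {A ∈ R.fibs | A ⊆ ℓ} | 0 < T₁.ν ℓ A} = univ := by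
    refine eq_univ_of_forall fun A => ?_
    obtain ⟨ℓ', hℓ', x, y, hA⟩ := fibs_isArc A.2.1
    have hℓℓ' : ℓ' = ℓ := T₁.line_unique hℓ' hℓ (hA.subset hA.left_mem) (A.2.2 hA.left_mem)
    subst hℓℓ'
    refine T₁.ν_arc_pos _ hℓ _ x y hA ?_
    rintro rfl
    obtain ⟨z, hz, hzB⟩ := exists_inter A.2.1 hB
    obtain ⟨z', hz', hzB'⟩ := exists_inter A.2.1 hB'
    obtain ⟨f, hf, a, b, hab, h1, h2, h3⟩ := hA.exists_isParam
    have hab' : a = b := hf.2.1 (h1.trans h2.symm)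
    rw [h3, hab', Icc_self, image_singleton] at hz hz'
    rw [mem_singleton_iff] at hz hz'
    exact hne (fibu_unique hB hB' hzB (by rw [hz, ← hz']; exact hzB'))
  rw [hall, countable_univ_iff] at h
  exact countable_coe_iff.1 h

end

namespace Rowing

variable {R : Tartan T₁ T₂} (G : R.Rowing)

/-- The stable streamline containing the fiber `A` admits a parametrization which leaves `A`
between the unstable fibers `B` and `B'`. -/
def Exotic (B B' A : Set S) : Prop :=
  ∃ g, IsParam (G.line A) g ∧ ∃ s₀ t, g s₀ = G.f A t ∧ t ∈ Ioo (G.p A B) (G.p A B') ∧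
    ∀ ε > 0, ∃ s ∈ Ioo s₀ (s₀ + ε), g s ∉ A

/-- The streamline of `A` has an arc from a point of `A` between `B` and `B'` to `O`, which avoids
`B` and `B'`, while `O` also avoids `A`. -/
def Hair (U O B B' A : Set S) : Prop :=
  ∃ g, IsParam (G.line A) g ∧ ∃ s₀ s₁ t, g s₀ = G.f A t ∧ t ∈ Ioo (G.p A B) (G.p A B') ∧ s₀ ≤ s₁ ∧
    (g '' Icc s₀ s₁ ⊆ U ∩ Bᶜ ∩ B'ᶜ) ∧ g s₁ ∈ O ∧ O ⊆ U ∩ Bᶜ ∩ B'ᶜ ∩ Aᶜ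

lemma not_three_hairs {U O B B' : Set S} (e : U ≃ₜ ℝ × ℝ) (hRU : R.Rs ∪ R.Ru ⊆ U)
    (hO : ∀ x ∈ O, ∀ y ∈ O, JoinedIn O x y) (hB : B ∈ R.fibu) (hB' : B' ∈ R.fibu)
    (hlt : G.κ B < G.κ B') (A : Fin 3 → Set S) (hA : ∀ i, A i ∈ R.fibs)
    (hh : ∀ i, G.Hair U O B B' (A i)) (hne : ∀ i k, i ≠ k → G.line (A i) ≠ G.line (A k)) :
    False := by
  choose g hg s₀ s₁ t ht htI hs hgU hgO hOU using hh
  have hAA : ∀ i k, i ≠ k → Disjoint (A i) (A k) := fun i k hik =>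
    R.fibs_disjoint (hA i) (hA k) fun h => hne i k hik (by rw [h])
  have hBB : Disjoint B B' := R.fibu_disjoint hB hB' (by rintro rfl; exact lt_irrefl _ hlt)
  have hsU : ∀ i, A i ⊆ U := fun i => (subset_sUnion_of_mem (hA i)).trans
    (R.fibs_cover.le.trans (subset_union_left.trans hRU))
  have huU : ∀ B ∈ R.fibu, B ⊆ U := fun B hB => (subset_sUnion_of_mem hB).trans
    (R.fibu_cover.le.trans (subset_union_right.trans hRU))
  have hll : ∀ i k, i ≠ k → Disjoint (G.line (A i)) (G.line (A k)) := fun i k hik =>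
    T₁.lines_disjoint (G.line_mem _ (hA i)) (G.line_mem _ (hA k)) (hne i k hik)
  have harc : ∀ B ∈ R.fibu, ∀ x ∈ B, ∀ y ∈ B, JoinedIn B x y := fun B hB x hx y hy => by
    obtain ⟨_, _, _, _, h⟩ := R.swap.fibs_isArc hB
    exact h.joinedIn_of_mem hx hy
  let P : Fin 3 → Set S := fun i => G.f (A i) '' uIcc (t i) (G.p (A i) B)
  let Q : Fin 3 → Set S := fun i => G.f (A i) '' uIcc (t i) (G.p (A i) B')
  let H : Fin 3 → Set S := fun i => g i '' Icc (s₀ i) (s₁ i)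
  have htA : ∀ i, t i ∈ Icc (G.lo (A i)) (G.hi (A i)) := fun i =>
    ⟨(G.p_mem _ (hA i) _ hB).1.trans (htI i).1.le, (htI i).2.le.trans (G.p_mem _ (hA i) _ hB').2⟩
  have hsub : ∀ i C, C ∈ R.fibu → G.f (A i) '' uIcc (t i) (G.p (A i) C) ⊆ A i := fun i C hC => by
    have := image_mono (f := G.f (A i)) (ordConnected_Icc.uIcc_subset (htA i)
      (G.p_mem _ (hA i) C hC))
    rwa [← G.eq _ (hA i)] at this
  have hPA : ∀ i, P i ⊆ A i := fun i => hsub i B hB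
  have hQA : ∀ i, Q i ⊆ A i := fun i => hsub i B' hB'
  have hHl : ∀ i, H i ⊆ G.line (A i) := fun i => by
    rw [← (hg i).2.2]; exact image_subset_range _ _
  have hPB : ∀ i, Disjoint (P i) B' := fun i => by
    rw [disjoint_left]
    rintro _ ⟨s, hs, rfl⟩ hz
    have h1 := G.eq_p (hA i) hB' (ordConnected_Icc.uIcc_subset (htA i)
      (G.p_mem _ (hA i) B hB) hs) hz
    rw [uIcc_of_ge (htI i).1.le, h1] at hs
    exact not_lt.2 hs.2 (htI i).2
  have hQB : ∀ i, Disjoint (Q i) B := fun i => by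
    rw [disjoint_left]
    rintro _ ⟨s, hs, rfl⟩ hz
    have h1 := G.eq_p (hA i) hB (ordConnected_Icc.uIcc_subset (htA i)
      (G.p_mem _ (hA i) B' hB') hs) hz
    rw [uIcc_of_le (htI i).2.le, h1] at hs
    exact not_lt.2 hs.1 (htI i).1
  have hHB : ∀ i, Disjoint (H i) B := fun i =>
    disjoint_left.2 fun x hx => (hgU i hx).1.2
  have hHB' : ∀ i, Disjoint (H i) B' := fun i =>
    disjoint_left.2 fun x hx => (hgU i hx).2
  have hOB : Disjoint O B := disjoint_left.2 fun x hx => (hOU 0 hx).1.1.2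
  have hOB' : Disjoint O B' := disjoint_left.2 fun x hx => (hOU 0 hx).1.2
  have hOA : ∀ i, Disjoint O (A i) := fun i => disjoint_left.2 fun x hx => (hOU i hx).2
  have hjoinP : ∀ i C, C ∈ R.fibu → JoinedIn (G.f (A i) '' uIcc (t i) (G.p (A i) C)) (g i (s₀ i))
      (G.f (A i) (G.p (A i) C)) := fun i C hC => by
    rw [ht i]
    exact (G.param _ (hA i)).joinedIn _ _
  let E : Fin 3 → Fin 3 → Set S := fun i => ![P i ∪ B, Q i ∪ B', H i ∪ O]
  refine not_disjoint_joinedIn e (fun i => g i (s₀ i))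
    ![G.f (A 0) (G.p (A 0) B), G.f (A 0) (G.p (A 0) B'), g 0 (s₁ 0)] E ?_ ?_ ?_
  · intro i j
    fin_cases j
    · exact union_subset ((hPA i).trans (hsU i)) (huU B hB)
    · exact union_subset ((hQA i).trans (hsU i)) (huU B' hB')
    · exact union_subset (fun x hx => (hgU i hx).1.1) (fun x hx => (hOU i hx).1.1.1)
  · intro i j
    fin_cases j
    · exact ((hjoinP i B hB).mono subset_union_left).trans
        ((harc B hB _ (G.pt_mem_u _ (hA i) _ hB) _ (G.pt_mem_u _ (hA 0) _ hB)).mono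
          subset_union_right)
    · exact ((hjoinP i B' hB').mono subset_union_left).trans
        ((harc B' hB' _ (G.pt_mem_u _ (hA i) _ hB') _ (G.pt_mem_u _ (hA 0) _ hB')).mono
          subset_union_right)
    · refine JoinedIn.trans (y := g i (s₁ i)) (JoinedIn.mono ?_ subset_union_left)
        ((hO _ (hgO i) _ (hgO 0)).mono subset_union_right)
      exact ((hg i).isArcIn (hs i)).joinedIn
  · have hPQ : ∀ i k, i ≠ k → Disjoint (P i ∪ B) (Q k ∪ B') := fun i k hik =>
      disjoint_union_left.2 ⟨disjoint_union_right.2 ⟨(hAA i k hik).mono (hPA i) (hQA k), hPB i⟩,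
        disjoint_union_right.2 ⟨(hQB k).symm, hBB⟩⟩
    have hPH : ∀ i k, i ≠ k → Disjoint (P i ∪ B) (H k ∪ O) := fun i k hik =>
      disjoint_union_left.2 ⟨disjoint_union_right.2
        ⟨(hll i k hik).mono ((hPA i).trans (G.subset_line (hA i))) (hHl k),
          (hOA i).symm.mono_left (hPA i)⟩, disjoint_union_right.2 ⟨(hHB k).symm, hOB.symm⟩⟩
    have hQH : ∀ i k, i ≠ k → Disjoint (Q i ∪ B') (H k ∪ O) := fun i k hik =>
      disjoint_union_left.2 ⟨disjoint_union_right.2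
        ⟨(hll i k hik).mono ((hQA i).trans (G.subset_line (hA i))) (hHl k),
          (hOA i).symm.mono_left (hQA i)⟩, disjoint_union_right.2 ⟨(hHB' k).symm, hOB'.symm⟩⟩
    intro i j k l hik hjl
    fin_cases j <;> fin_cases l
    · exact absurd rfl hjl
    · exact hPQ i k hik
    · exact hPH i k hik
    · exact (hPQ k i hik.symm).symm
    · exact absurd rfl hjl
    · exact hQH i k hik
    · exact (hPH k i hik.symm).symm
    · exact (hQH k i hik.symm).symm
    · exact absurd rfl hjl

variable [T2Space S] [CompactSpace S] [SecondCountableTopology S] [BorelSpace S]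

lemma countable_exotic {B B' : Set S} (hB : B ∈ R.fibu) (hB' : B' ∈ R.fibu)
    (hlt : G.κ B < G.κ B') : {A ∈ R.fibs | G.Exotic B B' A}.Countable := by
  obtain ⟨U, hU, hRU, ⟨e⟩⟩ := R.in_disk
  obtain ⟨O, hO, hO'⟩ := exists_countable_joined_basis hU e
  have hBB : B ≠ B' := by rintro rfl; exact lt_irrefl _ hlt
  have hcl : ∀ B ∈ R.fibu, IsClosed B := fun B hB => R.swap.isClosed_fibs hB
  have hW : IsOpen (U ∩ Bᶜ ∩ B'ᶜ) :=
    (hU.inter (hcl B hB).isOpen_compl).inter (hcl B' hB').isOpen_compl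
  have hsub : {A ∈ R.fibs | G.Exotic B B' A} ⊆
      ⋃ i, {A ∈ R.fibs | G.Hair U (O i) B B' A} := by
    rintro A ⟨hA, g, hg, s₀, t, ht, htI, hex⟩
    have htA : t ∈ Icc (G.lo A) (G.hi A) :=
      ⟨(G.p_mem _ hA _ hB).1.trans htI.1.le, htI.2.le.trans (G.p_mem _ hA _ hB').2⟩
    have htA' : G.f A t ∈ A := by
      have := mem_image_of_mem (G.f A) htA
      rwa [← G.eq _ hA] at this
    have hs₀ : g s₀ ∈ U ∩ Bᶜ ∩ B'ᶜ := by
      rw [ht]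
      refine ⟨⟨hRU (Or.inl ?_), fun h => ?_⟩, fun h => ?_⟩
      · rw [← R.fibs_cover]; exact ⟨A, hA, htA'⟩
      · exact htI.1.ne' (G.eq_p hA hB htA h)
      · exact htI.2.ne (G.eq_p hA hB' htA h)
    obtain ⟨ε, hε, hεW⟩ := Metric.isOpen_iff.1 (hW.preimage hg.1) s₀ hs₀
    obtain ⟨s₁, hs₁, hs₁A⟩ := hex ε hε
    have hIcc : g '' Icc s₀ s₁ ⊆ U ∩ Bᶜ ∩ B'ᶜ := by
      rintro _ ⟨s, hs, rfl⟩
      refine hεW ?_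
      rw [Real.ball_eq_Ioo]
      exact ⟨by linarith [hs.1], hs.2.trans_lt hs₁.2⟩
    have hmem := hIcc (mem_image_of_mem g (right_mem_Icc.2 hs₁.1.le))
    obtain ⟨i, hi, hi'⟩ := hO' _ (hW.inter (isClosed_fibs hA).isOpen_compl) (g s₁)
      ⟨⟨hmem, hs₁A⟩, hmem.1.1⟩
    exact mem_iUnion.2 ⟨i, hA, g, hg, s₀, s₁, t, ht, htI, hs₁.1.le, hIcc, hi,
      hi'.trans inter_subset_left⟩
  refine Countable.mono hsub (countable_iUnion fun i => ?_)
  set X := {A ∈ R.fibs | G.Hair U (O i) B B' A} with hX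
  have hfin : (G.line '' X).Finite := by
    by_contra hinf
    obtain ⟨s, hs, hcard⟩ := Set.Infinite.exists_subset_card_eq hinf 3
    obtain ⟨x, y, z, hxy, hxz, hyz, rfl⟩ := Finset.card_eq_three.1 hcard
    obtain ⟨A₀, hA₀, h₀⟩ := hs (show x ∈ _ by simp)
    obtain ⟨A₁, hA₁, h₁⟩ := hs (show y ∈ _ by simp)
    obtain ⟨A₂, hA₂, h₂⟩ := hs (show z ∈ _ by simp)
    subst h₀ h₁ h₂
    refine G.not_three_hairs e hRU (hO i) hB hB' hlt ![A₀, A₁, A₂] ?_ ?_ ?_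
    · intro j; fin_cases j
      exacts [hA₀.1, hA₁.1, hA₂.1]
    · intro j; fin_cases j
      exacts [hA₀.2, hA₁.2, hA₂.2]
    · intro j k hjk; fin_cases j <;> fin_cases k
      exacts [absurd rfl hjk, hxy, hxz, hxy.symm, absurd rfl hjk, hyz, hxz.symm, hyz.symm,
        absurd rfl hjk]
  refine Countable.mono (s₂ := ⋃ ℓ ∈ G.line '' X, {A ∈ R.fibs | A ⊆ ℓ}) ?_
    (hfin.countable.biUnion ?_)
  · intro A hA
    exact mem_biUnion (mem_image_of_mem _ hA) ⟨hA.1, G.subset_line hA.1⟩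
  · rintro _ ⟨A, hA, rfl⟩
    exact R.countable_fibs_subset (G.line_mem A hA.1) hB hB' hBB

end Rowing

end Tartan

namespace Tartan

variable {μ : Measure S} {T₁ T₂ : MeasuredTurbulation μ}

namespace Rowing

variable {R : Tartan T₁ T₂} (G : R.Rowing)

lemma arc_subset_of_not_exotic [T2Space S] [CompactSpace S] [SecondCountableTopology S]
    [BorelSpace S] {A B B' Φ : Set S} (hΦ : Φ ∈ R.fibs) (hB : B ∈ R.fibu)
    (hB' : B' ∈ R.fibu) (hne : ¬ G.Exotic B B' Φ) {w z : S} (hA : IsArcIn (G.line Φ) A w z)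
    {t : ℝ} (ht : t ∈ Ioo (G.p Φ B) (G.p Φ B')) (htw : G.f Φ t = w)
    (hAB : Disjoint A B) (hAB' : Disjoint A B') : A ⊆ Φ := by
  obtain ⟨f, hf, a, b, hab, rfl, rfl, rfl⟩ := hA.exists_isParam
  have hcl : IsClosed Φ := isClosed_fibs hΦ
  have hIc : ∀ c d, IsClosed (G.f Φ '' Icc c d) := fun c d =>
    (isCompact_Icc.image (G.param Φ hΦ).1).isClosed
  have hp := G.p_mem Φ hΦ B hB
  have hp' := G.p_mem Φ hΦ B' hB'
  have hwΦ : f a ∈ Φ := by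
    rw [G.eq Φ hΦ, ← htw]
    exact mem_image_of_mem _ ⟨hp.1.trans ht.1.le, ht.2.le.trans hp'.2⟩
  let s : Set ℝ := {x | ∀ u ∈ Icc a b, u < x → f u ∈ Φ}
  have hs : IsClosed s := by
    have : s = ⋂ u ∈ Icc a b ∩ {u | f u ∉ Φ}, Iic u := by
      ext x
      simp only [s, mem_ofPred_eq, mem_iInter, mem_inter_iff, mem_Iic]
      exact ⟨fun h u hu => not_lt.1 fun hx => hu.2 (h u hu.1 hx),
        fun h u hu hx => by_contra fun hn => not_le.2 hx (h u ⟨hu, hn⟩)⟩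
    rw [this]
    exact isClosed_biInter fun u _ => isClosed_Iic
  have hmem : ∀ x ∈ s ∩ Icc a b, ∀ u ∈ Icc a x, f u ∈ Φ := by
    rintro x ⟨hx, hxI⟩ u hu
    rcases hu.2.eq_or_lt with rfl | hlt
    · rcases hu.1.eq_or_lt with rfl | hlt
      · exact hwΦ
      · have h1 : u ∈ closure (Ioo a u) := by
          rw [closure_Ioo hlt.ne]; exact ⟨hlt.le, le_rfl⟩
        exact closure_minimal (t := f ⁻¹' Φ) (fun v hv => hx v ⟨hv.1.le, hv.2.le.trans hxI.2⟩ hv.2)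
          (hcl.preimage hf.1) h1
    · exact hx u ⟨hu.1, hu.2.trans hxI.2⟩ hlt
  have hsub : Icc a b ⊆ s := by
    refine IsClosed.Icc_subset_of_forall_exists_gt (hs.inter isClosed_Icc)
      (fun u hu hua => absurd hu.1 (not_le.2 hua)) ?_
    rintro x ⟨hx, hxI⟩ y hxy
    have hxI' : x ∈ Icc a b := ⟨hxI.1, hxI.2.le⟩
    have hin := hmem x ⟨hx, hxI'⟩
    have hpre : IsPreconnected (f '' Icc a x) := isPreconnected_Icc.image _ hf.1.continuousOn
    have hbetween : f x ∈ G.f Φ '' Ioo (G.p Φ B) (G.p Φ B') := by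
      have hsubA : f '' Icc a x ⊆ f '' Icc a b := image_mono (Icc_subset_Icc_right hxI'.2)
      have hend : ∀ r, G.f Φ r ∈ f '' Icc a x → r ≠ G.p Φ B ∧ r ≠ G.p Φ B' := by
        refine fun r hr => ⟨?_, ?_⟩
        · rintro rfl
          exact disjoint_left.1 hAB (hsubA hr) (G.pt_mem_u Φ hΦ B hB)
        · rintro rfl
          exact disjoint_left.1 hAB' (hsubA hr) (G.pt_mem_u Φ hΦ B' hB')
      by_contra hcon
      have hfx : f x ∈ Φ := hin x ⟨hxI.1, le_rfl⟩
      have hfx' := hfx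
      rw [G.eq Φ hΦ] at hfx'
      obtain ⟨q, hq, hqx⟩ := hfx'
      have hxx : f x ∈ f '' Icc a x := mem_image_of_mem _ ⟨hxI.1, le_rfl⟩
      obtain ⟨v, hv, ⟨r, hr, hrv⟩, hv2⟩ := isPreconnected_closed_iff.1 hpre
        (G.f Φ '' Icc (G.p Φ B) (G.p Φ B'))
        (G.f Φ '' Icc (G.lo Φ) (G.p Φ B) ∪ G.f Φ '' Icc (G.p Φ B') (G.hi Φ))
        (hIc _ _) ((hIc _ _).union (hIc _ _)) (by
          rintro _ ⟨u, hu, rfl⟩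
          have := hin u hu
          rw [G.eq Φ hΦ] at this
          obtain ⟨r, hr, hru⟩ := this
          rw [← hru]
          rcases le_total r (G.p Φ B) with h | h
          · exact Or.inr (Or.inl ⟨r, ⟨hr.1, h⟩, rfl⟩)
          rcases le_total (G.p Φ B') r with h' | h'
          · exact Or.inr (Or.inr ⟨r, ⟨h', hr.2⟩, rfl⟩)
          exact Or.inl ⟨r, ⟨h, h'⟩, rfl⟩)
        ⟨f a, mem_image_of_mem _ ⟨le_rfl, hxI.1⟩, t, ⟨ht.1.le, ht.2.le⟩, htw⟩
        ⟨f x, hxx, by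
          rw [← hqx]
          rcases le_or_gt q (G.p Φ B) with h | h
          · exact Or.inl ⟨q, ⟨hq.1, h⟩, rfl⟩
          · exact Or.inr ⟨q, ⟨not_lt.1 fun h' => hcon ⟨q, ⟨h, h'⟩, hqx⟩, hq.2⟩, rfl⟩⟩
      rw [← hrv] at hv hv2
      have he := hend r hv
      rcases hv2 with ⟨r', hr', h⟩ | ⟨r', hr', h⟩ <;>
      · have := (G.param Φ hΦ).2.1 h
        subst this
        first
          | exact he.1 (le_antisymm hr'.2 hr.1)
          | exact he.2 (le_antisymm hr.2 hr'.1)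
    obtain ⟨q, hq, hqx⟩ := hbetween
    have : ∃ ε > 0, ∀ s ∈ Ioo x (x + ε), f s ∈ Φ := by
      by_contra hcon
      push Not at hcon
      exact hne ⟨f, hf, x, q, hqx.symm, hq, hcon⟩
    obtain ⟨ε, hε, hεΦ⟩ := this
    refine ⟨min y (x + ε), fun u hu huy => ?_, lt_min hxy (by linarith), min_le_left _ _⟩
    rcases le_or_gt u x with h | h
    · exact hin u ⟨hu.1, h⟩
    · exact hεΦ u ⟨h, huy.trans_le (min_le_right _ _)⟩
  rintro _ ⟨u, hu, rfl⟩
  exact hmem b ⟨hsub ⟨hab, le_rfl⟩, hab, le_rfl⟩ u hu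

/-- Two points in different columns of a frame cannot be joined in the disk avoiding the frame
and a column between them. -/
lemma not_joinedIn_of_between (G' : R.swap.Rowing) {U X : Set S} (e : U ≃ₜ ℝ × ℝ)
    (hRU : R.Rs ∪ R.Ru ⊆ U) {b b' c c' k d d' D D' : Set S}
    (hb : b ∈ R.fibu) (hb' : b' ∈ R.fibu) (hc : c ∈ R.fibu) (hc' : c' ∈ R.fibu) (hk : k ∈ R.fibu)
    (hd : d ∈ R.fibs) (hd' : d' ∈ R.fibs) (hD : D ∈ R.fibs) (hD' : D' ∈ R.fibs)
    (h1 : G.κ b < G.κ c) (h2 : G.κ c < G.κ k) (h3 : G.κ k < G.κ c') (h4 : G.κ c' < G.κ b')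
    (h5 : G'.κ d ∈ Ioo (G'.κ D) (G'.κ D')) (h6 : G'.κ d' ∈ Ioo (G'.κ D) (G'.κ D'))
    (hXU : X ⊆ U) (hXb : Disjoint X b) (hXb' : Disjoint X b') (hXk : Disjoint X k)
    (hXD : Disjoint X D) (hXD' : Disjoint X D')
    {w w' : S} (hwd : w ∈ d) (hwc : w ∈ c) (hwd' : w' ∈ d') (hwc' : w' ∈ c')
    (hX : JoinedIn X w w') : False := by
  have hsU : ∀ A ∈ R.fibs, A ⊆ U := fun A hA => (subset_sUnion_of_mem hA).trans
    (R.fibs_cover.le.trans (subset_union_left.trans hRU))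
  have huU : ∀ B ∈ R.fibu, B ⊆ U := fun B hB => (subset_sUnion_of_mem hB).trans
    (R.fibu_cover.le.trans (subset_union_right.trans hRU))
  obtain ⟨sR, hsR⟩ : ∃ s, s = G.seg := ⟨_, rfl⟩
  obtain ⟨sC, hsC⟩ : ∃ s, s = G'.seg := ⟨_, rfl⟩
  have hRs : ∀ {A B B'}, A ∈ R.fibs → B ∈ R.fibu → B' ∈ R.fibu → sR A B B' ⊆ A :=
    fun hA hB hB' => hsR ▸ G.seg_subset hA hB hB'
  have hCs : ∀ {B A A'}, B ∈ R.fibu → A ∈ R.fibs → A' ∈ R.fibs → sC B A A' ⊆ B :=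
    fun hB hA hA' => hsC ▸ G'.seg_subset hB hA hA'
  have hpt : ∀ {A B}, A ∈ R.fibs → B ∈ R.fibu → G'.f B (G'.p B A) = G.f A (G.p A B) :=
    fun hA hB => G.eq_pt hA hB (G'.pt_mem_u _ hB _ hA) (G'.pt_mem_s hB hA)
  have hw : w = G.f d (G.p d c) := G.eq_pt hd hc hwd hwc
  have hw' : w' = G.f d' (G.p d' c') := G.eq_pt hd' hc' hwd' hwc'
  have jR : ∀ {A B B'}, A ∈ R.fibs → JoinedIn (sR A B B') (G.f A (G.p A B)) (G.f A (G.p A B')) :=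
    fun hA => hsR ▸ G.seg_joinedIn hA
  have jC : ∀ {B A A'}, B ∈ R.fibu → A ∈ R.fibs → A' ∈ R.fibs →
      JoinedIn (sC B A A') (G.f A (G.p A B)) (G.f A' (G.p A' B)) := fun {B A A'} hB hA hA' => by
    have := G'.seg_joinedIn (B := A) (B' := A') hB
    rwa [hpt hA hB, hpt hA' hB, ← hsC] at this
  have uRR : ∀ {A A'}, A ∈ R.fibs → A' ∈ R.fibs → G'.κ A ≠ G'.κ A' → Disjoint A A' :=
    fun hA hA' h => R.fibs_disjoint hA hA' fun h' => h (by rw [h'])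
  have uCC : ∀ {A A'}, A ∈ R.fibu → A' ∈ R.fibu → G.κ A ≠ G.κ A' → Disjoint A A' :=
    fun hA hA' h => R.fibu_disjoint hA hA' fun h' => h (by rw [h'])
  let E : Fin 3 → Fin 3 → Set S :=
    ![![sC b d D' ∪ sR D' b k, sC b d D ∪ sR D b k, sR d b c],
      ![sC b' d' D' ∪ sR D' b' k, sC b' d' D ∪ sR D b' k, sR d' b' c' ∪ X],
      ![sC k d D', sC k d D, sR d k c]]
  have hlt : ∀ i j k l : Fin 3, i < k → j ≠ l → Disjoint (E i j) (E k l) := by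
    obtain ⟨h5, h5'⟩ := h5
    obtain ⟨h6, h6'⟩ := h6
    have cc : ∀ {B A A' C D D'}, B ∈ R.fibu → A ∈ R.fibs → A' ∈ R.fibs → C ∈ R.fibu → D ∈ R.fibs →
        D' ∈ R.fibs → G.κ B ≠ G.κ C → Disjoint (sC B A A') (sC C D D') :=
      fun hB hA hA' hC hD hD' h => (uCC hB hC h).mono (hCs hB hA hA') (hCs hC hD hD')
    have rr : ∀ {B A A' C D D'}, B ∈ R.fibs → A ∈ R.fibu → A' ∈ R.fibu → C ∈ R.fibs → D ∈ R.fibu →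
        D' ∈ R.fibu → G'.κ B ≠ G'.κ C → Disjoint (sR B A A') (sR C D D') :=
      fun hB hA hA' hC hD hD' h => (uRR hB hC h).mono (hRs hB hA hA') (hRs hC hD hD')
    have rc : ∀ {A B B' C D D'}, A ∈ R.fibs → B ∈ R.fibu → B' ∈ R.fibu → C ∈ R.fibu → D ∈ R.fibs →
        D' ∈ R.fibs → (G.κ C ∉ uIcc (G.κ B) (G.κ B') ∨ G'.κ A ∉ uIcc (G'.κ D) (G'.κ D')) →
        Disjoint (sR A B B') (sC C D D') := by
      intro A B B' C D D' hA hB hB' hC hD hD' h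
      rw [hsR, hsC]
      rcases h with h | h
      · exact (G.disjoint_seg hA hB hB' hC h).mono_right (G'.seg_subset hC hD hD')
      · exact (G'.disjoint_seg hC hD hD' hA h).symm.mono_left (G.seg_subset hA hB hB')
    have xC : ∀ {B A A'}, B ∈ R.fibu → A ∈ R.fibs → A' ∈ R.fibs → Disjoint X B →
      Disjoint X (sC B A A') := fun hB hA hA' h => h.mono_right (hCs hB hA hA')
    have xR : ∀ {A B B'}, A ∈ R.fibs → B ∈ R.fibu → B' ∈ R.fibu → Disjoint X A →
      Disjoint X (sR A B B') := fun hB hA hA' h => h.mono_right (hRs hB hA hA')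
    have no : ∀ {x y z : ℝ}, x < y → x < z → x ∉ uIcc y z := fun h h' hx =>
      not_lt.2 hx.1 (lt_min h h')
    have no' : ∀ {x y z : ℝ}, y < x → z < x → x ∉ uIcc y z := fun h h' hx =>
      not_lt.2 hx.2 (max_lt h h')
    intro i j k l hik hjl
    fin_cases i <;> fin_cases k <;> first | exact absurd hik (by decide) | skip
    all_goals
      fin_cases j <;> fin_cases l <;> first | exact absurd rfl hjl | skip
    all_goals
      simp only [E, Fin.zero_eta, Fin.mk_one, Fin.reduceFinMk, Matrix.cons_val,
        disjoint_union_left, disjoint_union_right]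
      repeat' apply And.intro
    all_goals
      first
      | exact xC ‹_› ‹_› ‹_› ‹_›
      | exact xR ‹_› ‹_› ‹_› ‹_›
      | exact (xC ‹_› ‹_› ‹_› ‹_›).symm
      | exact (xR ‹_› ‹_› ‹_› ‹_›).symm
      | exact cc ‹_› ‹_› ‹_› ‹_› ‹_› ‹_› (ne_of_lt (by linarith))
      | exact cc ‹_› ‹_› ‹_› ‹_› ‹_› ‹_› (ne_of_gt (by linarith))
      | exact rr ‹_› ‹_› ‹_› ‹_› ‹_› ‹_› (ne_of_lt (by linarith))
      | exact rr ‹_› ‹_› ‹_› ‹_› ‹_› ‹_› (ne_of_gt (by linarith))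
      | (refine rc ‹_› ‹_› ‹_› ‹_› ‹_› ‹_› ?_
         first
         | exact Or.inl (no (by linarith) (by linarith))
         | exact Or.inr (no (by linarith) (by linarith))
         | exact Or.inl (no' (by linarith) (by linarith))
         | exact Or.inr (no' (by linarith) (by linarith)))
      | (refine (rc ‹_› ‹_› ‹_› ‹_› ‹_› ‹_› ?_).symm
         first
         | exact Or.inl (no (by linarith) (by linarith))
         | exact Or.inr (no (by linarith) (by linarith))
         | exact Or.inl (no' (by linarith) (by linarith))
         | exact Or.inr (no' (by linarith) (by linarith)))
  refine not_disjoint_joinedIn e ![G.f d (G.p d b), G.f d' (G.p d' b'), G.f d (G.p d k)]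
    ![G.f D' (G.p D' k), G.f D (G.p D k), w] E ?_ ?_ ?_
  · intro i j
    fin_cases i <;> fin_cases j <;>
    simp only [E, Fin.zero_eta, Fin.mk_one, Fin.reduceFinMk, Matrix.cons_val, union_subset_iff]
    · exact ⟨(hCs hb hd hD').trans (huU _ hb), (hRs hD' hb hk).trans (hsU _ hD')⟩
    · exact ⟨(hCs hb hd hD).trans (huU _ hb), (hRs hD hb hk).trans (hsU _ hD)⟩
    · exact (hRs hd hb hc).trans (hsU _ hd)
    · exact ⟨(hCs hb' hd' hD').trans (huU _ hb'), (hRs hD' hb' hk).trans (hsU _ hD')⟩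
    · exact ⟨(hCs hb' hd' hD).trans (huU _ hb'), (hRs hD hb' hk).trans (hsU _ hD)⟩
    · exact ⟨(hRs hd' hb' hc').trans (hsU _ hd'), hXU⟩
    · exact (hCs hk hd hD').trans (huU _ hk)
    · exact (hCs hk hd hD).trans (huU _ hk)
    · exact (hRs hd hk hc).trans (hsU _ hd)
  · have tr : ∀ {s t : Set S} {x y z : S}, JoinedIn s x y → JoinedIn t y z → JoinedIn (s ∪ t) x z :=
      fun h h' => (h.mono subset_union_left).trans (h'.mono subset_union_right)
    intro i j
    fin_cases i <;> fin_cases j <;>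
    simp only [E, Fin.zero_eta, Fin.mk_one, Fin.reduceFinMk, Matrix.cons_val]
    · exact tr (jC hb hd hD') (jR hD')
    · exact tr (jC hb hd hD) (jR hD)
    · exact hw ▸ jR hd
    · exact tr (jC hb' hd' hD') (jR hD')
    · exact tr (jC hb' hd' hD) (jR hD)
    · exact tr (jR hd') (hw' ▸ hX.symm)
    · exact jC hk hd hD'
    · exact jC hk hd hD
    · exact hw ▸ jR hd
  · intro i j k l hik hjl
    rcases hik.lt_or_gt with h | h
    · exact hlt i j k l h hjl
    · exact (hlt k l i j h hjl.symm).symm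

end Rowing
end Tartan

namespace Tartan

variable {μ : Measure S} {T₁ T₂ : MeasuredTurbulation μ}
variable [T2Space S] [CompactSpace S] [SecondCountableTopology S] [BorelSpace S]

namespace Rowing

variable {R : Tartan T₁ T₂} (G : R.Rowing)

/-- If two core points in a frame are joined, inside the frame, by two short stable arcs and an
unstable arc, then few columns separate them. -/
lemma measure_between_le (G' : R.swap.Rowing) {U : Set S} (e : U ≃ₜ ℝ × ℝ)
    (hRU : R.Rs ∪ R.Ru ⊆ U) {M : ℝ≥0∞}
    (hM : ∀ A ∈ R.fibs, ∀ ℓ ∈ T₁.lines, A ⊆ ℓ → ∀ X, MeasurableSet X → X ⊆ A ∩ R.core →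
      μ {v ∈ R.core | (R.col v ∩ X).Nonempty} = M * T₁.ν ℓ X)
    (hnull : ∀ B ∈ R.fibu, μ (R.core ∩ B) = 0)
    {b b' D D' : Set S} (hb : b ∈ R.fibu) (hb' : b' ∈ R.fibu) (hD : D ∈ R.fibs) (hD' : D' ∈ R.fibs)
    {r : ℝ≥0∞} {O : Set S} (hO : O = U ∩ bᶜ ∩ b'ᶜ ∩ Dᶜ ∩ D'ᶜ)
    {ℓJ J x y : _} (hℓJ : ℓJ ∈ T₂.lines) (hJ : IsArcIn ℓJ J x y) (hJO : J ⊆ O)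
    {w w' : S} (hw : w ∈ R.core) (hw' : w' ∈ R.core)
    (hκ : G.κ (R.col w) ∈ Ioo (G.κ b) (G.κ b')) (hκ' : G.κ (R.col w') ∈ Ioo (G.κ b) (G.κ b'))
    (hρ : G'.κ (R.swap.col w) ∈ Ioo (G'.κ D) (G'.κ D'))
    (hρ' : G'.κ (R.swap.col w') ∈ Ioo (G'.κ D) (G'.κ D'))
    (hE : ¬ G.Exotic b b' (R.swap.col w)) (hE' : ¬ G.Exotic b b' (R.swap.col w'))
    (hA : ∃ ℓ ∈ T₁.lines, ∃ A z, IsArcIn ℓ A w z ∧ z ∈ J ∧ T₁.ν ℓ A ≤ r ∧ A ⊆ O)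
    (hA' : ∃ ℓ ∈ T₁.lines, ∃ A z, IsArcIn ℓ A w' z ∧ z ∈ J ∧ T₁.ν ℓ A ≤ r ∧ A ⊆ O) :
    μ {v ∈ R.core | G.κ (R.col v) ∈ Ioo (G.κ (R.col w)) (G.κ (R.col w'))} ≤ M * r + M * r := by
  have key : ∀ w ∈ R.core, G.κ (R.col w) ∈ Ioo (G.κ b) (G.κ b') →
      ¬ G.Exotic b b' (R.swap.col w) →
      (∃ ℓ ∈ T₁.lines, ∃ A z, IsArcIn ℓ A w z ∧ z ∈ J ∧ T₁.ν ℓ A ≤ r ∧ A ⊆ O) →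
      ∃ A z, JoinedIn A w z ∧ z ∈ J ∧ A ⊆ O ∧ A ⊆ R.swap.col w ∧
        μ {v ∈ R.core | (R.col v ∩ (A ∩ R.core)).Nonempty} ≤ M * r := by
    rintro w hw hκ hE ⟨ℓ, hℓ, A, z, hA, hz, hr, hAO⟩
    obtain ⟨hcf, hwc⟩ := col_mem hw
    obtain ⟨hrf, hwr⟩ := R.swap.col_mem (v := w) (by rwa [core_swap])
    change R.swap.col w ∈ R.fibs at hrf
    have hℓ' : G.line (R.swap.col w) = ℓ := T₁.line_unique (G.line_mem _ hrf) hℓ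
      (G.subset_line hrf hwr) (hA.subset hA.left_mem)
    subst hℓ'
    have hwp : w = G.f _ (G.p (R.swap.col w) (R.col w)) := G.eq_pt hrf hcf hwr hwc
    have hsub : A ⊆ R.swap.col w := by
      refine G.arc_subset_of_not_exotic hrf hb hb' hE hA
        ⟨(G.p_lt hrf hb hcf).2 hκ.1, (G.p_lt hrf hcf hb').2 hκ.2⟩ hwp.symm ?_ ?_
      · rw [hO] at hAO
        exact disjoint_left.2 fun x hx => (hAO hx).1.1.1.2
      · rw [hO] at hAO
        exact disjoint_left.2 fun x hx => (hAO hx).1.1.2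
    refine ⟨A, z, hA.joinedIn, hz, hAO, hsub, ?_⟩
    rw [hM _ hrf _ hℓ (G.subset_line hrf) _ (hA.measurableSet.inter R.measurableSet_core)
      (inter_subset_inter_left _ hsub)]
    gcongr
    exact (measure_mono inter_subset_left).trans hr
  obtain ⟨A, z, hAj, hz, hAO, hAr, hAμ⟩ := key w hw hκ hE hA
  obtain ⟨A', z', hAj', hz', hAO', hAr', hAμ'⟩ := key w' hw' hκ' hE' hA'
  have hDD : D ≠ D' := by
    rintro rfl
    exact lt_asymm hρ.1 hρ.2
  have hcount : {B ∈ R.fibu | B ⊆ ℓJ}.Countable := R.swap.countable_fibs_subset hℓJ hD hD' hDD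
  have hnull' : μ (⋃ B ∈ {B ∈ R.fibu | B ⊆ ℓJ}, R.core ∩ B) = 0 :=
    (measure_biUnion_null_iff hcount).2 fun B hB => hnull B hB.1
  by_contra! hcon
  have hex : ∃ v ∈ R.core, G.κ (R.col v) ∈ Ioo (G.κ (R.col w)) (G.κ (R.col w')) ∧
      ¬ (R.col v ∩ (A ∩ R.core)).Nonempty ∧ ¬ (R.col v ∩ (A' ∩ R.core)).Nonempty ∧
      ¬ R.col v ⊆ ℓJ := by
    by_contra! hall
    refine not_le.2 hcon ?_
    calc _ ≤ μ (({v ∈ R.core | (R.col v ∩ (A ∩ R.core)).Nonempty} ∪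
            {v ∈ R.core | (R.col v ∩ (A' ∩ R.core)).Nonempty}) ∪
            ⋃ B ∈ {B ∈ R.fibu | B ⊆ ℓJ}, R.core ∩ B) := by
          refine measure_mono ?_
          rintro v ⟨hv, hvI⟩
          by_cases h1 : (R.col v ∩ (A ∩ R.core)).Nonempty
          · exact Or.inl (Or.inl ⟨hv, h1⟩)
          by_cases h2 : (R.col v ∩ (A' ∩ R.core)).Nonempty
          · exact Or.inl (Or.inr ⟨hv, h2⟩)
          have h3 := hall v hv hvI (not_nonempty_iff_eq_empty.1 h1)
            (not_nonempty_iff_eq_empty.1 h2)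
          exact Or.inr (mem_biUnion ⟨(col_mem hv).1, h3⟩ ⟨hv, (col_mem hv).2⟩)
      _ ≤ M * r + M * r + 0 := by
          refine (measure_union_le _ _).trans (add_le_add ((measure_union_le _ _).trans
            (add_le_add hAμ hAμ')) hnull'.le)
      _ = _ := add_zero _
  obtain ⟨v, hv, hvI, hvA, hvA', hvJ⟩ := hex
  obtain ⟨hkf, hvk⟩ := col_mem hv
  obtain ⟨hcf, hwc⟩ := col_mem hw
  obtain ⟨hcf', hwc'⟩ := col_mem hw'
  obtain ⟨hrf, hwr⟩ := R.swap.col_mem (v := w) (by rwa [core_swap])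
  obtain ⟨hrf', hwr'⟩ := R.swap.col_mem (v := w') (by rwa [core_swap])
  have hXO : A ∪ J ∪ A' ⊆ O := union_subset (union_subset hAO hJO) hAO'
  rw [hO] at hXO
  have hdisjA : ∀ A w, A ⊆ R.swap.col w → R.swap.col w ∈ R.fibs →
      ¬ (R.col v ∩ (A ∩ R.core)).Nonempty → Disjoint A (R.col v) := fun A w h hrf hn =>
    disjoint_left.2 fun x hx hxv => hn ⟨x, hxv, hx, mem_core hrf hkf (h hx) hxv⟩
  refine G.not_joinedIn_of_between G' e hRU hb hb' hcf hcf' hkf hrf hrf' hD hD'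
    hκ.1 hvI.1 hvI.2 hκ'.2 hρ hρ' (X := A ∪ J ∪ A') (fun x hx => (hXO hx).1.1.1.1)
    (disjoint_left.2 fun x hx => (hXO hx).1.1.1.2) (disjoint_left.2 fun x hx => (hXO hx).1.1.2)
    ?_ (disjoint_left.2 fun x hx => (hXO hx).1.2) (disjoint_left.2 fun x hx => (hXO hx).2)
    hwr hwc hwr' hwc' ?_
  · rw [disjoint_union_left, disjoint_union_left]
    refine ⟨⟨hdisjA A w hAr hrf hvA, ?_⟩, hdisjA A' w' hAr' hrf' hvA'⟩
    refine disjoint_left.2 fun x hx hxv => hvJ ?_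
    obtain ⟨ℓ, hℓ, _, _, hk⟩ := R.swap.fibs_isArc hkf
    rw [← T₂.line_unique hℓ hℓJ (hk.subset hxv) (hJ.subset hx)]
    exact hk.subset
  · exact ((hAj.mono (subset_union_left.trans subset_union_left)).trans
      ((hJ.joinedIn_of_mem hz hz').mono (subset_union_right.trans subset_union_left))).trans
      (hAj'.symm.mono subset_union_right)

end Rowing
end Tartan

namespace Tartan

variable {μ : Measure S} {T₁ T₂ : MeasuredTurbulation μ}
variable [T2Space S] [CompactSpace S] [SecondCountableTopology S] [BorelSpace S]

variable {R : Tartan T₁ T₂}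

/-- Most of the core of a compatible tartan consists of points which only short stable arcs
of small total measure can join to a given short unstable arc. -/
theorem Compatible.exists_control [IsFiniteMeasure μ] (hR : R.Compatible) (h1 : T₁.Tame)
    (h2 : T₂.Tame) {ε : ℝ≥0∞} (hε : 0 < ε) :
    ∃ K, MeasurableSet K ∧ μ (R.core \ K) ≤ ε ∧
    ∃ δ > (0 : ℝ), ∃ C : ℝ≥0∞, C < ⊤ ∧ ∀ ℓJ ∈ T₂.lines, ∀ J x y, IsArcIn ℓJ J x y →
      T₂.ν ℓJ J < ENNReal.ofReal δ → ∀ r < ENNReal.ofReal δ,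
      μ {w ∈ K | ∃ ℓ ∈ T₁.lines, ∃ A z, IsArcIn ℓ A w z ∧ z ∈ J ∧ T₁.ν ℓ A ≤ r} ≤ C * r := by
  by_cases htriv : μ R.core ≤ ε
  · exact ⟨∅, MeasurableSet.empty, (by rwa [sdiff_empty]), 1, one_pos, 0, ENNReal.zero_lt_top, by simp⟩
  rcases R.core.eq_empty_or_nonempty with hc | hc
  · exact absurd (by simp [hc]) htriv
  obtain ⟨U, hU, hRU, ⟨e⟩⟩ := R.in_disk
  obtain ⟨v, hv⟩ := hc
  obtain ⟨A₀, hA₀, -⟩ := exists_fibs hv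
  obtain ⟨G⟩ := R.exists_rowing ⟨A₀, hA₀⟩
  obtain ⟨G'⟩ := R.swap.exists_rowing ⟨_, (col_mem hv).1⟩
  have hε3 : 0 < ε / 3 := ENNReal.div_pos hε.ne' (by simp)
  obtain ⟨b, hb, b', hb', hm, hle⟩ := G.exists_frame hR ⟨v, hv⟩ hε3
  obtain ⟨D, hD, D', hD', hm', hle'⟩ := G'.exists_frame hR.swap ⟨v, by rwa [core_swap]⟩ hε3
  rw [core_swap] at hm' hle'
  change D ∈ R.fibs at hD
  change D' ∈ R.fibs at hD'
  rcases le_or_gt (G.κ b') (G.κ b) with hbb | hlt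
  · have hε' : ε / 3 ≤ ε := ENNReal.div_le_of_le_mul (le_mul_of_one_le_right' (by norm_num))
    refine absurd ((measure_mono fun v hv => ?_).trans (hle.trans hε')) htriv
    refine ⟨hv, ?_⟩
    rw [Ioo_eq_empty (not_lt.2 hbb)]
    exact notMem_empty _
  have hcount := G.countable_exotic hb hb' hlt
  let X := ⋃ A ∈ {A ∈ R.fibs | G.Exotic b b' A}, A
  have hXm : MeasurableSet X := MeasurableSet.biUnion hcount fun A hA => measurableSet_fibs hA.1
  have hX0 : μ (R.core ∩ X) = 0 := by
    rw [inter_iUnion₂]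
    refine (measure_biUnion_null_iff hcount).2 fun A hA => ?_
    rw [← core_swap]
    exact hR.swap.measure_core_inter_fibu hA.1
  let K₀ := ({v ∈ R.core | G.κ (R.col v) ∈ Ioo (G.κ b) (G.κ b')} ∩
    {v ∈ R.core | G'.κ (R.swap.col v) ∈ Ioo (G'.κ D) (G'.κ D')}) \ X
  have hK₀m : MeasurableSet K₀ := (hm.inter hm').diff hXm
  let O := U ∩ bᶜ ∩ b'ᶜ ∩ Dᶜ ∩ D'ᶜ
  have hO : IsOpen O := by
    have h1 : ∀ B ∈ R.fibu, IsOpen Bᶜ := fun B hB => (R.swap.isClosed_fibs hB).isOpen_compl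
    have h2 : ∀ B ∈ R.fibs, IsOpen Bᶜ := fun B hB => (R.isClosed_fibs hB).isOpen_compl
    exact (((hU.inter (h1 b hb)).inter (h1 b' hb')).inter (h2 D hD)).inter (h2 D' hD')
  have hK₀O : K₀ ⊆ O := by
    rintro w ⟨⟨⟨hw, hwκ⟩, -, hwρ⟩, -⟩
    refine ⟨⟨⟨⟨hRU (Or.inl hw.1), fun h => ?_⟩, fun h => ?_⟩, fun h => ?_⟩, fun h => ?_⟩
    · rw [col_eq hb h] at hwκ; exact lt_irrefl _ hwκ.1
    · rw [col_eq hb' h] at hwκ; exact lt_irrefl _ hwκ.2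
    · rw [R.swap.col_eq hD h] at hwρ; exact lt_irrefl _ hwρ.1
    · rw [R.swap.col_eq hD' h] at hwρ; exact lt_irrefl _ hwρ.2
  obtain ⟨K, hKK, hK, hKμ⟩ := hK₀m.exists_isCompact_sdiff_lt (measure_ne_top μ _) hε3.ne'
  obtain ⟨L, hL, hKL, hLO⟩ := exists_compact_between hK hO (hKK.trans hK₀O)
  obtain ⟨δ₁, hδ₁, H₁⟩ := h1.exists_subset hK isOpen_interior hKL
  obtain ⟨δ₂, hδ₂, H₂⟩ := h2.exists_subset hL hO hLO
  obtain ⟨M, hM, HM⟩ := hR.exists_measure_col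
  obtain ⟨m, _, m0, hmμ⟩ := G.exists_law hR
  refine ⟨K, hK.measurableSet, ?_, min δ₁ δ₂, lt_min hδ₁ hδ₂, M + M, ENNReal.add_lt_top.2 ⟨hM, hM⟩, ?_⟩
  · calc μ (R.core \ K) ≤ μ (({v ∈ R.core | G.κ (R.col v) ∉ Ioo (G.κ b) (G.κ b')} ∪
          {v ∈ R.core | G'.κ (R.swap.col v) ∉ Ioo (G'.κ D) (G'.κ D')}) ∪
          ((R.core ∩ X) ∪ (K₀ \ K))) := by
          refine measure_mono ?_
          rintro w ⟨hw, hwK⟩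
          by_cases i1 : G.κ (R.col w) ∈ Ioo (G.κ b) (G.κ b')
          · by_cases i2 : G'.κ (R.swap.col w) ∈ Ioo (G'.κ D) (G'.κ D')
            · by_cases i3 : w ∈ X
              · exact Or.inr (Or.inl ⟨hw, i3⟩)
              · exact Or.inr (Or.inr ⟨⟨⟨⟨hw, i1⟩, hw, i2⟩, i3⟩, hwK⟩)
            · exact Or.inl (Or.inr ⟨hw, i2⟩)
          · exact Or.inl (Or.inl ⟨hw, i1⟩)
      _ ≤ (ε / 3 + ε / 3) + (0 + ε / 3) := by
          refine (measure_union_le _ _).trans (add_le_add ((measure_union_le _ _).trans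
            (add_le_add hle hle')) ((measure_union_le _ _).trans (add_le_add hX0.le hKμ.le)))
      _ = ε := by rw [zero_add, ENNReal.add_thirds]
  intro ℓJ hℓJ J x y hJ hJν r hr
  let N := {w ∈ K | ∃ ℓ ∈ T₁.lines, ∃ A z, IsArcIn ℓ A w z ∧ z ∈ J ∧ T₁.ν ℓ A ≤ r}
  have hr1 : r < ENNReal.ofReal δ₁ := hr.trans_le (ENNReal.ofReal_le_ofReal (min_le_left _ _))
  have hN : ∀ w ∈ N, J ⊆ O ∧
      ∃ ℓ ∈ T₁.lines, ∃ A z, IsArcIn ℓ A w z ∧ z ∈ J ∧ T₁.ν ℓ A ≤ r ∧ A ⊆ O := by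
    rintro w ⟨hwK, ℓ, hℓ, A, z, hA, hz, hAr⟩
    have hAL : A ⊆ L :=
      (H₁ ℓ hℓ A w z hA (hAr.trans_lt hr1) ⟨w, hA.left_mem, hwK⟩).trans interior_subset
    exact ⟨H₂ ℓJ hℓJ J x y hJ (hJν.trans_le (ENNReal.ofReal_le_ofReal (min_le_right _ _)))
      ⟨z, hz, hAL hA.right_mem⟩, ℓ, hℓ, A, z, hA, hz, hAr, hAL.trans hLO⟩
  have hNc : N ⊆ R.core := fun w hw => (hKK hw.1).1.1.1
  let P := (fun v => G.κ (R.col v)) '' N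
  have hP : P ⊆ Icc (G.lo G.base) (G.hi G.base) := by
    rintro _ ⟨v, hv, rfl⟩
    exact G.κ_mem (col_mem (hNc hv)).1
  have hbb := bddBelow_Icc.mono hP
  have hba := bddAbove_Icc.mono hP
  have hne : ∀ w ∈ N, ¬ G.Exotic b b' (R.swap.col w) := fun w hw hex =>
    have hrow := R.swap.col_mem (v := w) (by rw [core_swap]; exact hNc hw)
    (hKK hw.1).2 (mem_biUnion (x := R.swap.col w) ⟨hrow.1, hex⟩ hrow.2)
  have hfin := measure_le_of_forall_Ioo_le m m0 hbb hba (k := (M + M) * r) (by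
    rintro _ ⟨w, hw, rfl⟩ _ ⟨w', hw', rfl⟩ -
    rw [hmμ _ measurableSet_Ioo, add_mul]
    exact G.measure_between_le G' e hRU (fun A hA ℓ hℓ hAℓ X hX hXA => (HM A hA ℓ hℓ hAℓ X hX hXA).2)
      (fun B hB => hR.measure_core_inter_fibu hB) hb hb' hD hD' rfl hℓJ hJ (hN w hw).1
      (hNc hw) (hNc hw') (hKK hw.1).1.1.2 (hKK hw'.1).1.1.2 (hKK hw.1).1.2.2 (hKK hw'.1).1.2.2
      (hne w hw) (hne w' hw') (hN w hw).2 (hN w' hw').2)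
  refine le_trans ?_ hfin
  rw [hmμ _ (measurableSet_Icc.inter (MeasurableSet.const _))]
  exact measure_mono fun w hw => ⟨hNc hw, ⟨csInf_le hbb (mem_image_of_mem _ hw),
    le_csSup hba (mem_image_of_mem _ hw)⟩, ⟨_, mem_image_of_mem _ hw⟩⟩

end Tartan

section UnitSpeed

/-- An atomless locally finite measure on the line which agrees with Lebesgue measure off a
bounded interval is the pull-back of Lebesgue measure by an increasing bijection. -/
theorem exists_orderIso_map_eq_volume (ρ : Measure ℝ) [IsLocallyFiniteMeasure ρ]
    [NullSingletonClass ρ] {a b : ℝ} (hab : a ≤ b)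
    (hpos : ∀ u v, u < v → 0 < ρ (Ioc u v))
    (hout : ∀ E ⊆ (Icc a b)ᶜ, MeasurableSet E → ρ E = volume E) :
    ∃ e : ℝ ≃o ℝ, e a = 0 ∧ ρ.map e = volume := by
  have hint : ∀ u v, IntervalIntegrable (fun _ => (1 : ℝ)) ρ u v := fun u v =>
    intervalIntegrable_const
  set h : ℝ → ℝ := fun s => ∫ _ in a..s, (1 : ℝ) ∂ρ with hh
  have hc : Continuous h := intervalIntegral.continuous_primitive hint a
  have hsub : ∀ u v, h v - h u = ∫ _ in u..v, (1 : ℝ) ∂ρ := fun u v =>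
    intervalIntegral.integral_interval_sub_left (hint _ _) (hint _ _)
  have hle : ∀ u v, u ≤ v → h v - h u = ρ.real (Ioc u v) := fun u v huv => by
    rw [hsub, intervalIntegral.integral_of_le huv]; simp
  have hmono : StrictMono h := fun u v huv => by
    rw [← sub_pos, hle u v huv.le]
    exact ENNReal.toReal_pos (hpos u v huv).ne' measure_Ioc_lt_top.ne
  have htop : ∀ s, b ≤ s → h s = h b + (s - b) := fun s hs => by
    have h1 := hle b s hs
    rw [measureReal_def, hout _ (fun x hx h' => not_lt.2 h'.2 hx.1) measurableSet_Ioc,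
      Real.volume_Ioc, ENNReal.toReal_ofReal (sub_nonneg.2 hs)] at h1
    linarith
  have hbot : ∀ s, s ≤ a → h s = h a + (s - a) := fun s hs => by
    have h1 := hle s a hs
    rw [measureReal_def, measure_congr (Ioo_ae_eq_Ioc (μ := ρ)).symm,
      hout _ (fun x hx h' => not_lt.2 h'.1 hx.2) measurableSet_Ioo,
      Real.volume_Ioo, ENNReal.toReal_ofReal (sub_nonneg.2 hs)] at h1
    linarith
  have hsurj : Surjective h := by
    refine hc.surjective ?_ ?_
    · refine Tendsto.congr' (f₁ := fun s => h b + (s - b)) ?_ ?_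
      · filter_upwards [eventually_ge_atTop b] with s hs using (htop s hs).symm
      · exact tendsto_atTop_add_const_left _ _ (tendsto_atTop_add_const_right _ _ tendsto_id)
    · refine Tendsto.congr' (f₁ := fun s => h a + (s - a)) ?_ ?_
      · filter_upwards [eventually_le_atBot a] with s hs using (hbot s hs).symm
      · exact tendsto_atBot_add_const_left _ _ (tendsto_atBot_add_const_right _ _ tendsto_id)
  let e := StrictMono.orderIsoOfSurjective h hmono hsurj
  have he : ⇑e = h := rfl
  refine ⟨e, ?_, ?_⟩
  · rw [he]; simp [hh]
  · refine (Real.measure_ext_Ioo_rat fun p q => Eq.symm ?_).symm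
    rw [Measure.map_apply (by rw [he]; exact hc.measurable) measurableSet_Ioo,
      OrderIso.preimage_Ioo, measure_congr Ioo_ae_eq_Ioc, Real.volume_Ioo]
    rcases le_total (p : ℝ) q with hpq | hpq
    · have h1 := hle _ _ (e.symm.monotone hpq)
      rw [← he, e.apply_symm_apply, e.apply_symm_apply, measureReal_def] at h1
      rw [h1, ENNReal.ofReal_toReal measure_Ioc_lt_top.ne]
    · rw [Ioc_eq_empty (not_lt.2 (e.symm.monotone hpq)), measure_empty,
        ENNReal.ofReal_of_nonpos (by linarith)]

variable {μ : Measure S} [T2Space S] [CompactSpace S] [SecondCountableTopology S] [BorelSpace S]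

/-- A stream arc can be parametrised by its stream measure. -/
theorem MeasuredTurbulation.exists_unitSpeed (T : MeasuredTurbulation μ) {ℓ A : Set S} {x y : S}
    (h : ℓ ∈ T.lines) (hA : IsArcIn ℓ A x y) :
    ∃ g, IsParam ℓ g ∧ ∃ Λ : ℝ, 0 ≤ Λ ∧ A = g '' Icc 0 Λ ∧
      ∀ E ⊆ Icc 0 Λ, MeasurableSet E → T.ν ℓ (g '' E) = volume E := by
  obtain ⟨f, hf, a, b, hab, rfl, rfl, rfl⟩ := hA.exists_isParam
  have := T.noAtoms h
  have hme := hf.measurableEmbedding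
  set σ := (T.ν ℓ).comap f with hσ
  have hσa : ∀ E, σ E = T.ν ℓ (f '' E) := fun E => hme.comap_apply _ E
  set ρ := σ.restrict (Icc a b) + volume.restrict (Icc a b)ᶜ with hρ
  have hρa : ∀ E, MeasurableSet E → ρ E = σ (E ∩ Icc a b) + volume (E ∩ (Icc a b)ᶜ) := fun E hE => by
    rw [hρ, Measure.add_apply, Measure.restrict_apply hE, Measure.restrict_apply hE]
  have : NullSingletonClass ρ := ⟨fun x => by
    rw [hρa _ (measurableSet_singleton x), hσa]
    have h1 : T.ν ℓ (f '' ({x} ∩ Icc a b)) = 0 :=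
      measure_mono_null (image_mono inter_subset_left) (by rw [image_singleton]; exact measure_singleton _)
    have h2 : volume ({x} ∩ (Icc a b)ᶜ) = 0 := measure_mono_null inter_subset_left (by simp)
    rw [h1, h2, add_zero]⟩
  have : IsLocallyFiniteMeasure ρ := ⟨fun x => ⟨Icc (x - 1) (x + 1), Icc_mem_nhds (by linarith)
    (by linarith), by
      rw [hρa _ measurableSet_Icc, hσa]
      refine ENNReal.add_lt_top.2 ⟨?_, ?_⟩
      · exact (measure_mono (image_mono inter_subset_left)).trans_lt (T.measure_Icc_lt_top h hf _ _)
      · exact (measure_mono inter_subset_left).trans_lt _root_.measure_Icc_lt_top⟩⟩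
  have hout : ∀ E ⊆ (Icc a b)ᶜ, MeasurableSet E → ρ E = volume E := fun E hE hm => by
    rw [hρa E hm, inter_eq_left.2 hE, (disjoint_left.2 hE : Disjoint E (Icc a b)).inter_eq]
    simp
  have hpos : ∀ u v, u < v → 0 < ρ (Ioc u v) := fun u v huv => by
    by_cases hv : v ≤ a
    · refine lt_of_lt_of_le ?_ (measure_mono Ioo_subset_Ioc_self)
      rw [hout _ (fun x hx h' => absurd h'.1 (not_le.2 (hx.2.trans_le hv))) measurableSet_Ioo]
      simpa using huv
    by_cases hu : b ≤ u
    · rw [hout _ (fun x hx h' => absurd h'.2 (not_le.2 (lt_of_le_of_lt hu hx.1))) measurableSet_Ioc]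
      simpa using huv
    push Not at hv hu
    rcases hab.eq_or_lt with rfl | hab'
    · refine lt_of_lt_of_le ?_ (measure_mono (Ioo_subset_Ioc_self.trans
        (Ioc_subset_Ioc_left hu.le)) : ρ (Ioo a v) ≤ _)
      rw [hout _ (fun x hx h' => absurd h'.2 (not_le.2 hx.1)) measurableSet_Ioo]
      simpa using hv
    · rw [hρa _ measurableSet_Ioc]
      refine lt_of_lt_of_le ?_ le_self_add
      set c := max u a
      set d := min v b
      have hcd : c < d := max_lt (lt_min huv hu) (lt_min hv hab')
      rw [hσa]
      have h1 := T.ν_arc_pos ℓ h _ _ _ (hf.isArcIn (show (c + d) / 2 ≤ d by linarith))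
        (hf.2.1.ne (by linarith))
      refine h1.trans_le (measure_mono (image_mono fun x hx => ?_))
      have e1 := le_max_left u a
      have e2 := le_max_right u a
      have e3 := min_le_left v b
      have e4 := min_le_right v b
      exact ⟨⟨by linarith [hx.1], by linarith [hx.2]⟩, by linarith [hx.1], by linarith [hx.2]⟩
  obtain ⟨e, hea, hev⟩ := exists_orderIso_map_eq_volume ρ hab hpos hout
  have him : ⇑e.symm '' Icc 0 (e b) = Icc a b := by
    rw [OrderIso.image_Icc]
    simp [← hea]
  refine ⟨f ∘ e.symm, ⟨hf.1.comp e.symm.continuous, hf.2.1.comp e.symm.injective, ?_⟩, e b, ?_, ?_,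
    fun E hE hm => ?_⟩
  · rw [range_comp, e.symm.surjective.range_eq, image_univ, hf.2.2]
  · rw [← hea]; exact e.monotone hab
  · rw [image_comp, him]
  · have hpre : ⇑e.symm '' E = e ⁻¹' E := by
      rw [← OrderIso.coe_toEquiv, ← OrderIso.coe_toEquiv, ← Equiv.image_symm_eq_preimage]; rfl
    have hmE : MeasurableSet (e ⁻¹' E) := e.continuous.measurable hm
    have hsubE : e ⁻¹' E ⊆ Icc a b := by rw [← hpre, ← him]; exact image_mono hE
    rw [image_comp, hpre, ← hσa, ← hev, Measure.map_apply e.continuous.measurable hm, hρa _ hmE,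
      inter_eq_left.2 hsubE]
    have : e ⁻¹' E ∩ (Icc a b)ᶜ = ∅ := by
      rw [← Set.sdiff_eq, sdiff_eq_empty.2 hsubE]
    rw [this, measure_empty, add_zero]

end UnitSpeed

/-- A sequence of measure preserving homeomorphisms contracting the streamlines of `T₁` in `D₁`
and expanding those of `T₂` in `D₂` at rate `lam ^ n`. -/
structure Contracts {μ : Measure S} (T₁ T₂ : MeasuredTurbulation μ) (G : ℕ → S ≃ₜ S)
    (D₁ D₂ : Set S) (lam : ℝ) : Prop where
  one_lt : 1 < lam
  measurePreserving : ∀ n, MeasurePreserving (G n) μ μ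
  measurable₁ : MeasurableSet D₁
  measurable₂ : MeasurableSet D₂
  null₁ : μ D₁ᶜ = 0
  null₂ : μ D₂ᶜ = 0
  saturated₁ : ∀ ℓ ∈ T₁.lines, (ℓ ∩ D₁).Nonempty → ℓ ⊆ D₁
  saturated₂ : ∀ ℓ ∈ T₂.lines, (ℓ ∩ D₂).Nonempty → ℓ ⊆ D₂
  contract : ∀ ℓ ∈ T₁.lines, (ℓ ∩ D₁).Nonempty → ∀ n, G n '' ℓ ∈ T₁.lines ∧
    ∀ A x y, IsArcIn ℓ A x y → T₁.ν (G n '' ℓ) (G n '' A) = (ENNReal.ofReal lam)⁻¹ ^ n * T₁.ν ℓ A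
  expand : ∀ ℓ ∈ T₂.lines, (ℓ ∩ D₂).Nonempty → ∀ n, G n '' ℓ ∈ T₂.lines ∧
    ∀ A x y, IsArcIn ℓ A x y → T₂.ν (G n '' ℓ) (G n '' A) = ENNReal.ofReal lam ^ n * T₂.ν ℓ A

section Iterates

variable {μ : Measure S}

lemma MeasuredTurbulation.image_pow_mem (T : MeasuredTurbulation μ) (F : S ≃ₜ S) (c : ℝ≥0∞)
    (h : ∀ ℓ ∈ T.lines, F '' ℓ ∈ T.lines)
    (hc : ∀ ℓ ∈ T.lines, ∀ A x y, IsArcIn ℓ A x y → T.ν (F '' ℓ) (F '' A) = c * T.ν ℓ A)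
    (n : ℕ) : ∀ ℓ ∈ T.lines, ⇑(F ^ n) '' ℓ ∈ T.lines ∧ ∀ A x y, IsArcIn ℓ A x y →
      T.ν (⇑(F ^ n) '' ℓ) (⇑(F ^ n) '' A) = c ^ n * T.ν ℓ A := by
  have hs : ∀ n (E : Set S), ⇑(F ^ (n + 1)) '' E = F '' (⇑(F ^ n) '' E) := fun n E => by
    rw [pow_succ', image_image]; rfl
  induction n with
  | zero =>
    intro ℓ hℓ
    have h1 : ∀ E : Set S, ⇑(F ^ 0) '' E = E := fun E => by rw [pow_zero]; exact image_id E
    refine ⟨(h1 ℓ).symm ▸ hℓ, fun A _ _ _ => ?_⟩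
    rw [h1, h1, pow_zero, one_mul]
  | succ n ih =>
    intro ℓ hℓ
    refine ⟨hs n ℓ ▸ h _ (ih ℓ hℓ).1, fun A x y hA => ?_⟩
    rw [hs, hs, hc _ (ih ℓ hℓ).1 _ _ _ (hA.image _), (ih ℓ hℓ).2 A x y hA, pow_succ', mul_assoc]

/-- The points all of whose backward iterates lie on streamlines of `T`. -/
def MeasuredTurbulation.backwardDomain (T : MeasuredTurbulation μ) (F : S ≃ₜ S) : Set S :=
  {x | ∀ n : ℕ, (F ^ n).symm x ∈ ⋃₀ T.lines}

lemma measurePreserving_pow {F : S ≃ₜ S} (hF : MeasurePreserving F μ μ) (n : ℕ) :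
    MeasurePreserving ⇑(F ^ n) μ μ := by
  induction n with
  | zero => rw [pow_zero]; exact MeasurePreserving.id μ
  | succ n ih => rw [pow_succ']; exact hF.comp ih

lemma MeasuredTurbulation.image_pow_symm_mem (T : MeasuredTurbulation μ) (F : S ≃ₜ S) {c d : ℝ≥0∞}
    (hcd : d * c = 1) (h : ∀ ℓ ∈ T.lines, F '' ℓ ∈ T.lines)
    (hc : ∀ ℓ ∈ T.lines, ∀ A x y, IsArcIn ℓ A x y → T.ν (F '' ℓ) (F '' A) = c * T.ν ℓ A)
    {ℓ : Set S} (hℓ : ℓ ∈ T.lines) (hne : (ℓ ∩ T.backwardDomain F).Nonempty) (n : ℕ) :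
    ⇑(F ^ n).symm '' ℓ ∈ T.lines ∧ ∀ A x y, IsArcIn ℓ A x y →
      T.ν (⇑(F ^ n).symm '' ℓ) (⇑(F ^ n).symm '' A) = d ^ n * T.ν ℓ A := by
  obtain ⟨x, hx, hxD⟩ := hne
  obtain ⟨ℓ', hℓ', hx'⟩ := hxD n
  obtain ⟨h1, h2⟩ := T.image_pow_mem F c h hc n ℓ' hℓ'
  have hEq : ⇑(F ^ n) '' ℓ' = ℓ :=
    T.line_unique h1 hℓ (x := x) ⟨_, hx', (F ^ n).apply_symm_apply x⟩ hx
  have hinv : ∀ E, ⇑(F ^ n).symm '' (⇑(F ^ n) '' E) = E := fun E => by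
    rw [image_image]; simp
  have hinv' : ∀ E, ⇑(F ^ n) '' (⇑(F ^ n).symm '' E) = E := fun E => by
    rw [image_image]; simp
  have hEq' : ⇑(F ^ n).symm '' ℓ = ℓ' := by rw [← hEq, hinv]
  refine ⟨hEq' ▸ hℓ', fun A a b hA => ?_⟩
  have h3 := h2 _ _ _ (hEq' ▸ hA.image (F ^ n).symm)
  rw [hEq, hinv'] at h3
  rw [hEq', h3, ← mul_assoc, ← mul_pow, hcd, one_pow, one_mul]

lemma MeasuredTurbulation.backwardDomain_saturated (T : MeasuredTurbulation μ) (F : S ≃ₜ S)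
    (h : ∀ ℓ ∈ T.lines, F '' ℓ ∈ T.lines) {c : ℝ≥0∞} {d : ℝ≥0∞} (hcd : d * c = 1)
    (hc : ∀ ℓ ∈ T.lines, ∀ A x y, IsArcIn ℓ A x y → T.ν (F '' ℓ) (F '' A) = c * T.ν ℓ A)
    {ℓ : Set S} (hℓ : ℓ ∈ T.lines) (hne : (ℓ ∩ T.backwardDomain F).Nonempty) :
    ℓ ⊆ T.backwardDomain F := fun y hy n =>
  ⟨_, (T.image_pow_symm_mem F hcd h hc hℓ hne n).1, mem_image_of_mem _ hy⟩

variable [BorelSpace S]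

lemma measurePreserving_pow_symm {F : S ≃ₜ S} (hF : MeasurePreserving F μ μ) (n : ℕ) :
    MeasurePreserving ⇑(F ^ n).symm μ μ :=
  MeasurePreserving.symm (F ^ n).toMeasurableEquiv (measurePreserving_pow hF n)

lemma MeasuredTurbulation.measurableSet_backwardDomain (T : MeasuredTurbulation μ) (F : S ≃ₜ S) :
    MeasurableSet (T.backwardDomain F) := by
  have : T.backwardDomain F = ⋂ n : ℕ, (F ^ n).symm ⁻¹' ⋃₀ T.lines := by
    ext x; simp [backwardDomain]
  rw [this]
  exact MeasurableSet.iInter fun n => (F ^ n).symm.continuous.measurable T.domain_borel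

lemma MeasuredTurbulation.measure_compl_backwardDomain [IsProbabilityMeasure μ]
    (T : MeasuredTurbulation μ) {F : S ≃ₜ S} (hF : MeasurePreserving F μ μ) :
    μ (T.backwardDomain F)ᶜ = 0 := by
  have : (T.backwardDomain F)ᶜ = ⋃ n : ℕ, (F ^ n).symm ⁻¹' (⋃₀ T.lines)ᶜ := by
    ext x; simp [backwardDomain]
  rw [this, measure_iUnion_null_iff]
  intro n
  rw [(measurePreserving_pow_symm hF n).measure_preimage T.domain_borel.compl.nullMeasurableSet]
  exact (prob_compl_eq_zero_iff T.domain_borel).2 T.domain_full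

variable [IsProbabilityMeasure μ] {Ts Tu : MeasuredTurbulation μ} {F : S ≃ₜ S} {lam : ℝ}

lemma IsMPA.contracts (hF : IsMPA μ F Ts Tu lam) :
    Contracts Ts Tu (fun n => F ^ n) univ univ lam where
  one_lt := hF.one_lt_lam
  measurePreserving := measurePreserving_pow hF.measurePreserving
  measurable₁ := MeasurableSet.univ
  measurable₂ := MeasurableSet.univ
  null₁ := by simp
  null₂ := by simp
  saturated₁ := fun _ _ _ => subset_univ _
  saturated₂ := fun _ _ _ => subset_univ _
  contract := fun ℓ hℓ _ n => Ts.image_pow_mem F _ hF.stable_image hF.stable_contract n ℓ hℓ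
  expand := fun ℓ hℓ _ n => Tu.image_pow_mem F _ hF.unstable_image hF.unstable_expand n ℓ hℓ

lemma IsMPA.contracts_symm (hF : IsMPA μ F Ts Tu lam) :
    Contracts Tu Ts (fun n => (F ^ n).symm) (Tu.backwardDomain F) (Ts.backwardDomain F) lam := by
  have h0 : ENNReal.ofReal lam ≠ 0 := by
    rw [Ne, ENNReal.ofReal_eq_zero, not_le]; linarith [hF.one_lt_lam]
  have h1 : ENNReal.ofReal lam * (ENNReal.ofReal lam)⁻¹ = 1 :=
    ENNReal.mul_inv_cancel h0 ENNReal.ofReal_ne_top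
  have h2 : (ENNReal.ofReal lam)⁻¹ * ENNReal.ofReal lam = 1 :=
    ENNReal.inv_mul_cancel h0 ENNReal.ofReal_ne_top
  exact
  { one_lt := hF.one_lt_lam
    measurePreserving := measurePreserving_pow_symm hF.measurePreserving
    measurable₁ := Tu.measurableSet_backwardDomain F
    measurable₂ := Ts.measurableSet_backwardDomain F
    null₁ := Tu.measure_compl_backwardDomain hF.measurePreserving
    null₂ := Ts.measure_compl_backwardDomain hF.measurePreserving
    saturated₁ := fun _ hℓ => Tu.backwardDomain_saturated F hF.unstable_image h2
      hF.unstable_expand hℓ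
    saturated₂ := fun _ hℓ => Ts.backwardDomain_saturated F hF.stable_image h1
      hF.stable_contract hℓ
    contract := fun _ hℓ hne n => Tu.image_pow_symm_mem F h2 hF.unstable_image
      hF.unstable_expand hℓ hne n
    expand := fun _ hℓ hne n => Ts.image_pow_symm_mem F h1 hF.stable_image
      hF.stable_contract hℓ hne n }

end Iterates

section Control

variable {μ : Measure S} {T₁ T₂ : MeasuredTurbulation μ}

/-- Short `T₁`-arcs joining points of `K` to a given short `T₂`-arc start from a set of measure
at most proportional to their length. -/
def Controlled (T₁ T₂ : MeasuredTurbulation μ) (K : Set S) : Prop :=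
  ∃ δ > (0 : ℝ), ∃ C : ℝ≥0∞, C < ⊤ ∧ ∀ ℓJ ∈ T₂.lines, ∀ J x y, IsArcIn ℓJ J x y →
    T₂.ν ℓJ J < ENNReal.ofReal δ → ∀ r < ENNReal.ofReal δ,
      μ {w ∈ K | ∃ ℓ ∈ T₁.lines, ∃ A z, IsArcIn ℓ A w z ∧ z ∈ J ∧ T₁.ν ℓ A ≤ r} ≤ C * r

lemma Controlled.empty : Controlled T₁ T₂ ∅ :=
  ⟨1, one_pos, 0, ENNReal.zero_lt_top, fun _ _ _ _ _ _ _ _ _ => by simp⟩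

lemma Controlled.union {K L : Set S} (hK : Controlled T₁ T₂ K) (hL : Controlled T₁ T₂ L) :
    Controlled T₁ T₂ (K ∪ L) := by
  obtain ⟨δ, hδ, C, hC, H⟩ := hK
  obtain ⟨δ', hδ', C', hC', H'⟩ := hL
  refine ⟨min δ δ', lt_min hδ hδ', C + C', ENNReal.add_lt_top.2 ⟨hC, hC'⟩,
    fun ℓJ hℓJ J x y hJ hν r hr => ?_⟩
  have h1 : ENNReal.ofReal (min δ δ') ≤ ENNReal.ofReal δ := ENNReal.ofReal_le_ofReal (min_le_left _ _)
  have h2 : ENNReal.ofReal (min δ δ') ≤ ENNReal.ofReal δ' :=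
    ENNReal.ofReal_le_ofReal (min_le_right _ _)
  rw [add_mul]
  refine (measure_mono ?_).trans ((measure_union_le _ _).trans (add_le_add
    (H ℓJ hℓJ J x y hJ (hν.trans_le h1) r (hr.trans_le h1))
    (H' ℓJ hℓJ J x y hJ (hν.trans_le h2) r (hr.trans_le h2))))
  rintro w ⟨hw | hw, h⟩
  exacts [Or.inl ⟨hw, h⟩, Or.inr ⟨hw, h⟩]

variable [T2Space S] [CompactSpace S] [SecondCountableTopology S] [BorelSpace S]

/-- For a full pair of tame turbulations, most points of the surface are controlled. -/
theorem FullPair.exists_controlled [IsProbabilityMeasure μ] (hT : FullPair T₁ T₂) (h1 : T₁.Tame)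
    (h2 : T₂.Tame) {ε : ℝ≥0∞} (hε : 0 < ε) :
    ∃ K, MeasurableSet K ∧ μ Kᶜ ≤ ε ∧ Controlled T₁ T₂ K := by
  obtain ⟨⟨R, hR, hfull⟩, -⟩ := hT
  obtain ⟨ε', hε', hsum⟩ := ENNReal.exists_pos_sum_of_countable (ENNReal.half_pos hε.ne').ne' ℕ
  choose K hK hKε hctrl using fun i =>
    (hR i).exists_control h1 h2 (ENNReal.coe_pos.2 (hε' i))
  have hK' : ∀ n, Controlled T₁ T₂ (accumulate K n) := by
    intro n
    induction n with
    | zero => rw [accumulate_zero_nat]; exact hctrl 0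
    | succ n ih => rw [accumulate_succ]; exact ih.union (hctrl (n + 1))
  have hm : ∀ n, MeasurableSet (accumulate K n) := fun n => by
    rw [accumulate_def]; exact MeasurableSet.biUnion (to_countable _) fun i _ => hK i
  have hU : μ (⋃ n, accumulate K n)ᶜ ≤ ε / 2 := by
    have hcore : μ (⋃ i, (R i).core)ᶜ = 0 :=
      (prob_compl_eq_zero_iff (MeasurableSet.iUnion fun i => (R i).measurableSet_core)).2 hfull
    calc μ (⋃ n, accumulate K n)ᶜ
        ≤ μ ((⋃ i, (R i).core)ᶜ ∪ ⋃ i, ((R i).core \ K i)) := measure_mono fun x hx => by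
          rw [iUnion_accumulate, mem_compl_iff, mem_iUnion, not_exists] at hx
          by_cases hc : x ∈ ⋃ i, (R i).core
          · obtain ⟨i, hi⟩ := mem_iUnion.1 hc
            exact Or.inr (mem_iUnion.2 ⟨i, hi, hx i⟩)
          · exact Or.inl hc
      _ ≤ 0 + ∑' i, (ε' i : ℝ≥0∞) := (measure_union_le _ _).trans (add_le_add hcore.le
          ((measure_iUnion_le _).trans (ENNReal.tsum_le_tsum hKε)))
      _ ≤ ε / 2 := by rw [zero_add]; exact hsum.le
  have hlim : Tendsto (fun n => μ (accumulate K n)ᶜ) atTop (𝓝 (μ (⋂ n, (accumulate K n)ᶜ))) :=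
    tendsto_measure_iInter_atTop (fun n => (hm n).compl.nullMeasurableSet)
      (fun _ _ h => compl_subset_compl.2 (monotone_accumulate h)) ⟨0, measure_ne_top _ _⟩
  rw [← compl_iUnion] at hlim
  by_cases htop : ε = ⊤
  · exact ⟨_, hm 0, by simp [htop], hK' 0⟩
  obtain ⟨n, hn⟩ := (hlim.eventually_lt_const
    (hU.trans_lt (ENNReal.half_lt_self hε.ne' htop))).exists
  exact ⟨_, hm n, hn.le, hK' n⟩

end Control

section Null

variable {μ : Measure S} {T₁ T₂ : MeasuredTurbulation μ}
variable [T2Space S] [CompactSpace S] [SecondCountableTopology S] [BorelSpace S]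
variable {G : ℕ → S ≃ₜ S} {D₁ D₂ : Set S} {lam : ℝ}

/-- The cells of length `q` contained in `O` have total length at most that of `O`. -/
lemma tsum_cells_le (O : Set ℝ) {q : ℝ} (hq : 0 < q) :
    ∑' _ : {i : ℤ // Icc (i * q) ((i + 1) * q) ⊆ O}, ENNReal.ofReal q ≤ volume O := by
  have hd : Pairwise (Disjoint on fun i : {i : ℤ // Icc (i * q) ((i + 1) * q) ⊆ O} =>
      Ico ((i : ℤ) * q) (((i : ℤ) + 1) * q)) := by
    intro i j hij
    refine disjoint_left.2 fun x hx hx' => hij (Subtype.ext ?_)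
    have h1 : ((i : ℤ) : ℝ) < (j : ℤ) + 1 := lt_of_mul_lt_mul_right (hx.1.trans_lt hx'.2) hq.le
    have h2 : ((j : ℤ) : ℝ) < (i : ℤ) + 1 := lt_of_mul_lt_mul_right (hx'.1.trans_lt hx.2) hq.le
    norm_cast at h1 h2
    lia
  calc ∑' _ : {i : ℤ // Icc (i * q) ((i + 1) * q) ⊆ O}, ENNReal.ofReal q
      = ∑' i : {i : ℤ // Icc (i * q) ((i + 1) * q) ⊆ O},
          volume (Ico ((i : ℤ) * q) (((i : ℤ) + 1) * q)) := by
        refine tsum_congr fun i => ?_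
        rw [Real.volume_Ico]; congr 1; ring
    _ = volume (⋃ i : {i : ℤ // Icc (i * q) ((i + 1) * q) ⊆ O},
          Ico ((i : ℤ) * q) (((i : ℤ) + 1) * q)) :=
        (measure_iUnion hd fun _ => measurableSet_Ico).symm
    _ ≤ volume O := measure_mono (iUnion_subset fun i => Ico_subset_Icc_self.trans i.2)

/-- Arcs of bounded `T₁`-length through a null subset of a `T₂`-arc start from a null set. -/
theorem Contracts.measure_eq_zero_of_bounded [IsProbabilityMeasure μ]
    (hG : Contracts T₁ T₂ G D₁ D₂ lam)
    (hT : FullPair T₁ T₂) (h1 : T₁.Tame) (h2 : T₂.Tame) {ℓβ β : Set S} {b b' : S}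
    (hℓβ : ℓβ ∈ T₂.lines) (hD : (ℓβ ∩ D₂).Nonempty) (hβ : IsArcIn ℓβ β b b') {Y W : Set S}
    (hY : MeasurableSet Y) (hYβ : Y ⊆ β) (hY0 : T₂.ν ℓβ Y = 0) (hWD : W ⊆ D₁) (L : ℕ)
    (hW : ∀ x ∈ W, ∃ y ∈ Y, ∃ ℓ ∈ T₁.lines, ∃ A, IsArcIn ℓ A x y ∧ T₁.ν ℓ A ≤ L) : μ W = 0 := by
  refine nonpos_iff_eq_zero.1 (ENNReal.le_of_forall_pos_le_add fun ε₀ hε₀ _ => ?_)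
  obtain ⟨K, hK, hKε, δ, hδ, C, hC, hctrl⟩ := hT.exists_controlled h1 h2
    (ENNReal.half_pos (ENNReal.coe_pos.2 hε₀).ne')
  set ε : ℝ≥0∞ := (ε₀ : ℝ≥0∞) / 2 with hε
  have hεpos : 0 < ε := ENNReal.half_pos (ENNReal.coe_pos.2 hε₀).ne'
  obtain ⟨g, hg, Λ, hΛ, rfl, hgν⟩ := T₂.exists_unitSpeed hℓβ hβ
  have hme := hg.measurableEmbedding
  have hlam := hG.one_lt
  have hlam0 : 0 < lam := one_pos.trans hlam
  set Y' := g ⁻¹' Y with hY'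
  have hY'sub : Y' ⊆ Icc 0 Λ := fun s hs => by
    obtain ⟨t, ht, hts⟩ := hYβ hs
    rwa [← hg.2.1 hts]
  have hY'0 : volume Y' = 0 := by
    rw [← hgν _ hY'sub (hme.measurable hY)]
    exact measure_mono_null (image_preimage_subset _ _) hY0
  set c : ℝ≥0∞ := (ENNReal.ofReal lam)⁻¹ with hc
  have hl0 : ENNReal.ofReal lam ≠ 0 := by rw [Ne, ENNReal.ofReal_eq_zero, not_le]; exact hlam0
  have hlc : ENNReal.ofReal lam * c = 1 := ENNReal.mul_inv_cancel hl0 ENNReal.ofReal_ne_top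
  have hc1 : c < 1 := by
    rw [hc, ENNReal.inv_lt_one]
    simpa using hlam
  set p : ℝ≥0∞ := ENNReal.ofReal (δ / 2) with hp
  have hp0 : p ≠ 0 := by rw [hp, Ne, ENNReal.ofReal_eq_zero, not_le]; positivity
  set D : ℝ≥0∞ := C * (L / p) with hDdef
  have hDtop : D ≠ ⊤ :=
    ENNReal.mul_ne_top hC.ne (ENNReal.div_ne_top (ENNReal.natCast_ne_top L) hp0)
  obtain ⟨O, hYO, hO, hOlt⟩ : ∃ O ⊇ Y', IsOpen O ∧ volume O < ε / (D + 1) := by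
    refine Set.exists_isOpen_lt_of_lt _ _ ?_
    rw [hY'0]
    exact ENNReal.div_pos hεpos.ne' (by simp [hDtop])
  have hDO : D * volume O ≤ ε := by
    calc D * volume O ≤ (D + 1) * (ε / (D + 1)) := mul_le_mul' le_self_add hOlt.le
      _ ≤ ε := ENNReal.mul_div_le
  set q : ℕ → ℝ := fun n => δ / 2 * lam⁻¹ ^ n with hq
  have hqpos : ∀ n, 0 < q n := fun n => by positivity
  have hqE : ∀ n, ENNReal.ofReal (q n) = p * c ^ n := fun n => by
    rw [hq, ENNReal.ofReal_mul (by positivity), ENNReal.ofReal_pow (by positivity),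
      ENNReal.ofReal_inv_of_pos hlam0]
  have hqanti : Antitone q := fun m n hmn => by
    refine mul_le_mul_of_nonneg_left ?_ (by positivity)
    exact pow_le_pow_of_le_one (by positivity) (inv_le_one_of_one_le₀ hlam.le) hmn
  have hqlim : Tendsto q atTop (𝓝 0) := by
    have := (tendsto_pow_atTop_nhds_zero_of_lt_one (inv_nonneg.2 hlam0.le)
      (inv_lt_one_of_one_lt₀ hlam)).const_mul (δ / 2)
    rwa [mul_zero] at this
  have hrlim : Tendsto (fun n => c ^ n * (L : ℝ≥0∞)) atTop (𝓝 0) := by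
    have := ENNReal.Tendsto.mul_const (ENNReal.tendsto_pow_atTop_nhds_zero_of_lt_one hc1)
      (Or.inr (ENNReal.natCast_ne_top L))
    rwa [zero_mul] at this
  let Z : ℕ → Set S := fun n => {x ∈ W | ∃ s ∈ Y', Icc (s - q n) (s + q n) ⊆ O ∧
    ∃ ℓ ∈ T₁.lines, ∃ A, IsArcIn ℓ A x (g s) ∧ T₁.ν ℓ A ≤ L}
  have hZmono : Monotone Z := by
    rintro m n hmn x ⟨hx, s, hs, hsO, h⟩
    exact ⟨hx, s, hs, (Icc_subset_Icc (by linarith [hqanti hmn])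
      (by linarith [hqanti hmn])).trans hsO, h⟩
  have hZU : W = ⋃ n, Z n := by
    refine subset_antisymm (fun x hx => ?_) (iUnion_subset fun n x hx => hx.1)
    obtain ⟨y, hy, h⟩ := hW x hx
    obtain ⟨s, -, rfl⟩ := hYβ hy
    obtain ⟨ρ, hρ, hρO⟩ := Metric.isOpen_iff.1 hO s (hYO hy)
    obtain ⟨n, hn⟩ := (hqlim.eventually_lt_const hρ).exists
    refine mem_iUnion.2 ⟨n, hx, s, hy, fun t ht => hρO ?_, h⟩
    rw [Metric.mem_ball, Real.dist_eq, abs_lt]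
    constructor <;> linarith [ht.1, ht.2]
  have hlim : Tendsto (μ ∘ Z) atTop (𝓝 (μ W)) := by
    rw [hZU]; exact tendsto_measure_iUnion_atTop hZmono
  rw [zero_add, ← ENNReal.add_halves (ε₀ : ℝ≥0∞), ← hε]
  have hδE : 0 < ENNReal.ofReal δ := ENNReal.ofReal_pos.2 hδ
  refine le_of_tendsto hlim ?_
  filter_upwards [hrlim.eventually_lt_const hδE] with n hn
  let M : ℤ → Set S := fun i => {w ∈ K | ∃ ℓ ∈ T₁.lines, ∃ A z, IsArcIn ℓ A w z ∧
    z ∈ G n '' (g '' (Icc (i * q n) ((i + 1) * q n) ∩ Icc 0 Λ)) ∧ T₁.ν ℓ A ≤ c ^ n * L}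
  have hM : ∀ i, μ (M i) ≤ D * ENNReal.ofReal (q n) := by
    intro i
    have hD' : D * ENNReal.ofReal (q n) = C * (c ^ n * L) := by
      rw [hqE, hDdef, mul_assoc, ← mul_assoc ((L : ℝ≥0∞) / p),
        ENNReal.div_mul_cancel hp0 ENNReal.ofReal_ne_top, mul_comm (L : ℝ≥0∞)]
    rw [hD']
    by_cases hne : max (i * q n) 0 ≤ min ((i + 1) * q n) Λ
    · have hcell : Icc (i * q n) ((i + 1) * q n) ∩ Icc 0 Λ =
          Icc (max (i * q n) 0) (min ((i + 1) * q n) Λ) := Icc_inter_Icc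
      obtain ⟨hl, hs⟩ := hG.expand ℓβ hℓβ hD n
      have harc := hg.isArcIn hne
      rw [← hcell] at harc
      refine hctrl _ hl _ _ _ (harc.image (G n)) ?_ _ hn
      rw [hs _ _ _ harc, hgν _ inter_subset_right (measurableSet_Icc.inter measurableSet_Icc)]
      calc ENNReal.ofReal lam ^ n * volume (Icc (i * q n) ((i + 1) * q n) ∩ Icc 0 Λ)
          ≤ ENNReal.ofReal lam ^ n * ENNReal.ofReal (q n) := by
            gcongr
            refine (measure_mono inter_subset_left).trans ?_
            rw [Real.volume_Icc]
            exact ENNReal.ofReal_le_ofReal (by linarith)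
        _ = p := by
            rw [hqE, mul_comm p, ← mul_assoc, ← mul_pow, hlc, one_pow, one_mul]
        _ < ENNReal.ofReal δ := (ENNReal.ofReal_lt_ofReal_iff hδ).2 (by linarith)
    · have : M i = ∅ := by
        refine eq_empty_of_forall_notMem ?_
        rintro w ⟨-, ℓ, -, A, z, -, ⟨_, ⟨t, ht, rfl⟩, rfl⟩, -⟩
        exact hne ((max_le ht.1.1 ht.2.1).trans (le_min ht.1.2 ht.2.2))
      rw [this, measure_empty]
      exact zero_le
  have hpre : ∀ E, μ (G n ⁻¹' E) = μ E := fun E =>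
    (hG.measurePreserving n).measure_preimage_emb (G n).measurableEmbedding E
  have hcov : Z n ⊆ G n ⁻¹' Kᶜ ∪
      ⋃ i : {i : ℤ // Icc (i * q n) ((i + 1) * q n) ⊆ O}, G n ⁻¹' M i := by
    rintro x ⟨hx, s, hs, hsO, ℓ, hℓ, A, hA, hAν⟩
    by_cases hxK : G n x ∈ K
    · right
      have e1 : (⌊s / q n⌋ : ℝ) * q n ≤ s := by
        rw [← le_div_iff₀ (hqpos n)]; exact Int.floor_le _
      have e2 : s ≤ (⌊s / q n⌋ + 1) * q n := by
        rw [← div_le_iff₀ (hqpos n)]; exact (Int.lt_floor_add_one _).le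
      refine mem_iUnion.2 ⟨⟨⌊s / q n⌋, (Icc_subset_Icc (by linarith) (by linarith)).trans hsO⟩, hxK, ?_⟩
      obtain ⟨hl, hsc⟩ := hG.contract ℓ hℓ ⟨x, hA.subset hA.left_mem, hWD hx⟩ n
      refine ⟨_, hl, _, _, hA.image (G n), ⟨_, ⟨s, ⟨⟨e1, e2⟩, hY'sub hs⟩, rfl⟩, rfl⟩, ?_⟩
      rw [hsc _ _ _ hA]
      gcongr
    · exact Or.inl hxK
  calc μ (Z n) ≤ μ (G n ⁻¹' Kᶜ) +
        ∑' i : {i : ℤ // Icc (i * q n) ((i + 1) * q n) ⊆ O}, μ (G n ⁻¹' M i) :=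
        (measure_mono hcov).trans ((measure_union_le _ _).trans
          (add_le_add le_rfl (measure_iUnion_le _)))
    _ ≤ ε + ∑' _ : {i : ℤ // Icc (i * q n) ((i + 1) * q n) ⊆ O}, D * ENNReal.ofReal (q n) := by
        refine add_le_add ((hpre _).le.trans hKε) (ENNReal.tsum_le_tsum fun i => ?_)
        rw [hpre]; exact hM i
    _ ≤ ε + ε := by
        rw [ENNReal.tsum_mul_left]
        exact add_le_add le_rfl ((mul_le_mul' le_rfl (tsum_cells_le O (hqpos n))).trans hDO)

/-- A saturated set missing almost all of the core of a tartan misses almost all of its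
saturation. -/
theorem Contracts.measure_stableSaturation_inter [IsProbabilityMeasure μ]
    (hG : Contracts T₁ T₂ G D₁ D₂ lam)
    (hT : FullPair T₁ T₂) (h1 : T₁.Tame) (h2 : T₂.Tame) {R : Tartan T₁ T₂} (hR : R.Compatible)
    (hpos : 0 < μ R.core) {A : Set S} (hA : MeasurableSet A)
    (hsat : ∀ ℓ ∈ T₁.lines, (ℓ ∩ A).Nonempty → ℓ ⊆ A) (h0 : μ (R.core ∩ A) = 0) :
    μ (stableSaturation R ∩ A) = 0 := by
  obtain ⟨v, hv, hvD⟩ : (R.core ∩ D₂).Nonempty := by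
    by_contra h
    rw [not_nonempty_iff_eq_empty] at h
    have hsub : R.core ⊆ D₂ᶜ := disjoint_left.1 (disjoint_iff_inter_eq_empty.2 h)
    exact hpos.ne' (measure_mono_null hsub hG.null₂)
  obtain ⟨𝔰, h𝔰, hv𝔰⟩ := R.exists_fibs hv
  obtain ⟨𝔲, h𝔲, hv𝔲⟩ := R.exists_fibu hv
  obtain ⟨ℓs, hℓs, x₁, x₂, harcs⟩ := R.fibs_isArc h𝔰
  obtain ⟨ℓu, hℓu, y₁, y₂, harcu⟩ := R.swap.fibs_isArc h𝔲
  have hcm := R.measurableSet_core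
  have hXm : MeasurableSet (𝔰 ∩ R.core) := harcs.measurableSet.inter hcm
  have hYm : MeasurableSet (𝔲 ∩ R.core ∩ A) := (harcu.measurableSet.inter hcm).inter hA
  obtain ⟨-, hb⟩ := hR.measure_box h𝔰 h𝔲 hℓs harcs.subset hℓu harcu.subset hXm subset_rfl hYm
    inter_subset_left
  obtain ⟨-, hb'⟩ := hR.measure_box h𝔰 h𝔲 hℓs harcs.subset hℓu harcu.subset hXm subset_rfl
    (harcu.measurableSet.inter hcm) subset_rfl
  have hX0 : T₁.ν ℓs (𝔰 ∩ R.core) ≠ 0 := by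
    intro h
    rw [h, zero_mul] at hb'
    refine hpos.ne' (measure_mono_null (fun w hw => ?_) hb')
    obtain ⟨A', hA', hwA'⟩ := R.exists_fibs hw
    obtain ⟨B', hB', hwB'⟩ := R.exists_fibu hw
    obtain ⟨z, hz, hz'⟩ := R.exists_inter h𝔰 hB'
    obtain ⟨t, ht, ht'⟩ := R.exists_inter hA' h𝔲
    exact ⟨hw, ⟨B', hB', hwB', z, hz', hz, R.mem_core h𝔰 hB' hz hz'⟩,
      A', hA', hwA', t, ht, ht', R.mem_core hA' h𝔲 ht ht'⟩
  have hY0 : T₂.ν ℓu (𝔲 ∩ R.core ∩ A) = 0 := by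
    have : μ (R.box (𝔰 ∩ R.core) (𝔲 ∩ R.core ∩ A)) = 0 := by
      refine measure_mono_null ?_ h0
      rintro w ⟨hw, -, A', hA', hwA', t, ht, ht'⟩
      obtain ⟨ℓ, hℓ, a, b, hab⟩ := R.fibs_isArc hA'
      exact ⟨hw, hsat ℓ hℓ ⟨t, hab.subset ht, ht'.2⟩ (hab.subset hwA')⟩
    rw [this] at hb
    exact (mul_eq_zero.1 hb.symm).resolve_left hX0
  let W : ℕ → Set S := fun L => {x ∈ D₁ | ∃ y ∈ 𝔲 ∩ R.core ∩ A, ∃ ℓ ∈ T₁.lines, ∃ B,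
    IsArcIn ℓ B x y ∧ T₁.ν ℓ B ≤ L}
  have hW : ∀ L, μ (W L) = 0 := fun L =>
    hG.measure_eq_zero_of_bounded hT h1 h2 hℓu ⟨v, harcu.subset hv𝔲, hvD⟩ harcu hYm
      (fun x hx => hx.1.1) hY0 (fun x hx => hx.1) L fun x hx => hx.2
  refine measure_mono_null ?_ (measure_union_null hG.null₁ (measure_iUnion_null hW))
  rintro x ⟨⟨ℓ, ⟨hℓ, A', hA', hA'ℓ⟩, hxℓ⟩, hxA⟩
  by_cases hxD : x ∈ D₁
  · right
    obtain ⟨t, ht, ht'⟩ := R.exists_inter hA' h𝔲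
    obtain ⟨B, hB⟩ := T₁.exists_arc hℓ hxℓ (hA'ℓ ht)
    obtain ⟨L, hL⟩ := ENNReal.exists_nat_gt (T₁.ν_arc_finite ℓ hℓ _ _ _ hB).ne
    exact mem_iUnion.2 ⟨L, hxD, t, ⟨⟨ht', R.mem_core hA' h𝔲 ht ht'⟩,
      hsat ℓ hℓ ⟨x, hxℓ, hxA⟩ (hA'ℓ ht)⟩, ℓ, hℓ, B, hB, hL.le⟩
  · exact Or.inl hxD

end Null

section Hopf

variable {μ : Measure S} {T₁ T₂ : MeasuredTurbulation μ}
variable [T2Space S] [CompactSpace S] [SecondCountableTopology S] [BorelSpace S]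
variable {G : ℕ → S ≃ₜ S} {D₁ D₂ : Set S} {lam : ℝ}

/-- Hopf's argument: an invariant set agrees almost everywhere with a union of contracted
streamlines. -/
theorem Contracts.exists_saturated [IsProbabilityMeasure μ] (hG : Contracts T₁ T₂ G D₁ D₂ lam)
    (h1 : T₁.Tame) {A : Set S} (hA : MeasurableSet A) (hinv : ∀ n, G n ⁻¹' A = A) :
    ∃ A', MeasurableSet A' ∧ A' =ᵐ[μ] A ∧ ∀ ℓ ∈ T₁.lines, (ℓ ∩ A').Nonempty → ℓ ⊆ A' := by
  let χ : S → ℝ := A.indicator fun _ => 1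
  have hχ1 : ∀ x ∈ A, χ x = 1 := fun x hx => indicator_of_mem hx _
  have hχ0 : ∀ x ∉ A, χ x = 0 := fun x hx => indicator_of_notMem hx _
  have hχ : Integrable χ μ := (integrable_const 1).indicator hA
  obtain ⟨ε, hε, hsum⟩ := ENNReal.exists_pos_sum_of_countable (ε := 1) one_ne_zero ℕ
  choose φ hφ _ using fun j : ℕ =>
    hχ.exists_boundedContinuous_lintegral_sub_le (ENNReal.coe_pos.2 (hε j)).ne'
  have hc1 : (ENNReal.ofReal lam)⁻¹ < 1 := by
    rw [ENNReal.inv_lt_one]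
    simpa using hG.one_lt
  have hex : ∀ j : ℕ, ∃ n, ∀ ℓ ∈ T₁.lines, (ℓ ∩ D₁).Nonempty → ∀ B x y, IsArcIn ℓ B x y →
      T₁.ν ℓ B ≤ j → |φ j (G n x) - φ j (G n y)| < 1 / ((j : ℝ) + 1) := by
    intro j
    obtain ⟨δ, hδ, H⟩ := h1.exists_abs_sub_lt (φ j).continuous
      (show (0 : ℝ) < 1 / ((j : ℝ) + 1) by positivity)
    have hlim := ENNReal.Tendsto.mul_const (b := (j : ℝ≥0∞))
      (ENNReal.tendsto_pow_atTop_nhds_zero_of_lt_one hc1) (Or.inr (ENNReal.natCast_ne_top j))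
    rw [zero_mul] at hlim
    obtain ⟨n, hn⟩ := (hlim.eventually_lt_const (ENNReal.ofReal_pos.2 hδ)).exists
    refine ⟨n, fun ℓ hℓ hne B x y hB hν => ?_⟩
    obtain ⟨hl, hs⟩ := hG.contract ℓ hℓ hne n
    refine H _ hl _ _ _ (hB.image (G n)) ?_
    rw [hs _ _ _ hB]
    exact (mul_le_mul' le_rfl hν).trans_lt hn
  choose n hn using hex
  let f : ℕ → S → ℝ := fun j x => φ j (G (n j) x)
  have hfm : ∀ j, Measurable (f j) := fun j =>
    ((φ j).continuous.comp (G (n j)).continuous).measurable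
  have hfint : ∀ j, ∫⁻ x, ‖χ x - f j x‖ₑ ∂μ ≤ ε j := fun j => by
    have hχG : ∀ x, χ x = χ (G (n j) x) := fun x => by
      have : x ∈ A ↔ G (n j) x ∈ A := by rw [← mem_preimage, hinv]
      by_cases hx : x ∈ A
      · rw [hχ1 _ hx, hχ1 _ (this.1 hx)]
      · rw [hχ0 _ hx, hχ0 _ (mt this.2 hx)]
    calc ∫⁻ x, ‖χ x - f j x‖ₑ ∂μ
        = ∫⁻ x, ‖χ (G (n j) x) - φ j (G (n j) x)‖ₑ ∂μ := by
          refine lintegral_congr fun x => ?_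
          rw [hχG x]
      _ = ∫⁻ x, ‖χ x - φ j x‖ₑ ∂μ :=
          (hG.measurePreserving (n j)).lintegral_comp_emb (G (n j)).measurableEmbedding
            fun x => ‖χ x - φ j x‖ₑ
      _ ≤ ε j := hφ j
  have hχm : Measurable χ := measurable_const.indicator hA
  have hae : ∀ᵐ x ∂μ, Tendsto (fun j => f j x) atTop (𝓝 (χ x)) := by
    have hm : ∀ j, Measurable fun x => ‖χ x - f j x‖ₑ := fun j => (hχm.sub (hfm j)).enorm
    have hfin : ∫⁻ x, ∑' j, ‖χ x - f j x‖ₑ ∂μ ≠ ⊤ := by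
      rw [lintegral_tsum fun j => (hm j).aemeasurable]
      exact ((ENNReal.tsum_le_tsum hfint).trans_lt (hsum.trans ENNReal.one_lt_top)).ne
    filter_upwards [ae_lt_top (Measurable.tsum hm) hfin] with x hx
    have h2 := ENNReal.tendsto_atTop_zero_of_tsum_ne_top hx.ne
    rw [tendsto_iff_edist_tendsto_0]
    exact h2.congr fun j => by rw [edist_comm, edist_eq_enorm_sub]
  refine ⟨D₁ ∩ {x | Tendsto (fun j => f j x) atTop (𝓝 1)},
    hG.measurable₁.inter (measurableSet_tendsto (𝓝 1) hfm), ?_, ?_⟩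
  · have hD : ∀ᵐ x ∂μ, x ∈ D₁ := hG.null₁
    filter_upwards [hae, hD] with x hx hxD
    refine propext ⟨fun h => ?_, fun h => ⟨hxD, ?_⟩⟩
    · by_contra hxA
      have : (1 : ℝ) = χ x := tendsto_nhds_unique h.2 hx
      rw [hχ0 x hxA] at this
      exact one_ne_zero this
    · rwa [hχ1 x h] at hx
  · rintro ℓ hℓ ⟨x, hxℓ, hxD, hx⟩ y hy
    have hne : (ℓ ∩ D₁).Nonempty := ⟨x, hxℓ, hxD⟩
    refine ⟨hG.saturated₁ ℓ hℓ hne hy, ?_⟩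
    obtain ⟨B, hB⟩ := T₁.exists_arc hℓ hxℓ hy
    obtain ⟨L, hL⟩ := ENNReal.exists_nat_gt (T₁.ν_arc_finite ℓ hℓ _ _ _ hB).ne
    have hz : Tendsto (fun j => f j y - f j x) atTop (𝓝 0) := by
      refine squeeze_zero_norm' ?_ tendsto_one_div_add_atTop_nhds_zero_nat
      filter_upwards [eventually_ge_atTop L] with j hj
      rw [Real.norm_eq_abs, abs_sub_comm]
      exact (hn j ℓ hℓ hne B x y hB (hL.le.trans (Nat.cast_le.2 hj))).le
    simpa using hz.add hx

namespace Tartan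

variable {R : Tartan T₁ T₂}

lemma mem_box_core {𝔰 A w Y} (h𝔰 : 𝔰 ∈ R.fibs) (hw : w ∈ R.core) (hA : A ∈ R.fibs) (hwA : w ∈ A)
    (hY : (A ∩ Y).Nonempty) : w ∈ R.box (𝔰 ∩ R.core) Y := by
  obtain ⟨B, hB, hwB⟩ := R.exists_fibu hw
  obtain ⟨z, hz, hz'⟩ := R.exists_inter h𝔰 hB
  exact ⟨hw, ⟨B, hB, hwB, z, hz', hz, R.mem_core h𝔰 hB hz hz'⟩, A, hA, hwA, hY⟩

/-- A set which is, up to null sets, both a union of stable and a union of unstable streamlines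
has null or full measure in the core of a compatible tartan. -/
theorem Compatible.measure_core_inter_or (hR : R.Compatible) {A A' : Set S}
    (hA : MeasurableSet A) (hA' : MeasurableSet A')
    (hsat : ∀ ℓ ∈ T₁.lines, (ℓ ∩ A).Nonempty → ℓ ⊆ A)
    (hsat' : ∀ ℓ ∈ T₂.lines, (ℓ ∩ A').Nonempty → ℓ ⊆ A') (hAA' : A =ᵐ[μ] A') :
    μ (R.core ∩ A) = 0 ∨ μ (R.core \ A) = 0 := by
  rcases R.core.eq_empty_or_nonempty with h | ⟨v, hv⟩
  · simp [h]
  obtain ⟨𝔰, h𝔰, -⟩ := R.exists_fibs hv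
  obtain ⟨𝔲, h𝔲, -⟩ := R.exists_fibu hv
  obtain ⟨ℓs, hℓs, x₁, x₂, harcs⟩ := R.fibs_isArc h𝔰
  obtain ⟨ℓu, hℓu, y₁, y₂, harcu⟩ := R.swap.fibs_isArc h𝔲
  have hXm : MeasurableSet (𝔰 ∩ R.core) := harcs.measurableSet.inter R.measurableSet_core
  have hYm : MeasurableSet (𝔲 ∩ R.core) := harcu.measurableSet.inter R.measurableSet_core
  have hbox : ∀ {X Y}, MeasurableSet X → X ⊆ 𝔰 ∩ R.core → MeasurableSet Y → Y ⊆ 𝔲 ∩ R.core →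
      μ (R.box X Y) = T₁.ν ℓs X * T₂.ν ℓu Y := fun hX hX' hY hY' =>
    (hR.measure_box h𝔰 h𝔲 hℓs harcs.subset hℓu harcu.subset hX hX' hY hY').2
  have hrow : ∀ {B}, B ∈ R.fibs → (B ∩ A).Nonempty → B ⊆ A := by
    rintro B hB ⟨t, ht, htA⟩
    obtain ⟨ℓ, hℓ, a, b, hab⟩ := R.fibs_isArc hB
    exact hab.subset.trans (hsat ℓ hℓ ⟨t, hab.subset ht, htA⟩)
  have hcol : ∀ {B}, B ∈ R.fibu → (B ∩ A').Nonempty → B ⊆ A' := by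
    rintro B hB ⟨t, ht, htA⟩
    obtain ⟨ℓ, hℓ, a, b, hab⟩ := R.swap.fibs_isArc hB
    exact hab.subset.trans (hsat' ℓ hℓ ⟨t, hab.subset ht, htA⟩)
  have hnull : μ (R.box ((𝔰 ∩ R.core) ∩ A') ((𝔲 ∩ R.core) \ A)) = 0 := by
    refine measure_mono_null ?_ (ae_le_set.1 hAA'.symm.le)
    rintro w ⟨-, ⟨B, hB, hwB, z, hz, hz'⟩, C, hC, hwC, t, ht, ht'⟩
    exact ⟨hcol hB ⟨z, hz, hz'.2⟩ hwB, fun hwA => ht'.2 (hrow hC ⟨w, hwC, hwA⟩ ht)⟩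
  have hnull' : μ (R.box ((𝔰 ∩ R.core) \ A') ((𝔲 ∩ R.core) ∩ A)) = 0 := by
    refine measure_mono_null ?_ (ae_le_set.1 hAA'.le)
    rintro w ⟨-, ⟨B, hB, hwB, z, hz, hz'⟩, C, hC, hwC, t, ht, ht'⟩
    exact ⟨hrow hC ⟨t, ht, ht'.2⟩ hwC, fun hwA => hz'.2 (hcol hB ⟨w, hwB, hwA⟩ hz)⟩
  rw [hbox (hXm.inter hA') inter_subset_left (hYm.diff hA) sdiff_subset, mul_eq_zero] at hnull
  rw [hbox (hXm.diff hA') sdiff_subset (hYm.inter hA) inter_subset_left, mul_eq_zero] at hnull'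
  have hcase : ∀ Y ⊆ 𝔲 ∩ R.core, MeasurableSet Y → T₂.ν ℓu Y = 0 →
      μ (R.box (𝔰 ∩ R.core) Y) = 0 := fun Y hY hYm h => by
    rw [hbox hXm subset_rfl hYm hY, h, mul_zero]
  rcases hnull' with hX' | hY
  · rcases hnull with hX | hY
    · left
      have h0 : T₁.ν ℓs (𝔰 ∩ R.core) = 0 := by
        rw [← measure_inter_add_sdiff _ hA', hX, hX', add_zero]
      have hb := hbox hXm subset_rfl hYm subset_rfl
      rw [h0, zero_mul] at hb
      refine measure_mono_null ?_ hb
      rintro w ⟨hw, -⟩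
      obtain ⟨B, hB, hwB⟩ := R.exists_fibs hw
      obtain ⟨t, ht, ht'⟩ := R.exists_inter hB h𝔲
      exact mem_box_core h𝔰 hw hB hwB ⟨t, ht, ht', R.mem_core hB h𝔲 ht ht'⟩
    · right
      refine measure_mono_null ?_ (hcase _ sdiff_subset (hYm.diff hA) hY)
      rintro w ⟨hw, hwA⟩
      obtain ⟨B, hB, hwB⟩ := R.exists_fibs hw
      obtain ⟨t, ht, ht'⟩ := R.exists_inter hB h𝔲
      exact mem_box_core h𝔰 hw hB hwB ⟨t, ht, ⟨ht', R.mem_core hB h𝔲 ht ht'⟩,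
        fun htA => hwA (hrow hB ⟨t, ht, htA⟩ hwB)⟩
  · left
    refine measure_mono_null ?_ (hcase _ inter_subset_left (hYm.inter hA) hY)
    rintro w ⟨hw, hwA⟩
    obtain ⟨B, hB, hwB⟩ := R.exists_fibs hw
    obtain ⟨t, ht, ht'⟩ := R.exists_inter hB h𝔲
    exact mem_box_core h𝔰 hw hB hwB ⟨t, ht, ⟨ht', R.mem_core hB h𝔲 ht ht'⟩,
      hrow hB ⟨w, hwB, hwA⟩ ht⟩

end Tartan

lemma FullPair.swap (h : FullPair T₁ T₂) : FullPair T₂ T₁ := by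
  obtain ⟨⟨R, hR, hfull⟩, h2⟩ := h
  refine ⟨⟨fun i => (R i).swap, fun i => (hR i).swap, ?_⟩, fun U hU hne => ?_⟩
  · simpa only [Tartan.core_swap] using hfull
  · obtain ⟨Q, hQ, hpos, hsub⟩ := h2 U hU hne
    refine ⟨Q.swap, hQ.swap, by rwa [Tartan.core_swap], ?_⟩
    rw [union_comm]
    exact hsub

lemma FullPair.exists_core_inter [IsProbabilityMeasure μ] (h : FullPair T₁ T₂) {A : Set S}
    (hA : μ A ≠ 0) : ∃ R : Tartan T₁ T₂, R.Compatible ∧ μ (R.core ∩ A) ≠ 0 := by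
  obtain ⟨⟨R, hR, hfull⟩, -⟩ := h
  by_contra! H
  have h0 : μ (⋃ i, (R i).core)ᶜ = 0 :=
    (prob_compl_eq_zero_iff (MeasurableSet.iUnion fun i => (R i).measurableSet_core)).2 hfull
  refine hA (measure_mono_null (fun x hx => ?_)
    (measure_union_null h0 (measure_iUnion_null fun i => H (R i) (hR i))))
  by_cases hc : x ∈ ⋃ i, (R i).core
  · obtain ⟨i, hi⟩ := mem_iUnion.1 hc
    exact Or.inr (mem_iUnion.2 ⟨i, hi, hx⟩)
  · exact Or.inl hc

end Hopf

/-- a measurable pseudo-Anosov map whose turbulations satisfy the chain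
version of the tartan connection hypothesis is ergodic. -/
theorem mpa_ergodic_of_tartan_chains
    {S : Type} [TopologicalSpace S] [T2Space S] [CompactSpace S]
    [ChartedSpace (EuclideanHalfSpace 2) S] [MeasurableSpace S] [BorelSpace S]
    (μ : Measure S) [IsProbabilityMeasure μ] (hμ : IsOUMeasure μ)
    (Ts Tu : MeasuredTurbulation μ) (F : S ≃ₜ S) (lam : ℝ)
    (hF : IsMPA μ F Ts Tu lam)
    (hchain : ∀ R Q : Tartan Ts Tu, R.Compatible → 0 < μ R.core →
      Q.Compatible → 0 < μ Q.core →
      ∃ k : ℕ, ∃ T : Fin (k + 1) → Tartan Ts Tu, T 0 = R ∧ T (Fin.last k) = Q ∧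
        (∀ i, (T i).Compatible ∧ 0 < μ (T i).core) ∧
        ∀ i : Fin k,
          0 < μ (stableSaturation (T i.castSucc) ∩ unstableSaturation (T i.succ))) :
    ∀ A : Set S, MeasurableSet A → ⇑F '' A = A → μ A = 0 ∨ μ A = 1 := by
  intro A hA hFA
  have : SecondCountableTopology (EuclideanHalfSpace 2) :=
    inferInstanceAs (SecondCountableTopology {x : EuclideanSpace ℝ (Fin 2) // 0 ≤ x 0})
  have : SecondCountableTopology S :=
    ChartedSpace.secondCountable_of_sigmaCompact (EuclideanHalfSpace 2) S
  obtain ⟨-, hts, htu, hfull, -⟩ := hF.turbulations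
  have hpow : ∀ n : ℕ, ⇑(F ^ n) '' A = A := by
    intro n
    induction n with
    | zero => rw [pow_zero]; exact image_id A
    | succ n ih =>
      calc ⇑(F ^ (n + 1)) '' A = F '' (⇑(F ^ n) '' A) := by rw [pow_succ', image_image]; rfl
        _ = A := by rw [ih, hFA]
  obtain ⟨As, hAsm, hAs, hsat⟩ := hF.contracts.exists_saturated hts hA fun n => by
    conv_lhs => rw [← hpow n]
    exact preimage_image_eq _ (F ^ n).injective
  obtain ⟨Au, hAum, hAu, hsatu⟩ := hF.contracts_symm.exists_saturated htu hA fun n => by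
    rw [← Homeomorph.image_eq_preimage_symm, hpow n]
  have hsu : As =ᵐ[μ] Au := hAs.trans hAu.symm
  have hdich : ∀ R : Tartan Ts Tu, R.Compatible → μ (R.core ∩ As) = 0 ∨ μ (R.core \ As) = 0 :=
    fun R hR => hR.measure_core_inter_or hAsm hAum hsat hsatu hsu
  by_contra! hcon
  obtain ⟨R, hR, hRA⟩ := hfull.exists_core_inter (A := As) (by rw [measure_congr hAs]; exact hcon.1)
  obtain ⟨Q, hQ, hQA⟩ := hfull.exists_core_inter (A := Asᶜ) (by
    rw [Ne, prob_compl_eq_zero_iff hAsm, measure_congr hAs]; exact hcon.2)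
  obtain ⟨k, T, hT0, hTk, hT, hTi⟩ := hchain R Q hR
    ((pos_iff_ne_zero.2 hRA).trans_le (measure_mono inter_subset_left)) hQ
    ((pos_iff_ne_zero.2 hQA).trans_le (measure_mono inter_subset_left))
  have hstep : ∀ i : Fin k, μ ((T i.castSucc).core \ As) = 0 → μ ((T i.succ).core \ As) = 0 := by
    intro i hi
    refine (hdich _ (hT i.succ).1).resolve_left fun hi' => (hTi i).ne' ?_
    have hs : μ (stableSaturation (T i.castSucc) ∩ Asᶜ) = 0 :=
      hF.contracts.measure_stableSaturation_inter hfull hts htu (hT _).1 (hT _).2 hAsm.compl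
        (fun ℓ hℓ ⟨x, hxℓ, hxA⟩ y hy hyA => hxA (hsat ℓ hℓ ⟨y, hy, hyA⟩ hxℓ)) hi
    have hu : μ (unstableSaturation (T i.succ) ∩ Au) = 0 := by
      rw [← Tartan.stableSaturation_swap]
      refine hF.contracts_symm.measure_stableSaturation_inter hfull.swap htu hts
        (hT _).1.swap ?_ hAum hsatu ?_
      · rw [Tartan.core_swap]; exact (hT _).2
      · rw [Tartan.core_swap, ← hi']
        exact measure_congr ((ae_eq_refl _).inter hsu.symm)
    refine measure_mono_null ?_
      (measure_union_null hs (measure_union_null hu (ae_le_set.1 hsu.le)))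
    rintro x ⟨hxs, hxu⟩
    by_cases hx : x ∈ As
    · by_cases hx' : x ∈ Au
      · exact Or.inr (Or.inl ⟨hxu, hx'⟩)
      · exact Or.inr (Or.inr ⟨hx, hx'⟩)
    · exact Or.inl ⟨hxs, hx⟩
  have hall : ∀ i, μ ((T i).core \ As) = 0 := fun i => by
    induction i using Fin.induction with
    | zero => rw [hT0]; exact (hdich R hR).resolve_left hRA
    | succ i ih => exact hstep i ih
  exact hQA (hTk ▸ hall (Fin.last k))

end
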